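/- arXiv:1705.04611 — 3 statements merged into one kernel-verified Lean document; each statement's English description precedes it below -/
import Mathlib

section
/- For every integer k ≥ 1, the group of invertible elements of the matrix ring M_k(T_1) over the Toeplitz algebra T_1 (the C*-algebra generated by the unilateral shift on ℓ²(ℕ)), equipped with the topology induced by the operator norm, is connected. -/
noncomputable section

/-- `ℓ²(ℕ)`. -/
abbrev H1 : Type := lp (fun _ : ℕ => ℂ) 2

/-- the standard basis vector `δ_j`. -/
def delta1 (j : ℕ) : H1 := lp.single 2 j 1

/-- `T` is the unilateral shift: `T δ_j = δ_{j+1}`. -/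
def IsShift1 (T : H1 →L[ℂ] H1) : Prop := ∀ j : ℕ, T (delta1 j) = delta1 (j + 1)

/-- The Toeplitz algebra `T_1`: the smallest norm-closed star-subalgebra of `B(ℓ²(ℕ))`
containing the unilateral shift. -/
def Toeplitz1 : StarSubalgebra ℂ (H1 →L[ℂ] H1) :=
  (StarAlgebra.adjoin ℂ {T : H1 →L[ℂ] H1 | IsShift1 T}).topologicalClosure

open Filter Topology

section IdentityComponent

/-- The elements of `R` that are units lying in the connected component of `1` of `Rˣ`. -/
def idComp (R : Type*) [Ring R] [TopologicalSpace R] [IsTopologicalRing R] : Submonoid R :=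
  (Subgroup.connectedComponentOfOne Rˣ).toSubmonoid.map (Units.coeHom R)

variable {R : Type*} [Ring R] [TopologicalSpace R] [IsTopologicalRing R]

theorem mem_idComp {a : R} :
    a ∈ idComp R ↔ ∃ u ∈ Subgroup.connectedComponentOfOne Rˣ, (u : R) = a := Iff.rfl

theorem exists_inv_of_mem_idComp {a : R} (ha : a ∈ idComp R) :
    ∃ b ∈ idComp R, a * b = 1 ∧ b * a = 1 := by
  obtain ⟨u, hu, rfl⟩ := mem_idComp.1 ha
  exact ⟨(u⁻¹ : Rˣ), mem_idComp.2 ⟨u⁻¹, inv_mem hu, rfl⟩, u.mul_inv, u.inv_mul⟩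

theorem map_mem_idComp {R' : Type*} [Ring R'] [TopologicalSpace R']
    [IsTopologicalRing R'] (f : R →* R') (hf : Continuous f) {a : R}
    (ha : a ∈ idComp R) : f a ∈ idComp R' := by
  obtain ⟨u, hu, rfl⟩ := mem_idComp.1 ha
  refine mem_idComp.2 ⟨Units.map f u, ?_, rfl⟩
  have hc : Continuous (Units.map f) := hf.units_map f
  have h := hc.image_connectedComponent_subset (1 : Rˣ) ⟨u, hu, rfl⟩
  rwa [map_one] at h

/-- The units of `R` carry the subspace topology, and their identity component is a neighbourhood
of `1` in `R`. -/
class LocallyConnectedUnits (R : Type*) [Ring R] [TopologicalSpace R] [IsTopologicalRing R] :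
    Prop where
  isInducing_val : IsInducing (Units.val : Rˣ → R)
  one_sub_mem : ∀ᶠ x in 𝓝 (0 : R), 1 - x ∈ idComp R

/-- A unit joined to `1` by a preconnected set of units lies in the identity component. -/
theorem mem_idComp_of_isPreconnected' (hv : IsInducing (Units.val : Rˣ → R)) {s : Set R}
    (hs : IsPreconnected s) (hu : ∀ x ∈ s, IsUnit x) (h1 : (1 : R) ∈ s) {a : R}
    (ha : a ∈ s) : a ∈ idComp R := by
  obtain ⟨u, rfl⟩ := hu a ha
  refine mem_idComp.2 ⟨u, ?_, rfl⟩
  have himg : Units.val '' (Units.val ⁻¹' s : Set Rˣ) = s := by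
    rw [Set.image_preimage_eq_iff]
    exact fun x hx => hu x hx
  have hp : IsPreconnected (Units.val ⁻¹' s : Set Rˣ) := by
    rw [← hv.isPreconnected_image, himg]
    exact hs
  exact hp.subset_connectedComponent (x := 1) (by simpa using h1) ha

variable [LocallyConnectedUnits R]

theorem mem_idComp_of_isPreconnected {s : Set R} (hs : IsPreconnected s)
    (hu : ∀ x ∈ s, IsUnit x) (h1 : (1 : R) ∈ s) {a : R} (ha : a ∈ s) : a ∈ idComp R :=
  mem_idComp_of_isPreconnected' LocallyConnectedUnits.isInducing_val hs hu h1 ha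

theorem exists_mem_idComp_of_mem_closure {s : Set R} {a : R} (ha : IsUnit a)
    (hs : a ∈ closure s) : ∃ b ∈ s, ∃ g ∈ idComp R, b = a * g := by
  obtain ⟨u, rfl⟩ := ha
  have hcont : Continuous fun b : R => 1 - (u⁻¹ : Rˣ) * b := by fun_prop
  have hev : ∀ᶠ b : R in 𝓝 (u : R), 1 - (1 - (u⁻¹ : Rˣ) * b) ∈ idComp R :=
    (hcont.tendsto' (u : R) 0 (by simp)).eventually LocallyConnectedUnits.one_sub_mem
  obtain ⟨b, hb, hbs⟩ := (hev.and_frequently (mem_closure_iff_frequently.1 hs)).exists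
  exact ⟨b, hbs, _, hb, by simp⟩

end IdentityComponent

section Normed

variable {R : Type*} [NormedRing R] [NormedAlgebra ℂ R] [CompleteSpace R]

theorem one_sub_mem_idComp {x : R} (hx : ‖x‖ < 1) : 1 - x ∈ idComp R := by
  refine mem_idComp_of_isPreconnected' Units.isOpenEmbedding_val.isInducing
    (((convex_closedBall (0 : ℂ) 1).isPreconnected).image (fun t : ℂ => 1 - t • x) (by fun_prop))
    ?_ ⟨0, by simp, by simp⟩ ⟨1, by simp, by simp⟩
  rintro _ ⟨t, ht, rfl⟩
  refine isUnit_one_sub_of_norm_lt_one ?_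
  rw [norm_smul]
  rw [mem_closedBall_zero_iff] at ht
  nlinarith [norm_nonneg x]

variable (R) in
theorem locallyConnectedUnits_of_normedAlgebra : LocallyConnectedUnits R where
  isInducing_val := Units.isOpenEmbedding_val.isInducing
  one_sub_mem := by
    filter_upwards [Metric.ball_mem_nhds (0 : R) one_pos] with x hx
    exact one_sub_mem_idComp (by simpa using hx)

instance : LocallyConnectedUnits R := locallyConnectedUnits_of_normedAlgebra R

instance {n : Type*} [Fintype n] [DecidableEq n] : LocallyConnectedUnits (Matrix n n R) :=
  have : CompleteSpace (Matrix n n R) := inferInstance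
  @locallyConnectedUnits_of_normedAlgebra (Matrix n n R) Matrix.linftyOpNormedRing
    Matrix.linftyOpNormedAlgebra this

end Normed

section IdentityComponentAlgebra

variable {R : Type*} [Ring R] [TopologicalSpace R] [IsTopologicalRing R] [Algebra ℂ R]
  [ContinuousSMul ℂ R] [LocallyConnectedUnits R]

theorem one_add_mem_idComp_of_mul_self_eq_zero {x : R} (hx : x * x = 0) : 1 + x ∈ idComp R := by
  refine mem_idComp_of_isPreconnected (s := Set.range fun t : ℂ => 1 + t • x)
    (isPreconnected_range (by fun_prop)) ?_ ⟨0, by simp⟩ ⟨1, by simp⟩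
  rintro _ ⟨t, rfl⟩
  exact ⟨⟨1 + t • x, 1 - t • x, by simp [mul_sub, add_mul, hx],
    by simp [mul_add, sub_mul, hx]⟩, rfl⟩

theorem algebraMap_mem_idComp {c : ℂ} (hc : c ≠ 0) : algebraMap ℂ R c ∈ idComp R := by
  have h : IsPreconnected ({0}ᶜ : Set ℂ) :=
    ((Set.countable_singleton (0 : ℂ)).isPathConnected_compl_of_one_lt_rank
      (by simp)).isConnected.isPreconnected
  refine mem_idComp_of_isPreconnected (h.image (algebraMap ℂ R)
    (continuous_algebraMap ℂ R).continuousOn) ?_ ⟨1, by simp⟩ ⟨c, by simpa using hc, rfl⟩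
  rintro _ ⟨t, ht, rfl⟩
  exact (IsUnit.mk0 t ht).map (algebraMap ℂ R)

/-- A unit `1 + x` with `x` algebraic lies in the identity component: `1 + t x` is invertible for
all but finitely many `t : ℂ`. -/
theorem one_add_mem_idComp_of_isAlgebraic {x : R} (hx : IsAlgebraic ℂ x) (hu : IsUnit (1 + x)) :
    1 + x ∈ idComp R := by
  obtain ⟨p, hp0, hp⟩ := hx
  set s : Set ℂ := {t | ¬ IsUnit (1 + t • x)} with hs
  have hfin : s.Finite := by
    refine ((p.rootSet_finite ℂ).image fun z => -z⁻¹).subset fun t ht => ?_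
    have ht0 : t ≠ 0 := by
      rintro rfl
      simp [hs] at ht
    refine ⟨-t⁻¹, ?_, by simp⟩
    have hsp : -t⁻¹ ∈ spectrum ℂ x := by
      rw [spectrum.mem_iff]
      intro hun
      apply ht
      have := hun.neg.smul (Units.mk0 t ht0)
      convert this using 1
      simp only [Units.smul_def, Units.val_mk0, neg_sub, smul_sub, map_neg,
        Algebra.algebraMap_eq_smul_one, smul_neg, smul_smul]
      simp [mul_inv_cancel₀ ht0, add_comm]
    have h := spectrum.subset_polynomial_aeval x p ⟨_, hsp, rfl⟩
    rw [hp] at h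
    have hne : Nontrivial R := by
      by_contra hcon
      rw [not_nontrivial_iff_subsingleton] at hcon
      exact ht (isUnit_of_subsingleton _)
    rw [spectrum.zero_eq] at h
    rw [Polynomial.mem_rootSet]
    exact ⟨hp0, by simpa using h⟩
  have hpre := (hfin.countable.isPathConnected_compl_of_one_lt_rank
      (by simp)).isConnected.isPreconnected
  refine mem_idComp_of_isPreconnected (hpre.image (fun t : ℂ => 1 + t • x) (by fun_prop)) ?_
    ⟨0, by simp [hs], by simp⟩ ⟨1, by simpa [hs] using hu, by simp⟩
  rintro _ ⟨t, ht, rfl⟩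
  simpa [hs] using ht

end IdentityComponentAlgebra

section ToeplitzPair

/-- `S` and `S'` behave like the unilateral shift and its adjoint: `S'` is a left inverse of `S`,
their powers are contractive, they generate a dense subalgebra, and the corner cut out by
`1 - S S'` is one-dimensional. -/
structure ToeplitzPair {R : Type*} [NormedRing R] [NormedAlgebra ℂ R] (S S' : R) : Prop where
  mul_eq_one : S' * S = 1
  norm_pow_le : ∀ n : ℕ, ‖S ^ n‖ ≤ 1
  norm_pow_le' : ∀ n : ℕ, ‖S' ^ n‖ ≤ 1
  dense : Dense (Algebra.adjoin ℂ {S, S'} : Set R)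
  corner : ∀ t : R, ∃ c : ℂ, (1 - S * S') * t * (1 - S * S') = c • (1 - S * S')

namespace ToeplitzPair

variable {R : Type*} [NormedRing R] [NormedAlgebra ℂ R] {S S' : R}

theorem pow_mul_pow (h : ToeplitzPair S S') (n : ℕ) : S' ^ n * S ^ n = 1 := by
  induction n with
  | zero => simp
  | succ n ih =>
    rw [pow_succ, pow_succ', mul_assoc, ← mul_assoc S', h.mul_eq_one, one_mul, ih]

theorem pow_mul_pow_add (h : ToeplitzPair S S') (n m : ℕ) : S' ^ n * S ^ (n + m) = S ^ m := by
  rw [pow_add, ← mul_assoc, h.pow_mul_pow, one_mul]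

/-- The ideal of all `t` with `t S ^ n → 0`; in the Toeplitz algebra these are the compact
operators. -/
def compactIdeal (_h : ToeplitzPair S S') : Ideal R where
  carrier := {t | Tendsto (fun n : ℕ => t * S ^ n) atTop (𝓝 0)}
  add_mem' {a b} ha hb := by
    simpa [add_mul] using Tendsto.add (show Tendsto _ _ _ from ha) hb
  zero_mem' := by simp
  smul_mem' c t ht := by
    simpa [mul_assoc] using Tendsto.const_mul c (show Tendsto _ _ _ from ht)

theorem mem_compactIdeal (h : ToeplitzPair S S') {t : R} :
    t ∈ h.compactIdeal ↔ Tendsto (fun n : ℕ => t * S ^ n) atTop (𝓝 0) := Iff.rfl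

theorem mem_compactIdeal_of_mul_pow_eq_zero (h : ToeplitzPair S S') {t : R} {N : ℕ}
    (ht : t * S ^ N = 0) : t ∈ h.compactIdeal := by
  rw [mem_compactIdeal]
  refine tendsto_const_nhds.congr' ?_
  filter_upwards [eventually_ge_atTop N] with n hn
  obtain ⟨m, rfl⟩ := Nat.exists_eq_add_of_le hn
  rw [pow_add, ← mul_assoc, ht, zero_mul]

theorem mul_mem_compactIdeal_of_mem_adjoin (h : ToeplitzPair S S') {b : R}
    (hb : b ∈ Algebra.adjoin ℂ {S, S'}) : ∀ a ∈ h.compactIdeal, a * b ∈ h.compactIdeal := by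
  induction hb using Algebra.adjoin_induction with
  | mem x hx =>
    intro a ha
    rw [mem_compactIdeal] at ha ⊢
    rcases hx with rfl | rfl
    · exact (ha.comp (tendsto_add_atTop_nat 1)).congr fun n => by
        simp [pow_succ', mul_assoc]
    · rw [← tendsto_add_atTop_iff_nat 1]
      refine ha.congr fun n => ?_
      rw [pow_succ', mul_assoc, ← mul_assoc x, h.mul_eq_one, one_mul]
  | algebraMap r =>
    intro a ha
    rw [← Algebra.commutes]
    exact h.compactIdeal.mul_mem_left _ ha
  | add x y _ _ hx hy =>
    intro a ha
    rw [mul_add]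
    exact add_mem (hx a ha) (hy a ha)
  | mul x y _ _ hx hy =>
    intro a ha
    rw [← mul_assoc]
    exact hy _ (hx a ha)

instance isTwoSided_compactIdeal (h : ToeplitzPair S S') : h.compactIdeal.IsTwoSided where
  mul_mem_of_left {a} b ha := by
    rw [mem_compactIdeal, Metric.tendsto_atTop]
    intro ε hε
    have hδ : 0 < ε / (2 * (‖a‖ + 1)) := by positivity
    obtain ⟨c, hc, hcb⟩ := Metric.mem_closure_iff.1 (h.dense b) _ hδ
    have hac := h.mul_mem_compactIdeal_of_mem_adjoin hc a ha
    rw [mem_compactIdeal, Metric.tendsto_atTop] at hac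
    obtain ⟨N, hN⟩ := hac (ε / 2) (by positivity)
    refine ⟨N, fun n hn => ?_⟩
    have h1 := hN n hn
    rw [dist_zero_right] at h1 ⊢
    have h2 : ‖a * (b - c) * S ^ n‖ ≤ ‖a‖ * ‖b - c‖ := by
      calc ‖a * (b - c) * S ^ n‖ ≤ ‖a‖ * ‖b - c‖ * ‖S ^ n‖ :=
            (norm_mul_le _ _).trans (by gcongr; exact norm_mul_le _ _)
        _ ≤ ‖a‖ * ‖b - c‖ * 1 := by gcongr; exact h.norm_pow_le n
        _ = _ := mul_one _
    have h3 : ‖a‖ * ‖b - c‖ ≤ ε / 2 := by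
      rw [dist_eq_norm] at hcb
      calc ‖a‖ * ‖b - c‖ ≤ (‖a‖ + 1) * (ε / (2 * (‖a‖ + 1))) := by
            gcongr
            linarith
        _ = ε / 2 := by
            have : ‖a‖ + 1 ≠ 0 := by positivity
            field_simp
    calc ‖a * b * S ^ n‖ = ‖a * (b - c) * S ^ n + a * c * S ^ n‖ := by
          congr 1
          noncomm_ring
      _ ≤ ‖a * (b - c) * S ^ n‖ + ‖a * c * S ^ n‖ := norm_add_le _ _
      _ < ε := by linarith

/-- The symbol map. -/
abbrev symbol (h : ToeplitzPair S S') : R →+* R ⧸ h.compactIdeal :=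
  Ideal.Quotient.mk h.compactIdeal

theorem symbol_eq_symbol_of_mul_pow_eq (h : ToeplitzPair S S') {a b : R} {N : ℕ}
    (hab : a * S ^ N = b * S ^ N) : h.symbol a = h.symbol b := by
  rw [symbol, Ideal.Quotient.mk_eq_mk_iff_sub_mem]
  exact h.mem_compactIdeal_of_mul_pow_eq_zero (N := N) (by rw [sub_mul, hab, sub_self])

/-- The symbol of `S`, as a unit. -/
def z (h : ToeplitzPair S S') : (R ⧸ h.compactIdeal)ˣ where
  val := h.symbol S
  inv := h.symbol S'
  val_inv := by
    rw [← map_mul, ← map_one h.symbol]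
    refine h.symbol_eq_symbol_of_mul_pow_eq (N := 1) ?_
    rw [pow_one, mul_assoc, h.mul_eq_one, mul_one, one_mul]
  inv_val := by rw [← map_mul, h.mul_eq_one, map_one]

theorem coe_z_inv (h : ToeplitzPair S S') :
    ((h.z⁻¹ : (R ⧸ h.compactIdeal)ˣ) : R ⧸ h.compactIdeal) = h.symbol S' := rfl

theorem coe_z (h : ToeplitzPair S S') : (h.z : R ⧸ h.compactIdeal) = h.symbol S := rfl

/-- The lift `S ^ m` (or `S' ^ (-m)` if `m < 0`) of `z ^ m`. -/
def zpowLift (_h : ToeplitzPair S S') (m : ℤ) : R := S ^ m.toNat * S' ^ (-m).toNat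

theorem symbol_zpowLift (h : ToeplitzPair S S') (m : ℤ) :
    h.symbol (h.zpowLift m) = (h.z ^ m : (R ⧸ h.compactIdeal)ˣ) := by
  obtain ⟨n, rfl | rfl⟩ := m.eq_nat_or_neg
  · simp [zpowLift, coe_z]
  · simp [zpowLift, ← inv_pow, coe_z_inv]

theorem zpowLift_mul_pow (h : ToeplitzPair S S') {m : ℤ} {N : ℕ} (hN : m.natAbs ≤ N) :
    h.zpowLift m * S ^ N = S ^ (N + m).toNat := by
  obtain ⟨n, rfl | rfl⟩ := m.eq_nat_or_neg
  · have : ((N : ℤ) + n).toNat = n + N := by omega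
    rw [this, pow_add]
    simp [zpowLift]
  · obtain ⟨k, rfl⟩ := Nat.exists_eq_add_of_le (show n ≤ N by omega)
    have : (((n + k : ℕ) : ℤ) + -n).toNat = k := by omega
    rw [this]
    simp [zpowLift, h.pow_mul_pow_add]

theorem exists_mul_pow_eq_aeval (h : ToeplitzPair S S') {t : R}
    (ht : t ∈ Algebra.adjoin ℂ {S, S'}) :
    ∃ (N : ℕ) (f : Polynomial ℂ), t * S ^ N = Polynomial.aeval S f := by
  induction ht using Algebra.adjoin_induction with
  | mem x hx =>
    rcases hx with rfl | rfl
    · exact ⟨0, Polynomial.X, by simp⟩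
    · exact ⟨1, 1, by simp [h.mul_eq_one]⟩
  | algebraMap r => exact ⟨0, Polynomial.C r, by simp⟩
  | add x y _ _ hx hy =>
    obtain ⟨N, f, hf⟩ := hx
    obtain ⟨M, g, hg⟩ := hy
    refine ⟨N + M, f * Polynomial.X ^ M + g * Polynomial.X ^ N, ?_⟩
    rw [add_mul, pow_add, ← mul_assoc, hf, ← pow_add, add_comm N M, pow_add, ← mul_assoc, hg]
    simp
  | mul x y _ _ hx hy =>
    obtain ⟨N, f, hf⟩ := hx
    obtain ⟨M, g, hg⟩ := hy
    refine ⟨M + N, f * g, ?_⟩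
    have hcomm : Polynomial.aeval S g * S ^ N = S ^ N * Polynomial.aeval S g := by
      have := congrArg (Polynomial.aeval S) (mul_comm g (Polynomial.X ^ N))
      simpa using this
    rw [pow_add, mul_assoc x, ← mul_assoc y, hg, hcomm, ← mul_assoc, hf, map_mul]

/-- The elements whose symbol is a power of `z` times the symbol of an element of the identity
component commuting with `z`. -/
def elliptic (h : ToeplitzPair S S') : Submonoid R where
  carrier := {t | ∃ u ∈ idComp R, ∃ m : ℤ, Commute (h.symbol u) h.z ∧
    h.symbol t = h.symbol u * (h.z ^ m : (R ⧸ h.compactIdeal)ˣ)}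
  one_mem' := ⟨1, one_mem _, 0, by simp, by simp⟩
  mul_mem' := by
    rintro a b ⟨u, hu, m, hum, ha⟩ ⟨v, hv, k, hvk, hb⟩
    refine ⟨u * v, mul_mem hu hv, m + k, ?_, ?_⟩
    · rw [map_mul]
      exact hum.mul_left hvk
    · have hc : h.symbol v * (h.z ^ m : (R ⧸ h.compactIdeal)ˣ) =
          (h.z ^ m : (R ⧸ h.compactIdeal)ˣ) * h.symbol v := hvk.units_zpow_right m
      rw [map_mul, ha, hb, map_mul, zpow_add, Units.val_mul, mul_assoc, mul_assoc,
        ← mul_assoc (h.symbol v), hc, mul_assoc]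

theorem mem_elliptic (h : ToeplitzPair S S') {t : R} :
    t ∈ h.elliptic ↔ ∃ u ∈ idComp R, ∃ m : ℤ, Commute (h.symbol u) h.z ∧
      h.symbol t = h.symbol u * (h.z ^ m : (R ⧸ h.compactIdeal)ˣ) := Iff.rfl

theorem mem_elliptic_of_symbol_eq (h : ToeplitzPair S S') {a b : R} (ha : a ∈ h.elliptic)
    (hab : h.symbol b = h.symbol a) : b ∈ h.elliptic := by
  rw [mem_elliptic] at ha ⊢
  rwa [hab]

theorem mem_elliptic_of_mem_idComp (h : ToeplitzPair S S') {u : R} (hu : u ∈ idComp R)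
    (hc : Commute (h.symbol u) h.z) : u ∈ h.elliptic :=
  ⟨u, hu, 0, hc, by simp⟩

theorem zpowLift_mem_elliptic (h : ToeplitzPair S S') (m : ℤ) : h.zpowLift m ∈ h.elliptic :=
  ⟨1, one_mem _, m, by simp, by simp [symbol_zpowLift]⟩

variable [CompleteSpace R]

theorem algebraMap_mem_closure_elliptic (h : ToeplitzPair S S') (c : ℂ) :
    algebraMap ℂ R c ∈ closure (h.elliptic : Set R) := by
  refine map_mem_closure (continuous_algebraMap ℂ R) (dense_compl_singleton (0 : ℂ) c) ?_
  intro x hx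
  refine h.mem_elliptic_of_mem_idComp (algebraMap_mem_idComp hx) ?_
  rw [coe_z]
  exact (Algebra.commute_algebraMap_left x S).map h.symbol

theorem sub_algebraMap_mem_closure_elliptic (h : ToeplitzPair S S') (c : ℂ) :
    S - algebraMap ℂ R c ∈ closure (h.elliptic : Set R) := by
  have hS : ‖S‖ ≤ 1 := by simpa using h.norm_pow_le 1
  have hS' : ‖S'‖ ≤ 1 := by simpa using h.norm_pow_le' 1
  rcases le_or_gt ‖c‖ 1 with hc | hc
  · have hcl : c ∈ closure (Metric.ball (0 : ℂ) 1) := by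
      rw [closure_ball _ one_ne_zero]
      simpa using hc
    have hcont : Continuous fun x : ℂ => S - algebraMap ℂ R x := by
      have := continuous_algebraMap ℂ R
      fun_prop
    refine map_mem_closure (f := fun x : ℂ => S - algebraMap ℂ R x) hcont hcl fun x hx => ?_
    rw [mem_ball_zero_iff] at hx
    have hx' : ‖x • S'‖ < 1 := by
      rw [norm_smul]
      nlinarith [norm_nonneg x]
    have heq : S - algebraMap ℂ R x = (1 - x • S') * h.zpowLift 1 := by
      simp [zpowLift, sub_mul, h.mul_eq_one, Algebra.algebraMap_eq_smul_one]
    change S - algebraMap ℂ R x ∈ h.elliptic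
    rw [heq]
    refine mul_mem (h.mem_elliptic_of_mem_idComp (one_sub_mem_idComp hx') ?_)
      (h.zpowLift_mem_elliptic 1)
    have hcz : Commute (h.symbol S') h.z := by
      rw [← coe_z_inv]
      exact (Commute.inv_left (Commute.refl h.z)).units_val
    rw [map_sub, map_one, Algebra.smul_def, map_mul]
    refine (Commute.one_left _).sub_left (Commute.mul_left ?_ hcz)
    exact (Algebra.commute_algebraMap_left x S).map h.symbol
  · have hc0 : c ≠ 0 := by
      rintro rfl
      norm_num at hc
    have hx' : ‖c⁻¹ • S‖ < 1 := by
      rw [norm_smul, norm_inv]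
      calc ‖c‖⁻¹ * ‖S‖ ≤ ‖c‖⁻¹ * 1 := by gcongr
        _ < 1 := by rw [mul_one]; exact inv_lt_one_of_one_lt₀ hc
    have heq : S - algebraMap ℂ R c = algebraMap ℂ R (-c) * (1 - c⁻¹ • S) := by
      simp [Algebra.algebraMap_eq_smul_one, smul_sub, smul_smul, hc0]
    refine subset_closure (h.mem_elliptic_of_mem_idComp ?_ ?_)
    · rw [heq]
      exact mul_mem (algebraMap_mem_idComp (neg_ne_zero.2 hc0)) (one_sub_mem_idComp hx')
    · exact ((Commute.refl S).sub_left (Algebra.commute_algebraMap_left c S)).map h.symbol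

theorem aeval_mem_closure_elliptic (h : ToeplitzPair S S') (f : Polynomial ℂ) :
    Polynomial.aeval S f ∈ closure (h.elliptic : Set R) := by
  change f ∈ h.elliptic.topologicalClosure.comap (Polynomial.aeval (R := ℂ) S)
  rw [(IsAlgClosed.splits f).eq_prod_roots]
  refine mul_mem ?_ (Submonoid.multiset_prod_mem _ _ fun p hp => ?_)
  · have hc : algebraMap ℂ R f.leadingCoeff ∈ h.elliptic.topologicalClosure :=
      h.algebraMap_mem_closure_elliptic f.leadingCoeff
    simpa using hc
  · obtain ⟨a, -, rfl⟩ := Multiset.mem_map.1 hp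
    have ha : S - algebraMap ℂ R a ∈ h.elliptic.topologicalClosure :=
      h.sub_algebraMap_mem_closure_elliptic a
    simpa using ha

theorem dense_elliptic (h : ToeplitzPair S S') : Dense (h.elliptic : Set R) := by
  rw [← dense_closure]
  refine h.dense.mono fun t ht => ?_
  obtain ⟨N, f, hf⟩ := h.exists_mul_pow_eq_aeval ht
  have hmem : Polynomial.aeval S f * S' ^ N ∈ closure (h.elliptic : Set R) := by
    have h1 : S' ^ N ∈ h.elliptic := by
      simpa [zpowLift] using h.zpowLift_mem_elliptic (-N)
    exact h.elliptic.topologicalClosure.mul_mem (h.aeval_mem_closure_elliptic f)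
      (subset_closure h1)
  have hsym : h.symbol (t - Polynomial.aeval S f * S' ^ N) = 0 := by
    rw [← map_zero h.symbol]
    refine h.symbol_eq_symbol_of_mul_pow_eq (N := N) ?_
    rw [sub_mul, mul_assoc, h.pow_mul_pow, mul_one, hf, sub_self, zero_mul]
  have := map_mem_closure (f := fun x => x + (t - Polynomial.aeval S f * S' ^ N))
    (by fun_prop) hmem (t := (h.elliptic : Set R))
    (fun x hx => h.mem_elliptic_of_symbol_eq hx (by rw [map_add, hsym, add_zero]))
  simpa using this

end ToeplitzPair

end ToeplitzPair

section MatrixToeplitz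

section Blocks

variable {R : Type*} [NormedRing R]
variable {m n : Type*} [Fintype m] [DecidableEq m] [Fintype n] [DecidableEq n]

theorem fromBlocks_mem_idComp {a : Matrix m m R} {d : Matrix n n R}
    (ha : a ∈ idComp (Matrix m m R)) (hd : d ∈ idComp (Matrix n n R)) :
    Matrix.fromBlocks a 0 0 d ∈ idComp (Matrix (m ⊕ n) (m ⊕ n) R) := by
  let f : Matrix m m R →* Matrix (m ⊕ n) (m ⊕ n) R :=
    { toFun := fun x => Matrix.fromBlocks x 0 0 1
      map_one' := Matrix.fromBlocks_one
      map_mul' := fun x y => by simp [Matrix.fromBlocks_multiply] }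
  let g : Matrix n n R →* Matrix (m ⊕ n) (m ⊕ n) R :=
    { toFun := fun x => Matrix.fromBlocks 1 0 0 x
      map_one' := Matrix.fromBlocks_one
      map_mul' := fun x y => by simp [Matrix.fromBlocks_multiply] }
  have hf : Continuous f := by
    change Continuous fun x : Matrix m m R => (Matrix.fromBlocks x 0 0 1 : Matrix (m ⊕ n) (m ⊕ n) R)
    fun_prop
  have hg : Continuous g := by
    change Continuous fun x : Matrix n n R => (Matrix.fromBlocks 1 0 0 x : Matrix (m ⊕ n) (m ⊕ n) R)
    fun_prop
  have h := mul_mem (map_mem_idComp f hf ha) (map_mem_idComp g hg hd)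
  simpa [f, g, Matrix.fromBlocks_multiply] using h

variable [NormedAlgebra ℂ R] [CompleteSpace R]

theorem fromBlocks_lower_mem_idComp (c : Matrix n m R) :
    Matrix.fromBlocks 1 0 c 1 ∈ idComp (Matrix (m ⊕ n) (m ⊕ n) R) := by
  have h := one_add_mem_idComp_of_mul_self_eq_zero
    (x := (Matrix.fromBlocks 0 0 c 0 : Matrix (m ⊕ n) (m ⊕ n) R))
    (by simp [Matrix.fromBlocks_multiply])
  rwa [← Matrix.fromBlocks_one, Matrix.fromBlocks_add, add_zero, add_zero, zero_add, add_zero] at h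

theorem fromBlocks_upper_mem_idComp (b : Matrix m n R) :
    Matrix.fromBlocks 1 b 0 1 ∈ idComp (Matrix (m ⊕ n) (m ⊕ n) R) := by
  have h := one_add_mem_idComp_of_mul_self_eq_zero
    (x := (Matrix.fromBlocks 0 b 0 0 : Matrix (m ⊕ n) (m ⊕ n) R))
    (by simp [Matrix.fromBlocks_multiply])
  rwa [← Matrix.fromBlocks_one, Matrix.fromBlocks_add, add_zero, add_zero, zero_add, add_zero] at h

end Blocks

namespace ToeplitzPair

variable {R : Type*} [NormedRing R] {S S' : R} [NormedAlgebra ℂ R]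

/-- The diagonal matrix with entries `z ^ m i`. -/
def zpowDiagonal (h : ToeplitzPair S S') {n : Type*} [DecidableEq n] (m : n → ℤ) :
    Matrix n n (R ⧸ h.compactIdeal) :=
  Matrix.diagonal fun i => ((h.z ^ m i : (R ⧸ h.compactIdeal)ˣ) : R ⧸ h.compactIdeal)

theorem zpowDiagonal_add (h : ToeplitzPair S S') {n : Type*} [Fintype n] [DecidableEq n]
    (m k : n → ℤ) : h.zpowDiagonal (m + k) = h.zpowDiagonal m * h.zpowDiagonal k := by
  simp [zpowDiagonal, Matrix.diagonal_mul_diagonal, zpow_add]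

theorem zpowDiagonal_zero (h : ToeplitzPair S S') {n : Type*} [DecidableEq n] :
    h.zpowDiagonal (0 : n → ℤ) = 1 := by
  simp [zpowDiagonal]

/-- The matrices whose symbol is `diag (z ^ m i)` up to multiplication on both sides by elements
of the identity component. -/
def ellipticMatrix (h : ToeplitzPair S S') (n : Type*) [Fintype n] [DecidableEq n] :
    Set (Matrix n n R) :=
  {A | ∃ U ∈ idComp (Matrix n n R), ∃ V ∈ idComp (Matrix n n R), ∃ m : n → ℤ,
    h.symbol.mapMatrix A = h.symbol.mapMatrix U * h.zpowDiagonal m * h.symbol.mapMatrix V}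

theorem mul_mem_ellipticMatrix (h : ToeplitzPair S S') {n : Type*} [Fintype n] [DecidableEq n]
    {A U V B : Matrix n n R} (hA : A ∈ h.ellipticMatrix n) (hU : U ∈ idComp (Matrix n n R))
    (hV : V ∈ idComp (Matrix n n R))
    (hB : h.symbol.mapMatrix B = h.symbol.mapMatrix (U * A * V)) : B ∈ h.ellipticMatrix n := by
  obtain ⟨U', hU', V', hV', m, hm⟩ := hA
  refine ⟨U * U', mul_mem hU hU', V' * V, mul_mem hV' hV, m, ?_⟩
  simp only [hB, map_mul, hm, mul_assoc]

theorem reindex_mem_ellipticMatrix (h : ToeplitzPair S S') {n n' : Type*} [Fintype n]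
    [DecidableEq n] [Fintype n'] [DecidableEq n'] (e : n ≃ n') {A : Matrix n n R}
    (hA : A ∈ h.ellipticMatrix n) : Matrix.reindex e e A ∈ h.ellipticMatrix n' := by
  obtain ⟨U, hU, V, hV, m, hm⟩ := hA
  have hc : Continuous fun A : Matrix n n R => Matrix.reindex e e A :=
    continuous_id.matrix_reindex e e
  have hidc {W : Matrix n n R} (hW : W ∈ idComp (Matrix n n R)) :
      Matrix.reindex e e W ∈ idComp (Matrix n' n' R) :=
    map_mem_idComp (Matrix.reindexRingEquiv R e : Matrix n n R →* Matrix n' n' R) hc hW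
  refine ⟨_, hidc hU, _, hidc hV, m ∘ e.symm, ?_⟩
  have h2 := congrArg (Matrix.reindexRingEquiv _ e) hm
  rw [map_mul, map_mul] at h2
  have hd : Matrix.reindexRingEquiv _ e (h.zpowDiagonal m) = h.zpowDiagonal (m ∘ e.symm) := by
    ext i j
    simp [zpowDiagonal, Matrix.diagonal_apply]
  rw [hd] at h2
  exact h2

theorem dense_ellipticMatrix_congr (h : ToeplitzPair S S') {n n' : Type*} [Fintype n]
    [DecidableEq n] [Fintype n'] [DecidableEq n'] (e : n ≃ n')
    (hn : Dense (h.ellipticMatrix n)) : Dense (h.ellipticMatrix n') := by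
  intro A
  have := map_mem_closure (continuous_id.matrix_reindex e e) (hn (Matrix.reindex e.symm e.symm A))
    (fun A hA => h.reindex_mem_ellipticMatrix e hA)
  simpa using this

variable [CompleteSpace R]

theorem fromBlocks_mem_ellipticMatrix (h : ToeplitzPair S S') {n : Type*} [Fintype n]
    [DecidableEq n] {a α : R} (ha : a ∈ h.elliptic) (hα : h.symbol a * h.symbol α = 1)
    (hα' : h.symbol α * h.symbol a = 1) (b : Matrix Unit n R) (c : Matrix n Unit R)
    {d : Matrix n n R} (hd : d ∈ h.ellipticMatrix n) :
    Matrix.fromBlocks (Matrix.diagonal fun _ : Unit => a) b c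
      (d + c * (Matrix.diagonal fun _ : Unit => α) * b) ∈ h.ellipticMatrix (Unit ⊕ n) := by
  obtain ⟨u, hu, k, -, hk⟩ := ha
  obtain ⟨U, hU, V, hV, m, hm⟩ := hd
  set x : Matrix Unit Unit R := Matrix.diagonal fun _ => α with hx
  have hdiag : Matrix.fromBlocks (Matrix.diagonal fun _ : Unit => a) 0 0 d ∈
      h.ellipticMatrix (Unit ⊕ n) := by
    have hu' : Matrix.diagonal (fun _ : Unit => u) ∈ idComp (Matrix Unit Unit R) := by
      refine map_mem_idComp (Matrix.scalar Unit : R →+* _).toMonoidHom ?_ hu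
      change Continuous fun r : R => Matrix.diagonal fun _ : Unit => r
      fun_prop
    refine ⟨_, fromBlocks_mem_idComp hu' hU, _, fromBlocks_mem_idComp (one_mem _) hV,
      Sum.elim (fun _ => k) m, ?_⟩
    have hz : h.zpowDiagonal (Sum.elim (fun _ : Unit => k) m) =
        Matrix.fromBlocks (h.zpowDiagonal fun _ => k) 0 0 (h.zpowDiagonal m) := by
      rw [zpowDiagonal, zpowDiagonal, zpowDiagonal, Matrix.fromBlocks_diagonal]
      congr 1
      ext i
      cases i <;> rfl
    rw [hz]
    simp only [RingHom.mapMatrix_apply, Matrix.fromBlocks_map, Matrix.fromBlocks_multiply] at hm ⊢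
    simp [hm, hk, zpowDiagonal, Matrix.map_one, Matrix.diagonal_map]
  refine h.mul_mem_ellipticMatrix hdiag (fromBlocks_lower_mem_idComp (c * x))
    (fromBlocks_upper_mem_idComp (x * b)) ?_
  have hax : (Matrix.diagonal fun _ : Unit => a).map h.symbol * x.map h.symbol = 1 := by
    simp [hx, Matrix.diagonal_map, hα]
  have hxa : x.map h.symbol * (Matrix.diagonal fun _ : Unit => a).map h.symbol = 1 := by
    simp [hx, Matrix.diagonal_map, hα']
  have hcx : (c * x).map h.symbol = c.map h.symbol * x.map h.symbol := Matrix.map_mul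
  have hxb : (x * b).map h.symbol = x.map h.symbol * b.map h.symbol := Matrix.map_mul
  have hcxb : (d + c * x * b).map h.symbol =
      d.map h.symbol + c.map h.symbol * x.map h.symbol * b.map h.symbol := by
    rw [← hcx, ← Matrix.map_mul]
    exact Matrix.map_add _ (map_add h.symbol) _ _
  rw [map_mul, map_mul]
  simp only [RingHom.mapMatrix_apply, Matrix.fromBlocks_map, Matrix.fromBlocks_multiply,
    Matrix.map_one _ (map_zero h.symbol) (map_one h.symbol), Matrix.map_zero _ (map_zero h.symbol),
    Matrix.one_mul, Matrix.mul_one, Matrix.zero_mul, Matrix.mul_zero, add_zero, zero_add,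
    hcx, hxb, hcxb]
  rw [← Matrix.mul_assoc _ (x.map h.symbol) (b.map h.symbol), hax, Matrix.one_mul,
    Matrix.mul_assoc (c.map h.symbol) (x.map h.symbol) (Matrix.map (Matrix.diagonal _) _), hxa,
    Matrix.mul_one, Matrix.mul_assoc, add_comm]

theorem dense_ellipticMatrix_unit_sum (h : ToeplitzPair S S') {n : Type*} [Fintype n]
    [DecidableEq n] (hn : Dense (h.ellipticMatrix n)) : Dense (h.ellipticMatrix (Unit ⊕ n)) := by
  intro A
  have hA : A = Matrix.fromBlocks (Matrix.diagonal fun _ : Unit => A (Sum.inl ()) (Sum.inl ()))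
      A.toBlocks₁₂ A.toBlocks₂₁ A.toBlocks₂₂ := by
    conv_lhs => rw [← Matrix.fromBlocks_toBlocks A]
    congr 1
  rw [hA, ← closure_closure]
  refine map_mem_closure (f := fun a => Matrix.fromBlocks (Matrix.diagonal fun _ : Unit => a)
    A.toBlocks₁₂ A.toBlocks₂₁ A.toBlocks₂₂) (by fun_prop)
    (h.dense_elliptic (A (Sum.inl ()) (Sum.inl ()))) fun a ha => ?_
  obtain ⟨u, hu, k, -, hk⟩ := id ha
  obtain ⟨v, -, huv, hvu⟩ := exists_inv_of_mem_idComp hu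
  obtain ⟨α, hα⟩ := Ideal.Quotient.mk_surjective (I := h.compactIdeal)
    ((h.z ^ (-k) : (R ⧸ h.compactIdeal)ˣ) * h.symbol v)
  have huv' : h.symbol u * h.symbol v = 1 := by rw [← map_mul, huv, map_one]
  have hvu' : h.symbol v * h.symbol u = 1 := by rw [← map_mul, hvu, map_one]
  have h1 : h.symbol a * h.symbol α = 1 := by
    rw [hk, hα, mul_assoc, ← mul_assoc (_ : R ⧸ h.compactIdeal) _ (h.symbol v), ← Units.val_mul]
    simpa using huv'
  have h2 : h.symbol α * h.symbol a = 1 := by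
    rw [hk, hα, mul_assoc, ← mul_assoc (h.symbol v), hvu', one_mul, ← Units.val_mul]
    simp
  have := map_mem_closure (f := fun d => Matrix.fromBlocks (Matrix.diagonal fun _ : Unit => a)
    A.toBlocks₁₂ A.toBlocks₂₁
      (d + A.toBlocks₂₁ * (Matrix.diagonal fun _ : Unit => α) * A.toBlocks₁₂)) (by fun_prop)
    (hn (A.toBlocks₂₂ - A.toBlocks₂₁ * (Matrix.diagonal fun _ : Unit => α) * A.toBlocks₁₂))
    (fun d hd => h.fromBlocks_mem_ellipticMatrix ha h1 h2 A.toBlocks₁₂ A.toBlocks₂₁ hd)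
  simpa only [sub_add_cancel] using this

theorem dense_ellipticMatrix (h : ToeplitzPair S S') (k : ℕ) :
    Dense (h.ellipticMatrix (Fin k)) := by
  induction k with
  | zero =>
    intro A
    exact subset_closure ⟨1, one_mem _, 1, one_mem _, 0, Subsingleton.elim _ _⟩
  | succ k ih =>
    refine h.dense_ellipticMatrix_congr ?_ (h.dense_ellipticMatrix_unit_sum ih)
    exact (Equiv.sumCongr finOneEquiv.symm (Equiv.refl _)).trans
      (finSumFinEquiv.trans (finCongr (add_comm 1 k)))

end ToeplitzPair

theorem one_sub_pow_mul_pow {A : Type*} [Ring A] (S S' : A) (N : ℕ) :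
    1 - S ^ N * S' ^ N = ∑ i ∈ Finset.range N, S ^ i * (1 - S * S') * S' ^ i := by
  induction N with
  | zero => simp
  | succ N ih =>
    rw [Finset.sum_range_succ, ← ih, pow_succ S, pow_succ' S']
    noncomm_ring

theorem one_add_mul_one_sub_mul_one_add {A : Type*} [Ring A] {x y : A} (hx : x * x = 0)
    (hxy : x * y * x = x) : (1 + x) * (1 - y) * (1 + x) = 1 - x * y - y * x + x - y := by
  have : (1 + x) * (1 - y) * (1 + x) = 1 + x + x + x * x - y - x * y - y * x - x * y * x := by
    noncomm_ring
  rw [this, hx, hxy]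
  abel

theorem diagonal_eq_mul_of_mul_eq_one {A n : Type*} [Ring A] [Fintype n] [DecidableEq n] {i j : n}
    (hij : i ≠ j) {u v : A} (huv : u * v = 1) (hvu : v * u = 1) :
    (1 + Matrix.single i j u) * (1 - Matrix.single j i v) * (1 + Matrix.single i j u) *
      ((1 + Matrix.single i j (-1)) * (1 - Matrix.single j i (-1)) *
        (1 + Matrix.single i j (-1))) =
      Matrix.diagonal (Function.update (Function.update 1 i u) j v) := by
  rw [one_add_mul_one_sub_mul_one_add (by simp [hij.symm]) (by simp [huv]),
    one_add_mul_one_sub_mul_one_add (by simp [hij.symm]) (by simp)]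
  have hd : Matrix.diagonal (Function.update (Function.update 1 i u) j v) =
      1 - Matrix.single i i 1 - Matrix.single j j 1 + Matrix.single i i u +
        Matrix.single j j v := by
    ext a b
    by_cases hab : a = b
    · subst hab
      by_cases haj : a = j
      · subst haj
        simp [hij]
      · by_cases hai : a = i
        · subst hai
          simp [haj, hij.symm]
        · simp [haj, hai, Ne.symm haj, Ne.symm hai]
    · have h1 : ∀ c : n, ¬ (c = a ∧ c = b) := by
        rintro c ⟨rfl, rfl⟩
        exact hab rfl
      simp [hab, h1]
  rw [hd]
  simp only [Matrix.single_mul_single_same, huv, hvu, mul_one, one_mul, mul_neg, neg_mul, neg_neg,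
    mul_add, add_mul, mul_sub, sub_mul, ne_eq, hij, hij.symm, not_false_eq_true,
    Matrix.single_mul_single_of_ne, ← Matrix.single_neg]
  abel

namespace ToeplitzPair

variable {R : Type*} [NormedRing R] [NormedAlgebra ℂ R] {S S' : R}
  {n : Type*} [Fintype n] [DecidableEq n]

theorem mem_closure_of_symbol_eq (h : ToeplitzPair S S') {X B : Matrix n n R}
    (hXB : h.symbol.mapMatrix X = h.symbol.mapMatrix B) :
    X ∈ closure {Y | ∃ N : ℕ, (Y - B) * Matrix.scalar n (S ^ N) = 0} := by
  refine mem_closure_of_tendsto (b := atTop)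
    (f := fun N : ℕ => B + (X - B) * Matrix.scalar n (1 - S ^ N * S' ^ N)) ?_ ?_
  · have hij (i j : n) : Tendsto (fun N : ℕ => (X - B) i j * (S ^ N * S' ^ N)) atTop (𝓝 0) := by
      have hmem : (X - B) i j ∈ h.compactIdeal := by
        have := congrFun (congrFun hXB i) j
        simpa [Ideal.Quotient.mk_eq_mk_iff_sub_mem] using this
      rw [mem_compactIdeal] at hmem
      rw [tendsto_zero_iff_norm_tendsto_zero] at hmem ⊢
      refine squeeze_zero (fun _ => norm_nonneg _) (fun N => ?_) hmem
      rw [← mul_assoc]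
      calc _ ≤ ‖(X - B) i j * S ^ N‖ * ‖S' ^ N‖ := norm_mul_le _ _
        _ ≤ ‖(X - B) i j * S ^ N‖ * 1 := by gcongr; exact h.norm_pow_le' N
        _ = _ := mul_one _
    refine tendsto_pi_nhds.2 fun i => tendsto_pi_nhds.2 fun j => ?_
    have := ((hij i j).const_sub ((X - B) i j)).const_add (B i j)
    simpa [mul_sub] using this
  · refine Eventually.of_forall fun N => ⟨N, ?_⟩
    have hzero : (1 - S ^ N * S' ^ N) * S ^ N = 0 := by
      rw [sub_mul, mul_assoc, h.pow_mul_pow, mul_one, one_mul, sub_self]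
    rw [add_sub_cancel_left, mul_assoc, ← map_mul, hzero, map_zero, mul_zero]

theorem corner_mem_span (h : ToeplitzPair S S') (N : ℕ) (t : R) :
    (1 - S ^ N * S' ^ N) * t * (1 - S ^ N * S' ^ N) ∈
      Submodule.span ℂ (Set.range fun p : Fin N × Fin N => S ^ (p.1 : ℕ) * (1 - S * S') *
        S' ^ (p.2 : ℕ)) := by
  rw [one_sub_pow_mul_pow, Finset.sum_mul, Finset.sum_mul_sum]
  refine Submodule.sum_mem _ fun i hi => Submodule.sum_mem _ fun j hj => ?_
  obtain ⟨c, hc⟩ := h.corner (S' ^ i * t * S ^ j)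
  have heq : S ^ i * (1 - S * S') * S' ^ i * t * (S ^ j * (1 - S * S') * S' ^ j) =
      c • (S ^ i * (1 - S * S') * S' ^ j) := by
    calc _ = S ^ i * ((1 - S * S') * (S' ^ i * t * S ^ j) * (1 - S * S')) * S' ^ j := by
          simp only [mul_assoc]
      _ = _ := by rw [hc, mul_smul_comm, smul_mul_assoc]
  rw [heq]
  exact Submodule.smul_mem _ _ (Submodule.subset_span
    ⟨(⟨i, Finset.mem_range.1 hi⟩, ⟨j, Finset.mem_range.1 hj⟩), rfl⟩)

theorem isAlgebraic_of_mul_scalar_eq_zero (h : ToeplitzPair S S') {F : Matrix n n R} {N : ℕ}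
    (hF : F * Matrix.scalar n (S ^ N) = 0) : IsAlgebraic ℂ F := by
  set P : Matrix n n R := Matrix.scalar n (1 - S ^ N * S' ^ N) with hP
  have hFP : F * P = F := by
    rw [hP, map_sub, map_one, map_mul, mul_sub, mul_one, ← mul_assoc, hF, zero_mul, sub_zero]
  set W := Submodule.span ℂ (Set.range fun p : Fin N × Fin N => S ^ (p.1 : ℕ) * (1 - S * S') *
        S' ^ (p.2 : ℕ)) with hW
  have : Module.Finite ℂ W := Module.Finite.span_of_finite ℂ (Set.finite_range _)
  set V : Submodule ℂ (Matrix n n R) :=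
    (LinearMap.range (W.subtype.mapMatrix (m := n) (n := n))).map (LinearMap.mulLeft ℂ F) with hV
  have hPV (Y : Matrix n n R) : P * Y * P ∈
      LinearMap.range (W.subtype.mapMatrix (m := n) (n := n)) := by
    have hmem (i j : n) : (P * Y * P) i j ∈ W := by
      simpa [hP] using h.corner_mem_span N (Y i j)
    exact ⟨Matrix.of fun i j => ⟨_, hmem i j⟩, by ext i j; simp⟩
  by_contra htr
  have hinj : Function.Injective (Polynomial.aeval (R := ℂ) F) := transcendental_iff_injective.1 htr
  set L : Polynomial ℂ →ₗ[ℂ] Matrix n n R :=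
    (Polynomial.aeval F).toLinearMap ∘ₗ LinearMap.mulLeft ℂ (Polynomial.X ^ 2) with hL
  have hLinj : Function.Injective L := by
    refine hinj.comp ?_
    exact mul_right_injective₀ (pow_ne_zero 2 Polynomial.X_ne_zero)
  have hLV (f : Polynomial ℂ) : L f ∈ V := by
    refine ⟨P * (Polynomial.aeval F f * F) * P, hPV _, ?_⟩
    have hcomm : Polynomial.aeval F f * F = F * Polynomial.aeval F f := by
      have := congrArg (Polynomial.aeval F) (mul_comm f Polynomial.X)
      simpa using this
    simp only [LinearMap.mulLeft_apply, hL, LinearMap.comp_apply, AlgHom.toLinearMap_apply, map_mul,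
      map_pow, Polynomial.aeval_X]
    rw [mul_assoc P, mul_assoc (Polynomial.aeval F f), hFP, ← mul_assoc, hFP, hcomm, sq, mul_assoc]
  have hfin : Module.Finite ℂ (Polynomial ℂ) :=
    Module.Finite.of_injective (L.codRestrict V hLV)
      (fun f g hfg => hLinj (congrArg Subtype.val hfg))
  exact Polynomial.not_finite hfin

variable [CompleteSpace R]

/-- The exponents `m` for which `diag (z ^ m i)` lifts to the identity component. -/
def liftableExponents (h : ToeplitzPair S S') (n : Type*) [Fintype n] [DecidableEq n] :
    AddSubgroup (n → ℤ) where
  carrier := {m | ∃ W ∈ idComp (Matrix n n R), h.symbol.mapMatrix W = h.zpowDiagonal m}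
  zero_mem' := ⟨1, one_mem _, by rw [map_one, zpowDiagonal_zero]⟩
  add_mem' := by
    rintro m k ⟨W, hW, hm⟩ ⟨V, hV, hk⟩
    exact ⟨W * V, mul_mem hW hV, by rw [map_mul, hm, hk, zpowDiagonal_add]⟩
  neg_mem' := by
    rintro m ⟨W, hW, hm⟩
    obtain ⟨V, hV, hWV, hVW⟩ := exists_inv_of_mem_idComp hW
    refine ⟨V, hV, ?_⟩
    have h1 : h.symbol.mapMatrix V * h.zpowDiagonal m = 1 := by
      rw [← hm, ← map_mul, hVW, map_one]
    have h2 : h.zpowDiagonal m * h.zpowDiagonal (-m) = 1 := by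
      rw [← zpowDiagonal_add, add_neg_cancel, zpowDiagonal_zero]
    exact left_inv_eq_right_inv h1 h2

theorem single_sub_single_mem_liftableExponents (h : ToeplitzPair S S') (i j : n) :
    (Pi.single i 1 - Pi.single j 1 : n → ℤ) ∈ h.liftableExponents n := by
  rcases eq_or_ne i j with rfl | hij
  · rw [sub_self]
    exact zero_mem _
  have hadd (a b : n) (hab : a ≠ b) (c : R) :
      1 + Matrix.single a b c ∈ idComp (Matrix n n R) :=
    one_add_mem_idComp_of_mul_self_eq_zero (by simp [hab.symm])
  have hsub (a b : n) (hab : a ≠ b) (c : R) :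
      1 - Matrix.single a b c ∈ idComp (Matrix n n R) := by
    rw [sub_eq_add_neg, Matrix.single_neg]
    exact hadd a b hab (-c)
  refine ⟨(1 + Matrix.single i j S) * (1 - Matrix.single j i S') * (1 + Matrix.single i j S) *
      ((1 + Matrix.single i j (-1)) * (1 - Matrix.single j i (-1)) *
        (1 + Matrix.single i j (-1))), ?_, ?_⟩
  · exact mul_mem (mul_mem (mul_mem (hadd i j hij _) (hsub j i hij.symm _)) (hadd i j hij _))
      (mul_mem (mul_mem (hadd i j hij _) (hsub j i hij.symm _)) (hadd i j hij _))
  · have hs (a b : n) (c : R) : h.symbol.mapMatrix (Matrix.single a b c) =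
        Matrix.single a b (h.symbol c) := by
      simp
    simp only [map_mul, map_add, map_sub, map_one, hs, map_neg]
    rw [diagonal_eq_mul_of_mul_eq_one (u := h.symbol S) (v := h.symbol S') hij h.z.val_inv
      h.z.inv_val, zpowDiagonal]
    congr 1
    ext a
    by_cases haj : a = j
    · subst haj
      simp [hij.symm, coe_z_inv]
    · by_cases hai : a = i
      · subst hai
        simp [haj, coe_z]
      · simp [haj, hai]

theorem mem_liftableExponents_of_sum_eq_zero (h : ToeplitzPair S S') {m : n → ℤ}
    (hm : ∑ i, m i = 0) : m ∈ h.liftableExponents n := by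
  cases isEmpty_or_nonempty n with
  | inl hn =>
    rw [Subsingleton.elim m 0]
    exact zero_mem _
  | inr hn =>
    obtain ⟨j⟩ := hn
    have heq : m = ∑ i, m i • (Pi.single i 1 - Pi.single j 1 : n → ℤ) := by
      simp only [smul_sub, Finset.sum_sub_distrib, ← Finset.sum_smul, hm, zero_smul, sub_zero]
      ext a
      simp [Finset.sum_apply, Pi.single_apply]
    rw [heq]
    exact sum_mem fun i _ => zsmul_mem (h.single_sub_single_mem_liftableExponents i j) _

theorem exists_unit_of_symbol_eq (h : ToeplitzPair S S') {X B : Matrix n n R} (hX : IsUnit X)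
    (hXB : h.symbol.mapMatrix X = h.symbol.mapMatrix B) :
    ∃ g ∈ idComp (Matrix n n R), ∃ N : ℕ,
      IsUnit (X * g) ∧ (X * g - B) * Matrix.scalar n (S ^ N) = 0 := by
  obtain ⟨Y, ⟨N, hN⟩, g, hg, rfl⟩ :=
    exists_mem_idComp_of_mem_closure hX (h.mem_closure_of_symbol_eq hXB)
  obtain ⟨u, -, rfl⟩ := mem_idComp.1 hg
  exact ⟨_, hg, N, hX.mul u.isUnit, hN⟩

theorem mem_idComp_of_symbol_eq_one (h : ToeplitzPair S S') {X : Matrix n n R} (hX : IsUnit X)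
    (hX1 : h.symbol.mapMatrix X = 1) : X ∈ idComp (Matrix n n R) := by
  obtain ⟨g, hg, N, hu, hN⟩ := h.exists_unit_of_symbol_eq hX
    (B := 1) (by rw [hX1, map_one])
  have hmem := one_add_mem_idComp_of_isAlgebraic (h.isAlgebraic_of_mul_scalar_eq_zero hN)
    (by rwa [add_sub_cancel])
  rw [add_sub_cancel] at hmem
  obtain ⟨g', hg', hgg', -⟩ := exists_inv_of_mem_idComp hg
  have := mul_mem hmem hg'
  rwa [mul_assoc, hgg', mul_one] at this

/-- The index obstruction: an invertible matrix agreeing with `diag (S ^ k i)` on the range of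
`S ^ N` has nonpositive total degree. -/
def IndexObstruction (S : R) (n : Type*) [Fintype n] [DecidableEq n] : Prop :=
  ∀ (X : Matrix n n R) (N : ℕ) (k : n → ℕ), IsUnit X →
    X * Matrix.scalar n (S ^ N) = Matrix.diagonal (fun i => S ^ k i) →
      ∑ i, k i ≤ Fintype.card n * N

theorem sum_nonpos_of_symbol_eq (h : ToeplitzPair S S') (hS : IndexObstruction S n)
    {X : Matrix n n R} (hX : IsUnit X) {m : n → ℤ} (hm : h.symbol.mapMatrix X = h.zpowDiagonal m) :
    ∑ i, m i ≤ 0 := by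
  obtain ⟨g, -, N, hu, hN⟩ := h.exists_unit_of_symbol_eq hX
    (B := Matrix.diagonal fun i => h.zpowLift (m i)) (by
      rw [hm, zpowDiagonal]
      simp [Matrix.diagonal_map, symbol_zpowLift])
  set M := N + ∑ i, (m i).natAbs with hM
  have hMi (i : n) : (m i).natAbs ≤ M :=
    (Finset.single_le_sum (f := fun i => (m i).natAbs) (fun _ _ => Nat.zero_le _)
      (Finset.mem_univ i)).trans (Nat.le_add_left _ _)
  have hXM : X * g * Matrix.scalar n (S ^ M) =
      Matrix.diagonal fun i => S ^ ((M : ℤ) + m i).toNat := by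
    have h0 : (X * g - Matrix.diagonal fun i => h.zpowLift (m i)) *
        Matrix.scalar n (S ^ M) = 0 := by
      rw [hM, pow_add, map_mul, ← mul_assoc, hN, zero_mul]
    rw [sub_mul, sub_eq_zero] at h0
    rw [h0, Matrix.scalar_apply, Matrix.diagonal_mul_diagonal]
    congr 1
    ext i
    exact h.zpowLift_mul_pow (hMi i)
  have hle := hS _ M _ hu hXM
  have hle' : ∑ i, ((((M : ℤ) + m i).toNat : ℕ) : ℤ) ≤ Fintype.card n * M := by
    exact_mod_cast hle
  have hcast (i : n) : ((((M : ℤ) + m i).toNat : ℕ) : ℤ) = M + m i := by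
    have := hMi i
    omega
  simp only [hcast, Finset.sum_add_distrib, Finset.sum_const, Finset.card_univ, nsmul_eq_mul]
    at hle'
  linarith

theorem mem_idComp_of_isUnit (h : ToeplitzPair S S') {k : ℕ} (hS : IndexObstruction S (Fin k))
    {A : Matrix (Fin k) (Fin k) R} (hA : IsUnit A) : A ∈ idComp (Matrix (Fin k) (Fin k) R) := by
  obtain ⟨B, ⟨U, hU, V, hV, m, hB⟩, g, hg, rfl⟩ :=
    exists_mem_idComp_of_mem_closure hA (h.dense_ellipticMatrix k A)
  obtain ⟨u, hu, rfl⟩ := mem_idComp.1 hU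
  obtain ⟨v, hv, rfl⟩ := mem_idComp.1 hV
  obtain ⟨w, hw, rfl⟩ := mem_idComp.1 hg
  obtain ⟨a, rfl⟩ := hA
  set x := u⁻¹ * (a * w) * v⁻¹ with hx
  have hcancel (t : (Matrix (Fin k) (Fin k) R)ˣ) :
      h.symbol.mapMatrix (t : Matrix (Fin k) (Fin k) R) *
        h.symbol.mapMatrix ((t⁻¹ : (Matrix (Fin k) (Fin k) R)ˣ) : Matrix (Fin k) (Fin k) R) = 1 := by
    rw [← map_mul, Units.mul_inv, map_one]
  have hcancel' (t : (Matrix (Fin k) (Fin k) R)ˣ) :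
      h.symbol.mapMatrix ((t⁻¹ : (Matrix (Fin k) (Fin k) R)ˣ) : Matrix (Fin k) (Fin k) R) *
        h.symbol.mapMatrix (t : Matrix (Fin k) (Fin k) R) = 1 := by
    rw [← map_mul, Units.inv_mul, map_one]
  have hxm : h.symbol.mapMatrix (x : Matrix (Fin k) (Fin k) R) = h.zpowDiagonal m := by
    rw [hx, Units.val_mul, Units.val_mul, Units.val_mul, map_mul, map_mul _ _ (_ * _), hB,
      mul_assoc, mul_assoc, hcancel, mul_one, ← mul_assoc, hcancel', one_mul]
  have hxm' : h.symbol.mapMatrix ((x⁻¹ : (Matrix (Fin k) (Fin k) R)ˣ) : Matrix (Fin k) (Fin k) R) =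
      h.zpowDiagonal (-m) := by
    have h1 := hcancel' x
    rw [hxm] at h1
    have h2 : h.zpowDiagonal m * h.zpowDiagonal (-m) = 1 := by
      rw [← zpowDiagonal_add, add_neg_cancel, zpowDiagonal_zero]
    exact left_inv_eq_right_inv h1 h2
  have hsum : ∑ i, m i = 0 := by
    have h1 := h.sum_nonpos_of_symbol_eq hS x.isUnit hxm
    have h2 := h.sum_nonpos_of_symbol_eq hS (x⁻¹).isUnit hxm'
    simp only [Pi.neg_apply, Finset.sum_neg_distrib] at h2
    omega
  obtain ⟨W, hW, hWm⟩ := h.mem_liftableExponents_of_sum_eq_zero hsum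
  obtain ⟨y, hy, rfl⟩ := mem_idComp.1 hW
  have hyx : h.symbol.mapMatrix ((y⁻¹ * x : (Matrix (Fin k) (Fin k) R)ˣ) :
      Matrix (Fin k) (Fin k) R) = 1 := by
    rw [Units.val_mul, map_mul, hxm, ← hWm, hcancel']
  obtain ⟨t, ht, htx⟩ := mem_idComp.1 (h.mem_idComp_of_symbol_eq_one (Units.isUnit _) hyx)
  have ha : a = u * (y * t) * v * w⁻¹ := by
    rw [Units.ext htx, hx]
    group
  exact mem_idComp.2 ⟨a, ha ▸ mul_mem (mul_mem (mul_mem hu (mul_mem hy ht)) hv) (inv_mem hw), rfl⟩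

end ToeplitzPair

end MatrixToeplitz

section UnilateralShift

open ContinuousLinearMap

theorem delta1_apply (i j : ℕ) : (delta1 i : ℕ → ℂ) j = if j = i then 1 else 0 := by
  simp [delta1, lp.single_apply, Pi.single_apply]

theorem inner_delta1 (j : ℕ) (v : H1) : inner ℂ (delta1 j) v = v j := by
  rw [delta1, lp.inner_single_left]
  simp

theorem norm_delta1 (j : ℕ) : ‖delta1 j‖ = 1 := by
  rw [delta1, lp.norm_single (by norm_num), norm_one]

theorem ext_delta1 {T T' : H1 →L[ℂ] H1} (h : ∀ j, T (delta1 j) = T' (delta1 j)) : T = T' := by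
  refine lp.ext_continuousLinearMap (by norm_num) fun j => ?_
  ext1
  simpa [delta1] using h j

theorem orthogonalFamily_delta1_succ :
    OrthogonalFamily ℂ (fun _ : ℕ => ℂ)
      fun j => LinearIsometry.toSpanSingleton ℂ H1 (norm_delta1 (j + 1)) := by
  intro i j hij v w
  simp [inner_smul_left, inner_smul_right, inner_delta1, delta1_apply, hij]

/-- The unilateral shift as an isometry. -/
def shiftIsometry : H1 →ₗᵢ[ℂ] H1 := orthogonalFamily_delta1_succ.linearIsometry

/-- The unilateral shift. -/
def shift : H1 →L[ℂ] H1 := shiftIsometry.toContinuousLinearMap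

theorem isShift1_shift : IsShift1 shift := by
  intro j
  refine (orthogonalFamily_delta1_succ.linearIsometry_apply_single (i := j) (1 : ℂ)).trans ?_
  simp

theorem setOf_isShift1 : {T : H1 →L[ℂ] H1 | IsShift1 T} = {shift} :=
  Set.eq_singleton_iff_unique_mem.2
    ⟨isShift1_shift, fun _ hT => ext_delta1 fun j => (hT j).trans (isShift1_shift j).symm⟩

theorem star_shift_mul_shift : star shift * shift = 1 := by
  rw [star_eq_adjoint]
  exact (ContinuousLinearMap.norm_map_iff_adjoint_comp_self shift).1 shiftIsometry.norm_map

theorem norm_shift_pow_le (n : ℕ) : ‖shift ^ n‖ ≤ 1 := by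
  cases n with
  | zero => exact norm_id_le
  | succ n =>
    exact (norm_pow_le' shift n.succ_pos).trans
      (pow_le_one₀ (norm_nonneg _) shiftIsometry.norm_toContinuousLinearMap_le)

theorem star_shift_apply (v : H1) (j : ℕ) : (star shift v : H1) j = v (j + 1) := by
  rw [star_eq_adjoint, ← inner_delta1, adjoint_inner_right, isShift1_shift, inner_delta1]

theorem star_shift_pow_apply (n : ℕ) (v : H1) (j : ℕ) :
    ((star shift ^ n) v : H1) j = v (j + n) := by
  induction n generalizing v with
  | zero => simp
  | succ n ih =>
    rw [pow_succ, mul_def, comp_apply, ih, star_shift_apply, add_assoc]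

theorem star_shift_delta1_zero : star shift (delta1 0) = 0 := by
  ext j
  rw [star_shift_apply, delta1_apply]
  simp

theorem shift_apply_zero (v : H1) : (shift v : H1) 0 = 0 := by
  rw [← inner_delta1, ← adjoint_inner_left, ← star_eq_adjoint, star_shift_delta1_zero,
    inner_zero_left]

theorem shift_apply_succ (v : H1) (j : ℕ) : (shift v : H1) (j + 1) = v j := by
  rw [← star_shift_apply, ← comp_apply, ← mul_def, star_shift_mul_shift]
  rfl

theorem shift_pow_apply_of_lt {n j : ℕ} (hj : j < n) (v : H1) : ((shift ^ n) v : H1) j = 0 := by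
  induction n generalizing j with
  | zero => omega
  | succ n ih =>
    rw [pow_succ', mul_def, comp_apply]
    cases j with
    | zero => exact shift_apply_zero _
    | succ j => rw [shift_apply_succ, ih (by omega)]

theorem shift_pow_apply_add (n j : ℕ) (v : H1) : ((shift ^ n) v : H1) (j + n) = v j := by
  induction n with
  | zero => simp
  | succ n ih => rw [pow_succ', mul_def, comp_apply, ← add_assoc, shift_apply_succ, ih]

theorem shift_pow_star_shift_pow_of_apply_eq_zero {n : ℕ} {v : H1} (hv : ∀ j < n, v j = 0) :
    (shift ^ n) ((star shift ^ n) v) = v := by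
  ext j
  by_cases hj : j < n
  · rw [shift_pow_apply_of_lt hj, hv j hj]
  · obtain ⟨i, rfl⟩ := Nat.exists_eq_add_of_le' (not_lt.1 hj)
    rw [shift_pow_apply_add, star_shift_pow_apply]

theorem one_sub_shift_mul_star_shift_apply (v : H1) :
    (1 - shift * star shift) v = v 0 • delta1 0 := by
  ext j
  cases j with
  | zero => simp [shift_apply_zero, delta1_apply]
  | succ j => simp [shift_apply_succ, star_shift_apply, delta1_apply]

theorem shift_mem_toeplitz1 : shift ∈ Toeplitz1 :=
  StarSubalgebra.le_topologicalClosure _ (StarAlgebra.subset_adjoin _ _ isShift1_shift)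

/-- The unilateral shift as an element of the Toeplitz algebra. -/
def toeplitzShift : ↥Toeplitz1 := ⟨shift, shift_mem_toeplitz1⟩

instance : CompleteSpace ↥Toeplitz1 :=
  (StarSubalgebra.isClosed_topologicalClosure _).completeSpace_coe

theorem dense_adjoin_toeplitzShift :
    Dense (Algebra.adjoin ℂ {toeplitzShift, star toeplitzShift} : Set ↥Toeplitz1) := by
  rw [Subtype.dense_iff]
  intro t ht
  have himage : ((↑) '' (Algebra.adjoin ℂ {toeplitzShift, star toeplitzShift} : Set ↥Toeplitz1)) =
      (StarAlgebra.adjoin ℂ {T : H1 →L[ℂ] H1 | IsShift1 T} : Set (H1 →L[ℂ] H1)) := by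
    rw [← StarSubalgebra.coe_toSubalgebra, StarAlgebra.adjoin_toSubalgebra, setOf_isShift1]
    have := congrArg (fun s : Subalgebra ℂ (H1 →L[ℂ] H1) => (s : Set (H1 →L[ℂ] H1)))
      (AlgHom.map_adjoin Toeplitz1.toSubalgebra.val {toeplitzShift, star toeplitzShift})
    simp only [Set.image_pair, Subalgebra.coe_map] at this
    rw [Set.star_singleton, Set.singleton_union]
    exact this
  exact himage ▸ ht

theorem toeplitzPair_toeplitzShift : ToeplitzPair toeplitzShift (star toeplitzShift) where
  mul_eq_one := Subtype.ext star_shift_mul_shift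
  norm_pow_le := norm_shift_pow_le
  norm_pow_le' n := by
    rw [← star_pow]
    exact (norm_star (shift ^ n)).trans_le (norm_shift_pow_le n)
  dense := dense_adjoin_toeplitzShift
  corner t := by
    refine ⟨((t : H1 →L[ℂ] H1) (delta1 0) : H1) 0,
      Subtype.ext (ContinuousLinearMap.ext fun v => ?_)⟩
    change (1 - shift * star shift) ((t : H1 →L[ℂ] H1) ((1 - shift * star shift) v)) =
      ((t : H1 →L[ℂ] H1) (delta1 0) : H1) 0 • (1 - shift * star shift) v
    simp only [one_sub_shift_mul_star_shift_apply, map_smul, smul_smul, mul_comm]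

/-- The action of an operator matrix on vectors in `ℓ²(ℕ)`. -/
def matrixAction {n : Type*} [Fintype n] (X : Matrix n n ↥Toeplitz1) : (n → H1) →ₗ[ℂ] (n → H1) :=
  LinearMap.pi fun i =>
    ∑ j, ((X i j : H1 →L[ℂ] H1) : H1 →ₗ[ℂ] H1) ∘ₗ LinearMap.proj j

theorem matrixAction_apply {n : Type*} [Fintype n] (X : Matrix n n ↥Toeplitz1) (v : n → H1)
    (i : n) : matrixAction X v i = ∑ j, (X i j : H1 →L[ℂ] H1) (v j) := by
  simp [matrixAction]

theorem matrixAction_mul {n : Type*} [Fintype n] (X Y : Matrix n n ↥Toeplitz1) (v : n → H1) :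
    matrixAction (X * Y) v = matrixAction X (matrixAction Y v) := by
  ext1 i
  simp only [matrixAction_apply, Matrix.mul_apply, map_sum]
  rw [Finset.sum_comm]
  refine Finset.sum_congr rfl fun j _ => ?_
  simp

theorem matrixAction_diagonal {n : Type*} [Fintype n] [DecidableEq n] (d : n → ↥Toeplitz1)
    (v : n → H1) (i : n) :
    matrixAction (Matrix.diagonal d) v i = (d i : H1 →L[ℂ] H1) (v i) := by
  rw [matrixAction_apply, Finset.sum_eq_single i]
  · simp
  · intro j _ hj
    simp [Matrix.diagonal_apply_ne' _ hj]
  · simp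

/-- The first `k i` coordinates of the `i`-th component. -/
def coordinates {n : Type*} (k : n → ℕ) : (n → H1) →ₗ[ℂ] ((Σ i, Fin (k i)) → ℂ) where
  toFun v p := v p.1 p.2
  map_add' _ _ := rfl
  map_smul' _ _ := rfl

theorem coordinates_surjective {n : Type*} (k : n → ℕ) :
    Function.Surjective (coordinates k) := by
  intro y
  refine ⟨fun i => ∑ a : Fin (k i), y ⟨i, a⟩ • delta1 a, ?_⟩
  ext ⟨i, a⟩
  change ((∑ b : Fin (k i), y ⟨i, b⟩ • delta1 b : H1) : ℕ → ℂ) a = y ⟨i, a⟩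
  rw [← inner_delta1, inner_sum]
  simp [inner_smul_right, inner_delta1, delta1_apply, Fin.val_inj]

theorem indexObstruction_toeplitzShift (n : Type*) [Fintype n] [DecidableEq n] :
    ToeplitzPair.IndexObstruction toeplitzShift n := by
  intro X N k hX hXN
  obtain ⟨Y, hXY⟩ := hX.exists_right_inv
  have hsurj : Function.Surjective (coordinates k ∘ₗ matrixAction X) := by
    refine (coordinates_surjective k).comp fun w => ⟨matrixAction Y w, ?_⟩
    rw [← matrixAction_mul, hXY]
    ext1 i
    rw [← Matrix.diagonal_one, matrixAction_diagonal]
    rfl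
  have hker : LinearMap.ker (coordinates fun _ : n => N) ≤
      LinearMap.ker (coordinates k ∘ₗ matrixAction X) := by
    intro v hv
    have hv' : matrixAction (Matrix.scalar n (toeplitzShift ^ N))
        (fun i => (star shift ^ N) (v i)) = v := by
      ext1 i
      rw [Matrix.scalar_apply, matrixAction_diagonal]
      exact shift_pow_star_shift_pow_of_apply_eq_zero fun j hj => congrFun hv ⟨i, j, hj⟩
    rw [LinearMap.mem_ker, LinearMap.comp_apply, ← hv', ← matrixAction_mul, hXN]
    ext ⟨i, a⟩
    have := matrixAction_diagonal (fun i => toeplitzShift ^ k i)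
      (fun i => (star shift ^ N) (v i)) i
    change (matrixAction _ _ i : H1) a = 0
    rw [this]
    exact shift_pow_apply_of_lt a.2 _
  obtain ⟨σ, hσ⟩ := (coordinates fun _ : n => N).exists_rightInverse_of_surjective
    (LinearMap.range_eq_top.2 (coordinates_surjective _))
  have hle := LinearMap.finrank_le_finrank_of_surjective
    (f := (coordinates k ∘ₗ matrixAction X) ∘ₗ σ) fun y => by
      obtain ⟨v, rfl⟩ := hsurj y
      refine ⟨coordinates (fun _ : n => N) v, ?_⟩
      rw [LinearMap.comp_apply, ← sub_eq_zero, ← map_sub]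
      refine hker (LinearMap.mem_ker.2 ?_)
      rw [map_sub, ← LinearMap.comp_apply, hσ, LinearMap.id_apply, sub_self]
  simpa using hle

end UnilateralShift

theorem stmt5 (k : ℕ) (hk : 1 ≤ k) :
    ConnectedSpace (Matrix (Fin k) (Fin k) ↥Toeplitz1)ˣ := by
  refine connectedSpace_iff_connectedComponent.2 ⟨1, Set.eq_univ_of_forall fun u => ?_⟩
  obtain ⟨v, hv, hvu⟩ := mem_idComp.1
    (toeplitzPair_toeplitzShift.mem_idComp_of_isUnit (indexObstruction_toeplitzShift (Fin k))
      u.isUnit)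
  rwa [← Units.ext hvu]
end
end

section
/- Let n ≥ 1 and let m ≥ ⌊(n−1)/2⌋ + 3 be an integer. If P is an idempotent matrix over the Toeplitz algebra T_n such that P ⊞ (⊞^r 1) is equivalent to ⊞^{m+r} 1 for some integer r ≥ 0 (i.e., P is stably equivalent to the free rank-m projection), then P is equivalent to ⊞^m 1. -/
noncomputable section

/-- `H n` is the Hilbert space `ℓ²(ℕ^n)`. -/
abbrev Hn (n : ℕ) : Type := lp (fun _ : (Fin n → ℕ) => ℂ) 2

/-- the standard basis vector `δ_z`. -/
def delta {n : ℕ} (z : Fin n → ℕ) : Hn n := lp.single 2 z 1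

/-- `T` is the `i`-th coordinate shift: `T δ_z = δ_{z + e_i}`. -/
def IsShift {n : ℕ} (i : Fin n) (T : Hn n →L[ℂ] Hn n) : Prop :=
  ∀ z : Fin n → ℕ, T (delta z) = delta (Function.update z i (z i + 1))

/-- The Toeplitz algebra `T_n`: the smallest norm-closed star-subalgebra of `B(H_n)`
containing the coordinate shifts. -/
def Toeplitz (n : ℕ) : StarSubalgebra ℂ (Hn n →L[ℂ] Hn n) :=
  (StarAlgebra.adjoin ℂ {T : Hn n →L[ℂ] Hn n | ∃ i : Fin n, IsShift i T}).topologicalClosure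
/-- Padding a matrix by zeros into an `N × N` matrix along an embedding `f`. -/
def padMat {R : Type*} [Semiring R] {ι : Type*} [Fintype ι] {N : ℕ}
    (f : ι ↪ Fin N) (P : Matrix ι ι R) : Matrix (Fin N) (Fin N) R :=
  fun i j => ∑ a : ι, ∑ b : ι, if f a = i ∧ f b = j then P a b else 0

/-- Equivalence of (idempotent) matrices over a ring `R`: after enlarging by zero diagonal blocks
to a common size `N`, they are conjugate by an invertible `N × N` matrix. -/
def IdemEquiv {R : Type*} [Ring R] {ι κ : Type*} [Fintype ι] [Fintype κ]
    (P : Matrix ι ι R) (Q : Matrix κ κ R) : Prop :=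
  ∃ (N : ℕ) (f : ι ↪ Fin N) (g : κ ↪ Fin N) (U : (Matrix (Fin N) (Fin N) R)ˣ),
    U.val * padMat f P * (U⁻¹).val = padMat g Q


section Columns

open Matrix

variable {R : Type*} [Ring R] {κ : Type*} [Fintype κ] [DecidableEq κ]

/-- Two columns lie in the same orbit of the general linear group. -/
def ColEquiv (b c : κ → R) : Prop := ∃ G : (Matrix κ κ R)ˣ, G.val *ᵥ b = c

theorem ColEquiv.trans {a b c : κ → R} (h : ColEquiv a b) (h' : ColEquiv b c) : ColEquiv a c := by
  obtain ⟨G, rfl⟩ := h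
  obtain ⟨G', rfl⟩ := h'
  exact ⟨G' * G, by simp [mulVec_mulVec]⟩

theorem ColEquiv.symm {b c : κ → R} (h : ColEquiv b c) : ColEquiv c b := by
  obtain ⟨G, rfl⟩ := h
  exact ⟨G⁻¹, by simp [mulVec_mulVec]⟩

theorem ColEquiv.exists_dotProduct_eq_one {b c : κ → R} (h : ColEquiv b c)
    (hb : ∃ y, y ⬝ᵥ b = 1) : ∃ y, y ⬝ᵥ c = 1 := by
  obtain ⟨G, rfl⟩ := h
  obtain ⟨y, hy⟩ := hb
  refine ⟨y ᵥ* (G⁻¹).val, ?_⟩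
  rw [← dotProduct_mulVec, mulVec_mulVec]
  simpa using hy

theorem isUnit_one_add_mul_swap {ι : Type*} [Fintype ι] [DecidableEq ι]
    (U : Matrix κ ι R) (V : Matrix ι κ R) (h : IsUnit (1 + V * U)) : IsUnit (1 + U * V) := by
  obtain ⟨T, hT⟩ := h
  have h₁ : (1 + V * U) * (T⁻¹).val = 1 := by rw [← hT]; simp
  have h₂ : (T⁻¹).val * (1 + V * U) = 1 := by rw [← hT]; simp
  refine ⟨⟨1 + U * V, 1 - U * (T⁻¹).val * V, ?_, ?_⟩, rfl⟩
  · have : (1 + U * V) * (1 - U * (T⁻¹).val * V)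
        = 1 + U * V - U * ((1 + V * U) * (T⁻¹).val) * V := by
      simp only [Matrix.add_mul, Matrix.mul_add, Matrix.mul_sub, Matrix.one_mul, Matrix.mul_one,
        Matrix.mul_assoc]
    rw [this, h₁]
    simp
  · have : (1 - U * (T⁻¹).val * V) * (1 + U * V)
        = 1 + U * V - U * ((T⁻¹).val * (1 + V * U)) * V := by
      simp only [Matrix.add_mul, Matrix.mul_add, Matrix.sub_mul, Matrix.one_mul, Matrix.mul_one,
        Matrix.mul_assoc]
      abel
    rw [this, h₂]
    simp

/-- The rank-one modification `b ↦ b + u (v · b)` is implemented by an invertible matrix as soon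
as `1 + v · u` is a unit. -/
theorem colEquiv_add_mul_dotProduct (b u v : κ → R) (h : IsUnit (1 + v ⬝ᵥ u)) :
    ColEquiv b (fun i => b i + u i * (v ⬝ᵥ b)) := by
  have key : IsUnit (1 + replicateCol Unit u * replicateRow Unit v) := by
    apply isUnit_one_add_mul_swap
    have := h.map (Matrix.scalar Unit)
    convert this using 1
    ext i j
    simp [Matrix.mul_apply, dotProduct]
  obtain ⟨G, hG⟩ := key
  refine ⟨G, ?_⟩
  ext i
  rw [hG, add_mulVec, one_mulVec, ← mulVec_mulVec]
  simp [mulVec, dotProduct, -mulVec_mulVec]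

theorem colEquiv_of_isUnit_dotProduct {b c y : κ → R} (hb : IsUnit (y ⬝ᵥ b))
    (hc : IsUnit (y ⬝ᵥ c)) : ColEquiv b c := by
  obtain ⟨t, ht⟩ := hb
  have hy : (fun i => (t⁻¹).val * y i) ⬝ᵥ b = 1 := by
    have : (fun i => (t⁻¹).val * y i) ⬝ᵥ b = (t⁻¹).val * (y ⬝ᵥ b) := by
      simp [dotProduct, Finset.mul_sum, mul_assoc]
    rw [this, ← ht]; simp
  have hy' : (fun i => (t⁻¹).val * y i) ⬝ᵥ c = (t⁻¹).val * (y ⬝ᵥ c) := by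
    simp [dotProduct, Finset.mul_sum, mul_assoc]
  have := colEquiv_add_mul_dotProduct b (c - b) (fun i => (t⁻¹).val * y i) (by
    rw [dotProduct_sub, hy, hy', add_sub_cancel]
    exact (t⁻¹).isUnit.mul hc)
  rw [hy] at this
  simpa using this

end Columns

section Idempotents

open Matrix

variable {R : Type*} [Ring R]

/-- Algebraic Murray–von Neumann equivalence of square matrices. -/
def MvNEquiv {ι κ : Type*} [Fintype ι] [Fintype κ] (P : Matrix ι ι R) (Q : Matrix κ κ R) : Prop :=
  ∃ (A : Matrix ι κ R) (B : Matrix κ ι R), A * B = P ∧ B * A = Q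

theorem MvNEquiv.submatrix {ι κ ι' κ' : Type*} [Fintype ι] [Fintype κ] [Fintype ι'] [Fintype κ']
    {P : Matrix ι ι R} {Q : Matrix κ κ R} (h : MvNEquiv P Q) (e : ι' ≃ ι) (f : κ' ≃ κ) :
    MvNEquiv (P.submatrix e e) (Q.submatrix f f) := by
  obtain ⟨A, B, rfl, rfl⟩ := h
  exact ⟨A.submatrix e f, B.submatrix f e, by simp [submatrix_mul_equiv],
    by simp [submatrix_mul_equiv]⟩

theorem padMat_eq_mul {ι : Type*} [Fintype ι] [DecidableEq ι] {N : ℕ} (f : ι ↪ Fin N)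
    (P : Matrix ι ι R) :
    padMat f P = (1 : Matrix (Fin N) (Fin N) R).submatrix id f * P *
      (1 : Matrix (Fin N) (Fin N) R).submatrix f id := by
  ext i j
  simp only [padMat, Matrix.mul_apply, submatrix_apply, id, one_apply, ite_mul,
    mul_ite, one_mul, zero_mul, mul_one, mul_zero]
  rw [Finset.sum_comm]
  refine Finset.sum_congr rfl fun b _ => ?_
  split_ifs with h
  · simp [h, eq_comm]
  · simp [h]

theorem padMat_apply_apply {ι : Type*} [Fintype ι] {N : ℕ} (f : ι ↪ Fin N)
    (P : Matrix ι ι R) (a b : ι) : padMat f P (f a) (f b) = P a b := by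
  classical
  simp [padMat, ite_and]

theorem padMat_apply_eq_zero {ι : Type*} [Fintype ι] {N : ℕ} (f : ι ↪ Fin N)
    (P : Matrix ι ι R) {i j : Fin N} (h : (∀ a, f a ≠ i) ∨ ∀ b, f b ≠ j) :
    padMat f P i j = 0 := by
  refine Finset.sum_eq_zero fun a _ => Finset.sum_eq_zero fun b _ => if_neg ?_
  rintro ⟨ha, hb⟩
  exact h.elim (fun h => h a ha) fun h => h b hb

theorem submatrix_one_mul_submatrix_one {ι : Type*} [DecidableEq ι] {N : ℕ} (f : ι ↪ Fin N) :
    (1 : Matrix (Fin N) (Fin N) R).submatrix f id *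
      (1 : Matrix (Fin N) (Fin N) R).submatrix id f = (1 : Matrix ι ι R) := by
  ext i j
  simp [Matrix.mul_apply, one_apply]

theorem IdemEquiv.mvNEquiv {ι κ : Type*} [Fintype ι] [Fintype κ] [DecidableEq ι] [DecidableEq κ]
    {P : Matrix ι ι R} {Q : Matrix κ κ R} (h : IdemEquiv P Q) (hP : P * P = P) (hQ : Q * Q = Q) :
    MvNEquiv P Q := by
  obtain ⟨N, f, g, U, hU⟩ := h
  rw [padMat_eq_mul, padMat_eq_mul] at hU
  have hf := submatrix_one_mul_submatrix_one (R := R) f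
  have hg := submatrix_one_mul_submatrix_one (R := R) g
  set F := (1 : Matrix (Fin N) (Fin N) R).submatrix id f
  set F' := (1 : Matrix (Fin N) (Fin N) R).submatrix f id
  set G := (1 : Matrix (Fin N) (Fin N) R).submatrix id g
  set G' := (1 : Matrix (Fin N) (Fin N) R).submatrix g id
  have hU' : F * P * F' = (U⁻¹).val * (G * Q * G') * U.val := by
    rw [← hU]
    simp [mul_assoc]
  refine ⟨P * F' * (U⁻¹).val * G * Q, Q * G' * U.val * F * P, ?_, ?_⟩
  · calc P * F' * (U⁻¹).val * G * Q * (Q * G' * U.val * F * P)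
        = P * F' * ((U⁻¹).val * (G * (Q * Q) * G') * U.val) * F * P := by
          simp only [Matrix.mul_assoc]
      _ = P * (F' * F) * P * (F' * F) * P := by
          rw [hQ, ← hU']; simp only [Matrix.mul_assoc]
      _ = P := by rw [hf]; simp [hP]
  · calc Q * G' * U.val * F * P * (P * F' * (U⁻¹).val * G * Q)
        = Q * G' * (U.val * (F * (P * P) * F') * (U⁻¹).val) * G * Q := by
          simp only [Matrix.mul_assoc]
      _ = Q * (G' * G) * Q * (G' * G) * Q := by
          rw [hP, hU]; simp only [Matrix.mul_assoc]
      _ = Q := by rw [hg]; simp [hQ]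

theorem MvNEquiv.idemEquiv_one {k m : ℕ} {P : Matrix (Fin k) (Fin k) R}
    (h : MvNEquiv P (1 : Matrix (Fin m) (Fin m) R)) :
    IdemEquiv P (1 : Matrix (Fin m) (Fin m) R) := by
  obtain ⟨A, B, rfl, hBA⟩ := h
  have h₁ : A * B * A = A := by rw [Matrix.mul_assoc, hBA, Matrix.mul_one]
  have h₂ : B * (A * B) = B := by rw [← Matrix.mul_assoc, hBA, Matrix.one_mul]
  let W : Matrix (Fin k ⊕ Fin m) (Fin k ⊕ Fin m) R := fromBlocks (1 - A * B) A B 0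
  have hW : W * W = 1 := by
    simp only [W, fromBlocks_multiply, Matrix.sub_mul, Matrix.mul_sub, Matrix.one_mul,
      Matrix.mul_one, Matrix.mul_zero, h₁, h₂, hBA]
    rw [← Matrix.mul_assoc, h₁]
    simp
  have hWP : W * fromBlocks (A * B) 0 0 0 * W = fromBlocks 0 0 0 1 := by
    have h₃ : A * B * (A * B) = A * B := by rw [← Matrix.mul_assoc, h₁]
    simp [W, fromBlocks_multiply, Matrix.sub_mul, Matrix.mul_sub, h₂, h₃, hBA]
  let e := (finSumFinEquiv (m := k) (n := m)).symm
  have hWe : W.submatrix e e * W.submatrix e e = 1 := by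
    rw [submatrix_mul_equiv, hW, submatrix_one_equiv]
  refine ⟨k + m, Fin.castAddEmb m, Fin.natAddEmb k,
    ⟨W.submatrix e e, W.submatrix e e, hWe, hWe⟩, ?_⟩
  have hne (a : Fin k) (b : Fin m) : Fin.castAdd m a ≠ Fin.natAdd k b := fun h => by
    have := congrArg Fin.val h
    simp only [Fin.val_castAdd, Fin.val_natAdd] at this
    omega
  have h₄ : padMat (Fin.castAddEmb m) (A * B) =
      (fromBlocks (A * B) 0 0 (0 : Matrix (Fin m) (Fin m) R)).submatrix e e := by
    ext i j
    obtain ⟨i, rfl⟩ := finSumFinEquiv.surjective i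
    obtain ⟨j, rfl⟩ := finSumFinEquiv.surjective j
    simp only [submatrix_apply, e, Equiv.symm_apply_apply]
    rcases i with i | i
    · rcases j with j | j
      · exact padMat_apply_apply (Fin.castAddEmb m) _ i j
      · exact padMat_apply_eq_zero _ _ (Or.inr fun b => hne b j)
    · rw [padMat_apply_eq_zero _ _ (Or.inl fun b => hne b i)]
      rcases j with j | j <;> rfl
  have h₅ : padMat (Fin.natAddEmb k) (1 : Matrix (Fin m) (Fin m) R) =
      (fromBlocks 0 0 0 1 : Matrix (Fin k ⊕ Fin m) (Fin k ⊕ Fin m) R).submatrix e e := by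
    ext i j
    obtain ⟨i, rfl⟩ := finSumFinEquiv.surjective i
    obtain ⟨j, rfl⟩ := finSumFinEquiv.surjective j
    simp only [submatrix_apply, e, Equiv.symm_apply_apply]
    rcases i with i | i
    · rw [padMat_apply_eq_zero _ _ (Or.inl fun b => (hne i b).symm)]
      rcases j with j | j <;> rfl
    · rcases j with j | j
      · exact padMat_apply_eq_zero _ _ (Or.inr fun b => (hne j b).symm)
      · exact padMat_apply_apply (Fin.natAddEmb k) _ i j
  rw [h₄, h₅, ← hWP]
  simp only [Units.inv_mk, submatrix_mul_equiv]

/-- If unimodular columns of length `s + 1` can be moved to the last basis vector, then one free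
summand can be cancelled from a complement of a free module of rank `s + 1`. -/
theorem MvNEquiv.cancel_unit {ι : Type*} [Fintype ι] {s : ℕ}
    (htrans : ∀ b : Fin s ⊕ Unit → R, (∃ y, y ⬝ᵥ b = 1) → ColEquiv b (Pi.single (Sum.inr ()) 1))
    {Q : Matrix ι ι R}
    (h : MvNEquiv (fromBlocks Q 0 0 (1 : Matrix Unit Unit R))
      (1 : Matrix (Fin s ⊕ Unit) (Fin s ⊕ Unit) R)) :
    MvNEquiv Q (1 : Matrix (Fin s) (Fin s) R) := by
  obtain ⟨A, B, hAB, hBA⟩ := h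
  have hcb : A (Sum.inr ()) ⬝ᵥ (fun i => B i (Sum.inr ())) = 1 := by
    have := congrFun (congrFun hAB (Sum.inr ())) (Sum.inr ())
    simpa [Matrix.mul_apply, dotProduct] using this
  obtain ⟨G, hG⟩ := htrans (fun i => B i (Sum.inr ())) ⟨_, hcb⟩
  set A₁ := A * (G⁻¹).val with hA₁
  set B₁ := G.val * B with hB₁
  have hAB₁ : A₁ * B₁ = fromBlocks Q 0 0 (1 : Matrix Unit Unit R) := by
    rw [← hAB, hA₁, hB₁, Matrix.mul_assoc, ← Matrix.mul_assoc (G⁻¹).val]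
    simp
  have hBA₁ : B₁ * A₁ = 1 := by
    rw [hA₁, hB₁, Matrix.mul_assoc, ← Matrix.mul_assoc B, hBA]
    simp
  have hcol : ∀ i, B₁ i (Sum.inr ()) = (Pi.single (Sum.inr ()) 1 : Fin s ⊕ Unit → R) i :=
    fun i => by rw [← hG]; rfl
  obtain ⟨A₁₁, A₁₂, A₂₁, A₂₂, hA₂⟩ :
      ∃ a b c d, A₁ = fromBlocks a b c d := ⟨_, _, _, _, (fromBlocks_toBlocks A₁).symm⟩
  obtain ⟨B₁₁, B₁₂, B₂₁, B₂₂, hB₂⟩ :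
      ∃ a b c d, B₁ = fromBlocks a b c d := ⟨_, _, _, _, (fromBlocks_toBlocks B₁).symm⟩
  have hB₁₂ : B₁₂ = 0 := by
    ext i j
    simpa [hB₂] using hcol (Sum.inl i)
  have hB₂₂ : B₂₂ = 1 := by
    ext i j
    simpa [hB₂] using hcol (Sum.inr ())
  rw [hA₂, hB₂, hB₁₂, hB₂₂, fromBlocks_multiply, fromBlocks_inj] at hAB₁
  rw [hA₂, hB₂, hB₁₂, hB₂₂, fromBlocks_multiply, ← fromBlocks_one, fromBlocks_inj] at hBA₁
  obtain ⟨hQ, h₀, -, -⟩ := hAB₁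
  have hA₁₂ : A₁₂ = 0 := by simpa using h₀
  exact ⟨A₁₁, B₁₁, by simpa [hA₁₂] using hQ, by simpa using hBA₁.1⟩

theorem MvNEquiv.cancel_free {k m : ℕ}
    (htrans : ∀ s, m ≤ s → ∀ b : Fin s ⊕ Unit → R, (∃ y, y ⬝ᵥ b = 1) →
      ColEquiv b (Pi.single (Sum.inr ()) 1))
    {P : Matrix (Fin k) (Fin k) R} (r : ℕ)
    (h : MvNEquiv (fromBlocks P 0 0 (1 : Matrix (Fin r) (Fin r) R))
      (1 : Matrix (Fin (m + r)) (Fin (m + r)) R)) :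
    MvNEquiv P (1 : Matrix (Fin m) (Fin m) R) := by
  induction r with
  | zero =>
    have := h.submatrix (Equiv.sumEmpty (Fin k) (Fin 0)).symm (Equiv.refl _)
    simpa using! this
  | succ r ih =>
    apply ih
    apply MvNEquiv.cancel_unit (htrans (m + r) (by omega))
    let e₀ : Fin r ⊕ Unit ≃ Fin (r + 1) :=
      (Equiv.sumCongr (Equiv.refl _) (Equiv.ofUnique Unit (Fin 1))).trans finSumFinEquiv
    let e₁ : Fin (m + r) ⊕ Unit ≃ Fin (m + (r + 1)) :=
      (Equiv.sumCongr (Equiv.refl _) (Equiv.ofUnique Unit (Fin 1))).trans finSumFinEquiv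
    let e := (Equiv.sumAssoc (Fin k) (Fin r) Unit).trans (Equiv.sumCongr (Equiv.refl _) e₀)
    have := h.submatrix e e₁
    rw [submatrix_one_equiv] at this
    convert this using 1
    ext i j
    rcases i with (i | i) | i <;> rcases j with (j | j) | j <;>
      simp [e, one_apply]

end Idempotents

section Corner

open Matrix Filter Topology

variable {R : Type*} [NormedRing R] [HasSummableGeomSeries R] {κ : Type*} [Fintype κ]
  [DecidableEq κ]

/-- A unimodular column that differs from a basis vector only through a corner `p = 1 - sᴺ tᴺ`,
where `t` is a left inverse of the shift-like element `s`, can be moved to that basis vector. -/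
theorem colEquiv_single_of_corner {s t : R} (hts : t * s = 1) (hs : ∀ M : ℕ, ‖s ^ M‖ ≤ 1) {N : ℕ}
    (hlim : ∀ x, Tendsto (fun M : ℕ => t ^ M * x * (1 - s ^ N * t ^ N)) atTop (𝓝 0))
    {i₀ i₁ : κ} (hne : i₁ ≠ i₀) (X : κ → R)
    (hX : ∃ y, y ⬝ᵥ (Pi.single i₀ 1 + fun i => X i * (1 - s ^ N * t ^ N)) = 1) :
    ColEquiv (Pi.single i₀ 1 + fun i => X i * (1 - s ^ N * t ^ N)) (Pi.single i₀ 1) := by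
  obtain ⟨y, hy⟩ := hX
  have hpow (M : ℕ) : t ^ M * s ^ M = 1 := by
    induction M with
    | zero => simp
    | succ M ih => rw [pow_succ, pow_succ', mul_assoc, ← mul_assoc t, hts, one_mul, ih]
  have hpp : (1 - s ^ N * t ^ N) * (1 - s ^ N * t ^ N) = 1 - s ^ N * t ^ N := by
    have : s ^ N * t ^ N * (s ^ N * t ^ N) = s ^ N * t ^ N := by
      rw [mul_assoc, ← mul_assoc (t ^ N), hpow, one_mul]
    simp [mul_sub, sub_mul, this]
  set p := 1 - s ^ N * t ^ N
  have hlim₁ : Tendsto (fun M : ℕ => y i₁ * (s ^ M * (t ^ M * X i₁ * p))) atTop (𝓝 0) := by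
    have h : Tendsto (fun M : ℕ => s ^ M * (t ^ M * X i₁ * p)) atTop (𝓝 0) := by
      refine squeeze_zero_norm (fun M => ?_) (tendsto_zero_iff_norm_tendsto_zero.mp (hlim (X i₁)))
      calc ‖s ^ M * (t ^ M * X i₁ * p)‖ ≤ ‖s ^ M‖ * ‖t ^ M * X i₁ * p‖ := norm_mul_le _ _
        _ ≤ 1 * ‖t ^ M * X i₁ * p‖ := by gcongr; exact hs M
        _ = _ := one_mul _
    simpa using h.const_mul (y i₁)
  have hlim₂ : Tendsto (fun M : ℕ => X i₀ * p * (t ^ M * X i₁ * p)) atTop (𝓝 0) := by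
    simpa using (hlim (X i₁)).const_mul (X i₀ * p)
  obtain ⟨M, hM₁, hM₂⟩ :=
    ((hlim₁.norm.eventually_lt_const (by simp : ‖(0 : R)‖ < 1)).and
      (hlim₂.norm.eventually_lt_const (by simp : ‖(0 : R)‖ < 1))).exists
  set b : κ → R := Pi.single i₀ 1 + fun i => X i * p with hb
  have hb₁ : b i₁ = X i₁ * p := by simp [hb, hne]
  have hb₀ : b i₀ = 1 + X i₀ * p := by simp [hb]
  let y' : κ → R := y - Pi.single i₁ (y i₁ * s ^ M * t ^ M)
  have hy' : y' ⬝ᵥ b = 1 - y i₁ * (s ^ M * (t ^ M * X i₁ * p)) := by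
    simp only [y', sub_dotProduct, hy, single_dotProduct, hb₁, mul_assoc]
  obtain ⟨u, hu⟩ := isUnit_one_sub_of_norm_lt_one hM₁
  let v : κ → R := fun i => (u⁻¹).val * y' i
  have hv : v ⬝ᵥ b = 1 := by
    have : v ⬝ᵥ b = (u⁻¹).val * (y' ⬝ᵥ b) := by simp [v, dotProduct, Finset.mul_sum, mul_assoc]
    rw [this, hy', ← hu, Units.inv_mul]
  have hvw : v ⬝ᵥ Pi.single i₁ (s ^ M * p) = 0 := by
    have : s ^ M * (t ^ M * (s ^ M * p)) = s ^ M * p := by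
      rw [← mul_assoc (t ^ M), hpow, one_mul]
    simp [v, y', sub_mul, mul_assoc, this]
  have h₁ := colEquiv_add_mul_dotProduct b (Pi.single i₁ (s ^ M * p)) v (by simp [hvw])
  refine h₁.trans (colEquiv_of_isUnit_dotProduct
    (y := Pi.single i₀ 1 - Pi.single i₁ (X i₀ * p * t ^ M)) ?_ ?_)
  · convert isUnit_one_sub_of_norm_lt_one hM₂ using 1
    have : X i₀ * (p * (t ^ M * (s ^ M * p))) = X i₀ * p := by
      rw [← mul_assoc (t ^ M), hpow, one_mul, hpp]
    simp [hv, sub_dotProduct, hb₁, hb₀, hne.symm, mul_add, mul_assoc, this]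
  · simp [hne]

end Corner

section Shifts

variable {n : ℕ}

theorem orthonormal_delta : Orthonormal ℂ (delta (n := n)) := by
  have := (HilbertBasis.ofRepr (LinearIsometryEquiv.refl ℂ (Hn n))).orthonormal
  convert this using 1
  ext z : 1
  simp only [← HilbertBasis.repr_symm_single]
  rfl

theorem dense_span_delta : Dense (Submodule.span ℂ (Set.range (delta (n := n))) : Set (Hn n)) := by
  have := (HilbertBasis.ofRepr (LinearIsometryEquiv.refl ℂ (Hn n))).dense_span
  rw [Submodule.dense_iff_topologicalClosure_eq_top, ← this]
  congr 3
  ext z : 1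
  simp only [← HilbertBasis.repr_symm_single]
  rfl

theorem clm_ext_delta {E : Type*} [NormedAddCommGroup E] [NormedSpace ℂ E]
    {S T : Hn n →L[ℂ] E} (h : ∀ z, S (delta z) = T (delta z)) : S = T :=
  ContinuousLinearMap.ext_on dense_span_delta (by rintro _ ⟨z, rfl⟩; exact h z)

/-- The isometry of `H_n` determined by an orthonormal family. -/
def isometryOfOrthonormal {E : Type*} [NormedAddCommGroup E] [InnerProductSpace ℂ E]
    [CompleteSpace E] {v : (Fin n → ℕ) → E} (hv : Orthonormal ℂ v) : Hn n →ₗᵢ[ℂ] E :=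
  hv.orthogonalFamily.linearIsometry

theorem isometryOfOrthonormal_delta {E : Type*} [NormedAddCommGroup E] [InnerProductSpace ℂ E]
    [CompleteSpace E] {v : (Fin n → ℕ) → E} (hv : Orthonormal ℂ v) (z : Fin n → ℕ) :
    isometryOfOrthonormal hv (delta z) = v z := by
  unfold isometryOfOrthonormal delta
  rw [OrthogonalFamily.linearIsometry_apply_single]
  simp

/-- The shift `δ_w ↦ δ_{w + z}`. -/
def shiftBy (z : Fin n → ℕ) : Hn n →L[ℂ] Hn n :=
  (isometryOfOrthonormal
    (orthonormal_delta.comp (fun w => w + z) (add_left_injective z))).toContinuousLinearMap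

@[simp]
theorem shiftBy_delta (z w : Fin n → ℕ) : shiftBy z (delta w) = delta (w + z) :=
  isometryOfOrthonormal_delta
    (orthonormal_delta.comp (fun w => w + z) (add_left_injective z)) w

theorem norm_shiftBy_apply (z : Fin n → ℕ) (v : Hn n) : ‖shiftBy z v‖ = ‖v‖ :=
  LinearIsometry.norm_map _ v

theorem shiftBy_zero : shiftBy (0 : Fin n → ℕ) = 1 :=
  clm_ext_delta fun w => by simp

theorem shiftBy_add (z z' : Fin n → ℕ) : shiftBy (z + z') = shiftBy z * shiftBy z' :=
  clm_ext_delta fun w => by simp [add_assoc, add_comm z z']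

theorem star_shiftBy_mul_self (z : Fin n → ℕ) : star (shiftBy z) * shiftBy z = 1 :=
  (ContinuousLinearMap.norm_map_iff_adjoint_comp_self _).mp (norm_shiftBy_apply z)

theorem isShift_iff {i : Fin n} {T : Hn n →L[ℂ] Hn n} :
    IsShift i T ↔ T = shiftBy (Pi.single i 1) := by
  have key (z : Fin n → ℕ) : Function.update z i (z i + 1) = z + Pi.single i 1 := by
    ext j
    by_cases h : j = i
    · subst h; simp
    · simp [h]
  constructor
  · exact fun h => clm_ext_delta fun z => by rw [h z, key, shiftBy_delta]
  · rintro rfl z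
    rw [shiftBy_delta, key]

theorem shiftBy_nsmul (z : Fin n → ℕ) (N : ℕ) : shiftBy (N • z) = shiftBy z ^ N := by
  induction N with
  | zero => simp [shiftBy_zero]
  | succ N ih => rw [succ_nsmul, shiftBy_add, ih, pow_succ]

theorem shiftBy_mem_toeplitz (z : Fin n → ℕ) : shiftBy z ∈ Toeplitz n := by
  rw [← Finset.univ_sum_single z]
  refine Finset.sum_induction _ (fun z => shiftBy z ∈ Toeplitz n) (fun z w hz hw => ?_) ?_
    fun i _ => ?_
  · rw [shiftBy_add]
    exact mul_mem hz hw
  · rw [shiftBy_zero]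
    exact one_mem _
  · have : Pi.single i (z i) = z i • (Pi.single i 1 : Fin n → ℕ) := by
      rw [← Pi.single_smul]; simp
    rw [this, shiftBy_nsmul]
    have hmem : shiftBy (Pi.single i 1) ∈
        StarAlgebra.adjoin ℂ {T : Hn n →L[ℂ] Hn n | ∃ i : Fin n, IsShift i T} :=
      StarAlgebra.subset_adjoin ℂ _ ⟨i, isShift_iff.mpr rfl⟩
    exact pow_mem (StarSubalgebra.le_topologicalClosure _ hmem) _

/-- The polynomial functional calculus of the commuting coordinate shifts. -/
def analyticToeplitz (n : ℕ) : AddMonoidAlgebra ℂ (Fin n → ℕ) →ₐ[ℂ] (Hn n →L[ℂ] Hn n) :=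
  AddMonoidAlgebra.lift ℂ _ _
    { toFun := fun z => shiftBy z.toAdd
      map_one' := shiftBy_zero
      map_mul' := fun z w => shiftBy_add z.toAdd w.toAdd }

@[simp]
theorem analyticToeplitz_single (z : Fin n → ℕ) (c : ℂ) :
    analyticToeplitz n (AddMonoidAlgebra.single z c) = c • shiftBy z := by
  simp [analyticToeplitz, AddMonoidAlgebra.lift_single]

/-- Polynomial elements of the Toeplitz algebra become analytic after multiplication by a high
power of the diagonal shift. -/
theorem exists_mul_shift_pow_eq_analyticToeplitz {a : Hn n →L[ℂ] Hn n}
    (ha : a ∈ StarAlgebra.adjoin ℂ {T : Hn n →L[ℂ] Hn n | ∃ i : Fin n, IsShift i T}) :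
    ∃ N : ℕ, ∀ M, N ≤ M → ∃ f, a * shiftBy 1 ^ M = analyticToeplitz n f := by
  have hpow (M : ℕ) : shiftBy (1 : Fin n → ℕ) ^ M =
      analyticToeplitz n (AddMonoidAlgebra.single (M • 1) 1) := by
    simp [← shiftBy_nsmul]
  suffices ∃ N f, a * shiftBy 1 ^ N = analyticToeplitz n f by
    obtain ⟨N, f, hf⟩ := this
    refine ⟨N, fun M hM => ⟨f * AddMonoidAlgebra.single ((M - N) • 1) 1, ?_⟩⟩
    rw [map_mul, ← hf, ← hpow, mul_assoc, ← pow_add, Nat.add_sub_cancel' hM]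
  rw [← StarSubalgebra.mem_toSubalgebra, StarAlgebra.adjoin_toSubalgebra] at ha
  induction ha using Algebra.adjoin_induction with
  | mem x hx =>
    rcases hx with ⟨i, hi⟩ | ⟨i, hi⟩
    · exact ⟨0, AddMonoidAlgebra.single (Pi.single i 1) 1, by simp [isShift_iff.mp hi]⟩
    · refine ⟨1, AddMonoidAlgebra.single (1 - Pi.single i 1) 1, ?_⟩
      have h₁ : (1 : Fin n → ℕ) = Pi.single i 1 + (1 - Pi.single i 1) := by
        ext j
        by_cases h : j = i
        · subst h; simp
        · simp [h]
      have h₂ : x = star (shiftBy (Pi.single i 1)) := by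
        rw [← isShift_iff.mp hi, star_star]
      rw [pow_one, h₂]
      conv_lhs => rw [h₁, shiftBy_add, ← mul_assoc, star_shiftBy_mul_self, one_mul]
      simp
  | algebraMap r => exact ⟨0, algebraMap _ _ r, by rw [AlgHom.commutes, pow_zero, mul_one]⟩
  | add x y _ _ hx hy =>
    obtain ⟨N, f, hf⟩ := hx
    obtain ⟨M, g, hg⟩ := hy
    refine ⟨N + M, f * AddMonoidAlgebra.single (M • 1) 1 + g * AddMonoidAlgebra.single (N • 1) 1,
      ?_⟩
    rw [map_add, map_mul, map_mul, ← hf, ← hg, ← hpow, ← hpow, mul_assoc, mul_assoc, ← pow_add,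
      ← pow_add, add_mul, add_comm M N]
  | mul x y _ _ hx hy =>
    obtain ⟨N, f, hf⟩ := hx
    obtain ⟨M, g, hg⟩ := hy
    refine ⟨M + N, f * g, ?_⟩
    rw [pow_add, mul_assoc, ← mul_assoc y, hg, hpow N, ← map_mul, mul_comm g, map_mul, ← hpow,
      ← mul_assoc, hf, map_mul]

end Shifts

section Symbols

open MeasureTheory UnitAddTorus Topology

/-- The circle carries its normalised Haar measure. -/
local instance haarMeasureSpace : MeasureSpace UnitAddCircle := ⟨AddCircle.haarAddCircle⟩

local instance : Measure.IsAddHaarMeasure (volume : Measure UnitAddCircle) :=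
  inferInstanceAs (Measure.IsAddHaarMeasure AddCircle.haarAddCircle)

local instance : IsProbabilityMeasure (volume : Measure UnitAddCircle) :=
  inferInstanceAs (IsProbabilityMeasure AddCircle.haarAddCircle)

variable {n : ℕ}

/-- The trigonometric polynomial on the torus attached to a polynomial. -/
def torusSymbol (n : ℕ) : AddMonoidAlgebra ℂ (Fin n → ℕ) →ₐ[ℂ] C(UnitAddTorus (Fin n), ℂ) :=
  AddMonoidAlgebra.lift ℂ _ _
    { toFun := fun z => mFourier fun i => (z.toAdd i : ℤ)
      map_one' := by simpa using! mFourier_zero (d := Fin n)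
      map_mul' := fun z w => by
        ext x
        rw [ContinuousMap.mul_apply, ← mFourier_add]
        congr }

@[simp]
theorem torusSymbol_single (z : Fin n → ℕ) (c : ℂ) :
    torusSymbol n (AddMonoidAlgebra.single z c) = c • mFourier fun i => (z i : ℤ) := by
  simp [torusSymbol, AddMonoidAlgebra.lift_single]

theorem norm_sq_toLp (h : C(UnitAddTorus (Fin n), ℂ)) :
    ‖ContinuousMap.toLp 2 volume ℂ h‖ ^ 2 = ∫ x, ‖h x‖ ^ 2 := by
  have h₁ := @inner_self_eq_norm_sq ℂ _ _ _ _ (ContinuousMap.toLp 2 volume ℂ h)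
  rw [← h₁, MeasureTheory.ContinuousMap.inner_toLp]
  have : ∀ x, h x * (starRingEnd ℂ) (h x) = ((‖h x‖ ^ 2 : ℝ) : ℂ) := fun x => by
    rw [RCLike.mul_conj]; simp
  simp only [this]
  rw [integral_complex_ofReal]
  exact Complex.ofReal_re _

theorem norm_analyticToeplitz_delta_zero (g : AddMonoidAlgebra ℂ (Fin n → ℕ)) :
    ‖analyticToeplitz n g (delta 0)‖ ^ 2 = ∫ x, ‖torusSymbol n g x‖ ^ 2 := by
  have hv : Orthonormal ℂ (fun z : Fin n → ℕ => mFourierLp 2 fun i => (z i : ℤ)) :=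
    orthonormal_mFourier.comp (fun (z : Fin n → ℕ) i => (z i : ℤ)) fun z w h => by
      ext i
      exact Int.ofNat_injective (congrFun h i)
  have key : isometryOfOrthonormal hv (analyticToeplitz n g (delta 0)) =
      ContinuousMap.toLp 2 volume ℂ (torusSymbol n g) := by
    induction g using AddMonoidAlgebra.induction_on with
    | of z =>
      simp [AddMonoidAlgebra.of_apply, isometryOfOrthonormal_delta]
    | add f g hf hg => simp [hf, hg]
    | smul r f hf => simp [hf]
  rw [← norm_sq_toLp, ← key, LinearIsometry.norm_map]

theorem dense_range_analyticToeplitz_delta_zero :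
    DenseRange fun g : AddMonoidAlgebra ℂ (Fin n → ℕ) => analyticToeplitz n g (delta 0) := by
  refine dense_span_delta.mono ?_
  let ψ : AddMonoidAlgebra ℂ (Fin n → ℕ) →ₗ[ℂ] Hn n :=
    (ContinuousLinearMap.apply ℂ (Hn n) (delta 0)).toLinearMap ∘ₗ (analyticToeplitz n).toLinearMap
  have : Submodule.span ℂ (Set.range (delta (n := n))) ≤ LinearMap.range ψ := by
    rw [Submodule.span_le]
    rintro _ ⟨z, rfl⟩
    exact ⟨AddMonoidAlgebra.single z 1, by simp [ψ]⟩
  exact this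

/-- If the symbols have no common zero on the torus, the column of analytic Toeplitz operators is
bounded below. -/
theorem exists_bound_of_torusSymbol_ne_zero {ι : Type*} [Fintype ι]
    (f : ι → AddMonoidAlgebra ℂ (Fin n → ℕ)) (hf : ∀ x, ∃ i, torusSymbol n (f i) x ≠ 0) :
    ∃ ε > 0, ∀ v : Hn n, ε * ‖v‖ ^ 2 ≤ ∑ i, ‖analyticToeplitz n (f i) v‖ ^ 2 := by
  have hcont : Continuous fun x => ∑ i, ‖torusSymbol n (f i) x‖ ^ 2 := by fun_prop
  obtain ⟨x₀, -, hx₀⟩ := isCompact_univ.exists_isMinOn Set.univ_nonempty hcont.continuousOn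
  refine ⟨∑ i, ‖torusSymbol n (f i) x₀‖ ^ 2, ?_, ?_⟩
  · obtain ⟨i, hi⟩ := hf x₀
    exact Finset.sum_pos' (fun i _ => by positivity) ⟨i, Finset.mem_univ i, by positivity⟩
  refine isClosed_property dense_range_analyticToeplitz_delta_zero
    (isClosed_le (by fun_prop) (by fun_prop)) fun g => ?_
  have hint (h : C(UnitAddTorus (Fin n), ℂ)) : Integrable fun x => ‖h x‖ ^ 2 :=
    Continuous.integrable_of_hasCompactSupport (by fun_prop)
      (HasCompactSupport.of_compactSpace _)
  have hmul (i : ι) : analyticToeplitz n (f i) (analyticToeplitz n g (delta 0)) =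
      analyticToeplitz n (f i * g) (delta 0) := by
    rw [map_mul]; rfl
  simp only [hmul, norm_analyticToeplitz_delta_zero]
  rw [← integral_const_mul, ← integral_finsetSum _ fun i _ => hint _]
  refine integral_mono ((hint _).const_mul _) (integrable_finsetSum _ fun i _ => hint _) fun x => ?_
  simp only [map_mul, ContinuousMap.mul_apply, norm_mul, mul_pow, ← Finset.sum_mul]
  exact mul_le_mul_of_nonneg_right (hx₀ (Set.mem_univ x)) (by positivity)

theorem contDiff_mFourier (z : Fin n → ℤ) :
    ContDiff ℝ 1 fun t : Fin n → ℝ => mFourier z (fun i => (t i : UnitAddCircle)) := by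
  have : (fun t : Fin n → ℝ => mFourier z (fun i => (t i : UnitAddCircle))) =
      fun t => ∏ i, Complex.exp (2 * Real.pi * Complex.I * z i * t i) := by
    ext t
    simp [mFourier]
  rw [this]
  refine contDiff_prod fun i _ => ?_
  have : ContDiff ℝ 1 fun t : Fin n → ℝ => (t i : ℂ) :=
    Complex.ofRealCLM.contDiff.comp (contDiff_apply ℝ ℝ i)
  exact (contDiff_const.mul this).cexp

theorem contDiff_torusSymbol (g : AddMonoidAlgebra ℂ (Fin n → ℕ)) :
    ContDiff ℝ 1 fun t : Fin n → ℝ => torusSymbol n g (fun i => (t i : UnitAddCircle)) := by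
  induction g using AddMonoidAlgebra.induction_on with
  | of z => simpa [AddMonoidAlgebra.of_apply] using contDiff_mFourier fun i => (z i : ℤ)
  | add f g hf hg => simpa using hf.add hg
  | smul r f hf => simpa using contDiff_const.mul hf

/-- A tuple of more than `n / 2` symbols on the `n`-torus can be made nowhere vanishing by adding
small multiples of a given monomial. -/
theorem exists_small_torusSymbol_add_ne_zero {d : ℕ} (hd : n < 2 * d)
    (f : Fin d → AddMonoidAlgebra ℂ (Fin n → ℕ)) (z : Fin n → ℕ) {η : ℝ} (hη : 0 < η) :
    ∃ c : Fin d → ℂ, (∀ i, ‖c i‖ < η) ∧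
      ∀ x, ∃ i, torusSymbol n (f i + AddMonoidAlgebra.single z (c i)) x ≠ 0 := by
  let F : (Fin n → ℝ) → Fin d → ℂ := fun t i =>
    torusSymbol n (f i) (fun i => (t i : UnitAddCircle)) *
      mFourier (-fun i => (z i : ℤ)) (fun i => (t i : UnitAddCircle))
  have hF : ContDiff ℝ 1 F :=
    contDiff_pi.mpr fun i => (contDiff_torusSymbol (f i)).mul (contDiff_mFourier _)
  have hdense := hF.dense_compl_range_of_finrank_lt_finrank (by
    simp [Module.finrank_pi_fintype, Complex.finrank_real_complex]; omega)
  obtain ⟨c, hc, hcη⟩ := hdense.exists_dist_lt (0 : Fin d → ℂ) hη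
  rw [dist_zero_left, pi_norm_lt_iff hη] at hcη
  refine ⟨-c, fun i => by simpa using hcη i, fun x => ?_⟩
  by_contra! hx
  have hsurj (i : Fin n) : ∃ t : ℝ, (t : UnitAddCircle) = x i := QuotientAddGroup.mk_surjective _
  choose t ht using hsurj
  refine hc ⟨t, ?_⟩
  have ht' : (fun i => (t i : UnitAddCircle)) = x := funext ht
  ext i
  have := hx i
  simp only [map_add, torusSymbol_single, ContinuousMap.add_apply, ContinuousMap.smul_apply,
    smul_eq_mul, Pi.neg_apply, neg_mul] at this
  have h₁ : torusSymbol n (f i) x = c i * mFourier (fun i => (z i : ℤ)) x := by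
    linear_combination this
  simp only [F, ht', h₁, mul_assoc, ← mFourier_add, add_neg_cancel, mFourier_zero]
  simp

end Symbols

section Toeplitz

open Matrix Filter Topology

variable {n : ℕ}

instance isClosed_toeplitz : IsClosed (Toeplitz n : Set (Hn n →L[ℂ] Hn n)) :=
  StarSubalgebra.isClosed_topologicalClosure _

instance completeSpace_toeplitz : CompleteSpace (Toeplitz n) :=
  isClosed_toeplitz.completeSpace_coe

/-- The product of all coordinate shifts, as an element of the Toeplitz algebra. -/
def diagShift (n : ℕ) : Toeplitz n := ⟨shiftBy 1, shiftBy_mem_toeplitz 1⟩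

theorem star_diagShift_mul_self : star (diagShift n) * diagShift n = 1 :=
  Subtype.ext (star_shiftBy_mul_self 1)

theorem star_diagShift_pow_mul_pow (M : ℕ) : star (diagShift n) ^ M * diagShift n ^ M = 1 := by
  apply Subtype.ext
  have := star_shiftBy_mul_self (M • (1 : Fin n → ℕ))
  rw [shiftBy_nsmul, star_pow] at this
  exact this

theorem norm_diagShift_pow_le (M : ℕ) : ‖diagShift n ^ M‖ ≤ 1 := by
  refine ContinuousLinearMap.opNorm_le_bound _ zero_le_one fun v => ?_
  change ‖(shiftBy 1 ^ M : Hn n →L[ℂ] Hn n) v‖ ≤ _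
  rw [← shiftBy_nsmul, norm_shiftBy_apply, one_mul]

theorem exists_adjoin_norm_sub_lt (x : Toeplitz n) {ε : ℝ} (hε : 0 < ε) :
    ∃ x' : Toeplitz n,
      x'.val ∈ StarAlgebra.adjoin ℂ {T : Hn n →L[ℂ] Hn n | ∃ i : Fin n, IsShift i T} ∧
      ‖x - x'‖ < ε := by
  obtain ⟨x', hx', hd⟩ := Metric.mem_closure_iff.mp x.2 ε hε
  refine ⟨⟨x', StarSubalgebra.le_topologicalClosure _ hx'⟩, hx', ?_⟩
  rw [dist_eq_norm] at hd
  exact hd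

theorem tendsto_star_diagShift_pow_mul (N : ℕ) (x : Toeplitz n) :
    Tendsto (fun M : ℕ => star (diagShift n) ^ M * x *
      (1 - diagShift n ^ N * star (diagShift n) ^ N)) atTop (𝓝 0) := by
  set p := 1 - diagShift n ^ N * star (diagShift n) ^ N with hp
  have hps : p * diagShift n ^ N = 0 := by
    rw [hp, sub_mul, mul_assoc, star_diagShift_pow_mul_pow]; simp
  have hpstar : star p = p := by simp [hp]
  rw [Metric.tendsto_atTop]
  intro ε hε
  obtain ⟨x', hx', hd⟩ := exists_adjoin_norm_sub_lt x (ε := ε / (‖p‖ + 1)) (by positivity)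
  obtain ⟨K, hK⟩ := exists_mul_shift_pow_eq_analyticToeplitz (star_mem hx')
  refine ⟨K + N, fun M hM => ?_⟩
  have hzero : star (diagShift n) ^ M * x' * p = 0 := by
    rw [← star_eq_zero, star_mul, star_mul, star_pow, star_star, hpstar]
    obtain ⟨f, hf⟩ := hK (M - N) (by omega)
    have hcomm : star x' * diagShift n ^ M = diagShift n ^ N * (star x' * diagShift n ^ (M - N)) := by
      apply Subtype.ext
      have h₁ : shiftBy (1 : Fin n → ℕ) ^ N =
          analyticToeplitz n (AddMonoidAlgebra.single (N • 1) 1) := by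
        simp [← shiftBy_nsmul]
      have h₂ : star x'.val * shiftBy 1 ^ M = shiftBy 1 ^ N * (star x'.val * shiftBy 1 ^ (M - N)) := by
        rw [hf, h₁, ← map_mul, mul_comm, map_mul, ← h₁, ← hf, mul_assoc, ← pow_add,
          Nat.sub_add_cancel (by omega)]
      exact h₂
    rw [hcomm, ← mul_assoc, hps, zero_mul]
  have hle : ‖star (diagShift n) ^ M‖ ≤ 1 := by
    rw [← star_pow]
    exact (norm_star (diagShift n ^ M).val).trans_le (norm_diagShift_pow_le M)
  rw [dist_zero_right]
  calc ‖star (diagShift n) ^ M * x * p‖ = ‖star (diagShift n) ^ M * (x - x') * p‖ := by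
        rw [mul_sub _ x x', sub_mul _ _ p, hzero, sub_zero]
    _ ≤ ‖star (diagShift n) ^ M‖ * ‖x - x'‖ * ‖p‖ := norm_mul₃_le
    _ ≤ 1 * (ε / (‖p‖ + 1)) * ‖p‖ := by gcongr
    _ < ε := by
        rw [one_mul, div_mul_eq_mul_div, div_lt_iff₀ (by positivity)]
        nlinarith

/-- A tuple whose symbols have no common zero is bounded below modulo the corner. -/
theorem exists_bound_add_corner {d N : ℕ} (a : Fin d → Hn n →L[ℂ] Hn n)
    (f : Fin d → AddMonoidAlgebra ℂ (Fin n → ℕ))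
    (haf : ∀ i, a i * shiftBy 1 ^ N = analyticToeplitz n (f i))
    (hf : ∀ x, ∃ i, torusSymbol n (f i) x ≠ 0) :
    ∃ ε > 0, ∀ v : Hn n, ε * ‖v‖ ^ 2 ≤ ∑ i, ‖a i v‖ ^ 2 +
      ‖(1 - shiftBy 1 ^ N * star (shiftBy 1) ^ N : Hn n →L[ℂ] Hn n) v‖ ^ 2 := by
  obtain ⟨ε, hε, hbound⟩ := exists_bound_of_torusSymbol_ne_zero f hf
  set C : ℝ := ∑ i, ‖a i‖ ^ 2 with hC
  have hC₀ : 0 ≤ C := Finset.sum_nonneg fun i _ => sq_nonneg _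
  have hsq (x y : ℝ) : (x + y) ^ 2 ≤ 2 * x ^ 2 + 2 * y ^ 2 := by nlinarith [sq_nonneg (x - y)]
  refine ⟨ε / (2 * ε + 4 + 4 * C), by positivity, fun v => ?_⟩
  set u : Hn n := (star (shiftBy 1) ^ N : Hn n →L[ℂ] Hn n) v with hu
  set w : Hn n := (1 - shiftBy 1 ^ N * star (shiftBy 1) ^ N : Hn n →L[ℂ] Hn n) v with hw
  have hwv : w = v - (shiftBy 1 ^ N : Hn n →L[ℂ] Hn n) u := rfl
  have hnu : ‖(shiftBy 1 ^ N : Hn n →L[ℂ] Hn n) u‖ = ‖u‖ := by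
    rw [← shiftBy_nsmul, norm_shiftBy_apply]
  have hterm (i : Fin d) : ‖analyticToeplitz n (f i) u‖ ^ 2 ≤
      2 * ‖a i v‖ ^ 2 + 2 * (‖a i‖ ^ 2 * ‖w‖ ^ 2) := by
    have h₁ : analyticToeplitz n (f i) u = a i v - a i w := by
      rw [← haf i, hwv, map_sub, sub_sub_cancel]
      rfl
    have h₂ : ‖analyticToeplitz n (f i) u‖ ≤ ‖a i v‖ + ‖a i‖ * ‖w‖ := by
      rw [h₁]
      exact (norm_sub_le _ _).trans (add_le_add_right ((a i).le_opNorm w) _)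
    exact ((pow_le_pow_left₀ (norm_nonneg _) h₂ 2).trans (hsq _ _)).trans_eq (by ring)
  have hsum : ε * ‖u‖ ^ 2 ≤ 2 * ∑ i, ‖a i v‖ ^ 2 + 2 * (C * ‖w‖ ^ 2) := by
    refine (hbound u).trans ((Finset.sum_le_sum fun i _ => hterm i).trans_eq ?_)
    rw [Finset.sum_add_distrib, ← Finset.mul_sum, ← Finset.mul_sum, ← Finset.sum_mul]
  have hnorm : ‖v‖ ^ 2 ≤ 2 * ‖w‖ ^ 2 + 2 * ‖u‖ ^ 2 := by
    have : ‖v‖ ≤ ‖w‖ + ‖u‖ := by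
      rw [← hnu]
      calc ‖v‖ = ‖w + (shiftBy 1 ^ N : Hn n →L[ℂ] Hn n) u‖ := by rw [hwv, sub_add_cancel]
        _ ≤ _ := norm_add_le _ _
    exact (pow_le_pow_left₀ (norm_nonneg _) this 2).trans (hsq _ _)
  have hS : 0 ≤ ∑ i, ‖a i v‖ ^ 2 := Finset.sum_nonneg fun i _ => sq_nonneg _
  rw [div_mul_eq_mul_div, div_le_iff₀ (by positivity)]
  have hW : 0 ≤ ‖w‖ ^ 2 := sq_nonneg _
  nlinarith [mul_le_mul_of_nonneg_left hnorm hε.le, mul_nonneg hC₀ hS, mul_nonneg hε.le hS]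

/-- A tuple whose symbols have no common zero is unimodular modulo the corner `1 - sᴺ s*ᴺ`. -/
theorem exists_sum_mul_add_corner_eq_one {d N : ℕ} (a : Fin d → Toeplitz n)
    (f : Fin d → AddMonoidAlgebra ℂ (Fin n → ℕ))
    (haf : ∀ i, (a i).val * shiftBy 1 ^ N = analyticToeplitz n (f i))
    (hf : ∀ x, ∃ i, torusSymbol n (f i) x ≠ 0) :
    ∃ (x : Fin d → Toeplitz n) (g : Toeplitz n),
      ∑ i, x i * a i + g * (1 - diagShift n ^ N * star (diagShift n) ^ N) = 1 := by
  obtain ⟨ε, hε, hbound⟩ := exists_bound_add_corner (fun i => (a i).val) f haf hf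
  set p := 1 - diagShift n ^ N * star (diagShift n) ^ N with hp
  have hpp : star p * p = p := by
    have : diagShift n ^ N * star (diagShift n) ^ N *
        (diagShift n ^ N * star (diagShift n) ^ N) =
        diagShift n ^ N * star (diagShift n) ^ N := by
      rw [mul_assoc, ← mul_assoc (star _ ^ N), star_diagShift_pow_mul_pow, one_mul]
    simp [hp, mul_sub, sub_mul, this]
  set e : Toeplitz n := ∑ i, star (a i) * a i + p with he
  have hinner (v : Hn n) : inner ℂ (e.val v) v =
      ((∑ i, ‖(a i).val v‖ ^ 2 + ‖p.val v‖ ^ 2 : ℝ) : ℂ) := by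
    have hstar (c : Toeplitz n) : inner ℂ ((star c * c).val v) v = ((‖c.val v‖ ^ 2 : ℝ) : ℂ) := by
      have : (star c * c).val v = ContinuousLinearMap.adjoint c.val (c.val v) := rfl
      rw [this, ContinuousLinearMap.adjoint_inner_left, inner_self_eq_norm_sq_to_K]
      simp
    have hev : e.val v = ∑ i, (star (a i) * a i).val v + (star p * p).val v := by
      rw [hpp, he]
      simp
    rw [hev, inner_add_left, sum_inner, hstar p]
    simp only [hstar]
    push_cast
    rfl
  have hunit : IsUnit e := by
    rw [← StarSubalgebra.coe_isUnit]
    refine ContinuousLinearMap.isUnit_of_forall_le_norm_inner_map _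
      (c := ⟨ε, hε.le⟩) hε fun v => ?_
    rw [hinner, Complex.norm_real, Real.norm_of_nonneg (by positivity)]
    exact (mul_comm _ _).trans_le (hbound v)
  obtain ⟨t, ht⟩ := hunit
  refine ⟨fun i => (t⁻¹).val * star (a i), (t⁻¹).val, ?_⟩
  calc _ = (t⁻¹).val * e := by simp only [he, mul_add, Finset.mul_sum, mul_assoc]
    _ = 1 := by rw [← ht, Units.inv_mul]

/-- Over `T_n`, unimodular columns of length `d + 1` with `n < 2 d` are completable. -/
theorem toeplitz_colEquiv_single {d : ℕ} (hd : n < 2 * d) (b : Fin d ⊕ Unit → Toeplitz n)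
    (hb : ∃ y, y ⬝ᵥ b = 1) : ColEquiv b (Pi.single (Sum.inr ()) 1) := by
  obtain ⟨y, hy⟩ := hb
  have hopen : IsOpen {c : Fin d ⊕ Unit → Toeplitz n | IsUnit (y ⬝ᵥ c)} :=
    Units.isOpen.preimage (by unfold dotProduct; fun_prop)
  obtain ⟨η, hη, hball⟩ := Metric.isOpen_iff.mp hopen b (by simp [hy])
  have happrox (i : Fin d) := exists_adjoin_norm_sub_lt (b (Sum.inl i)) (half_pos hη)
  choose a ha hda using happrox
  have hshift (i : Fin d) := exists_mul_shift_pow_eq_analyticToeplitz (ha i)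
  choose K hK using hshift
  let N := ∑ i, K i
  have hfex (i : Fin d) := hK i N (Finset.single_le_sum (fun _ _ => Nat.zero_le _) (Finset.mem_univ i))
  choose f hf using hfex
  obtain ⟨c, hc, hcne⟩ := exists_small_torusSymbol_add_ne_zero hd f (N • 1) (half_pos hη)
  let a' : Fin d → Toeplitz n := fun i => a i + algebraMap ℂ _ (c i)
  let b₁ : Fin d ⊕ Unit → Toeplitz n := Sum.elim a' fun _ => b (Sum.inr ())
  have hb₁ : IsUnit (y ⬝ᵥ b₁) := by
    refine hball (Metric.mem_ball.mpr ((dist_pi_lt_iff hη).mpr ?_))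
    rintro (i | i)
    · have : b₁ (Sum.inl i) - b (Sum.inl i) =
          -(b (Sum.inl i) - a i) + algebraMap ℂ (Toeplitz n) (c i) := by
        simp only [b₁, a', Sum.elim_inl]; abel
      rw [dist_eq_norm, this]
      refine (norm_add_le _ _).trans_lt ?_
      have hone : ‖algebraMap ℂ (Toeplitz n) (c i)‖ ≤ ‖c i‖ := by
        rw [Algebra.algebraMap_eq_smul_one]
        refine (norm_smul_le _ _).trans (mul_le_of_le_one_right (norm_nonneg _) ?_)
        simpa using norm_diagShift_pow_le (n := n) 0
      rw [norm_neg]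
      linarith [hda i, hc i]
    · simpa [b₁] using hη
  have h₁ : ColEquiv b b₁ := colEquiv_of_isUnit_dotProduct (by simp [hy]) hb₁
  obtain ⟨x, g, hxg⟩ := exists_sum_mul_add_corner_eq_one (N := N) a'
    (fun i => f i + AddMonoidAlgebra.single (N • 1) (c i)) (fun i => by
      rw [map_add, ← hf i, analyticToeplitz_single, shiftBy_nsmul]
      simp [a', add_mul, Algebra.algebraMap_eq_smul_one]) hcne
  set p := 1 - diagShift n ^ N * star (diagShift n) ^ N with hp
  let X : Toeplitz n := (1 - b (Sum.inr ())) * g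
  let b₂ : Fin d ⊕ Unit → Toeplitz n := Sum.elim a' fun _ => 1 - X * p
  have h₂ : ColEquiv b₁ b₂ := by
    have := colEquiv_add_mul_dotProduct b₁ (Pi.single (Sum.inr ()) (1 - b (Sum.inr ())))
      (Sum.elim x 0) (by simp)
    convert this using 1
    ext1 i
    have hdot : Sum.elim x 0 ⬝ᵥ b₁ = 1 - g * p := by
      rw [← hxg]
      simp [b₁, dotProduct]
    rw [hdot]
    rcases i with i | i
    · simp [b₁, b₂]
    · simp only [b₁, b₂, X, Sum.elim_inr, Pi.single_eq_same]
      noncomm_ring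
  let Y : Fin d ⊕ Unit → Toeplitz n := Sum.elim (fun i => a' i * X) fun _ => -X
  have h₃ : ColEquiv b₂ (Pi.single (Sum.inr ()) 1 + fun i => Y i * p) := by
    have := colEquiv_add_mul_dotProduct b₂ (Sum.elim (fun i => -a' i) 0)
      (Pi.single (Sum.inr ()) 1) (by simp)
    convert this using 1
    ext1 i
    rcases i with i | i
    · simp [b₂, Y]
      noncomm_ring
    · simp [b₂, Y]
      noncomm_ring
  have h := (h₁.trans h₂).trans h₃
  refine h.trans (colEquiv_single_of_corner star_diagShift_mul_self norm_diagShift_pow_le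
    (tendsto_star_diagShift_pow_mul N) (i₁ := Sum.inl ⟨0, by omega⟩) (by simp) Y
    (h.exists_dotProduct_eq_one ⟨y, hy⟩))

end Toeplitz

theorem stmt6 (n : ℕ) (hn : 1 ≤ n) (m : ℕ) (hm : (n - 1) / 2 + 3 ≤ m)
    (k : ℕ) (P : Matrix (Fin k) (Fin k) ↥(Toeplitz n)) (hP : P * P = P)
    (r : ℕ)
    (hstab : IdemEquiv (Matrix.fromBlocks P 0 0 (1 : Matrix (Fin r) (Fin r) ↥(Toeplitz n)))
      (1 : Matrix (Fin (m + r)) (Fin (m + r)) ↥(Toeplitz n))) :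
    IdemEquiv P (1 : Matrix (Fin m) (Fin m) ↥(Toeplitz n)) := by
  have h := hstab.mvNEquiv (by simp [Matrix.fromBlocks_multiply, hP]) (by simp)
  exact (MvNEquiv.cancel_free
    (fun s hs b hb => toeplitz_colEquiv_single (by omega) b hb) r h).idemEquiv_one
end
end

section
/- Let n ≥ 1 and let m ≥ ⌊(n−1)/2⌋ + 3 be an integer. If P is an idempotent matrix over the quotient ring A_n = T_n/J_n (isomorphic to C(S_H^{2n−1})) such that P ⊞ (⊞^r 1) is equivalent to ⊞^{m+r} 1 for some integer r ≥ 0, then P is equivalent to ⊞^m 1. -/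
noncomputable section

/-- The two-sided ideal `J_n` of compact operators in the Toeplitz algebra `T_n`. -/
def compactIdeal (n : ℕ) : TwoSidedIdeal ↥(Toeplitz n) :=
  TwoSidedIdeal.mk'
    {a : ↥(Toeplitz n) | IsCompactOperator ⇑(a : Hn n →L[ℂ] Hn n)}
    (by
      show IsCompactOperator ⇑(((0 : ↥(Toeplitz n)) : Hn n →L[ℂ] Hn n))
      simp only [ZeroMemClass.coe_zero, ContinuousLinearMap.coe_zero]
      exact isCompactOperator_zero)
    (fun {x y} hx hy => by
      show IsCompactOperator ⇑(((x + y : ↥(Toeplitz n)) : Hn n →L[ℂ] Hn n))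
      simp only [AddMemClass.coe_add, ContinuousLinearMap.coe_add']
      exact hx.add hy)
    (fun {x} hx => by
      show IsCompactOperator ⇑(((-x : ↥(Toeplitz n)) : Hn n →L[ℂ] Hn n))
      simp only [NegMemClass.coe_neg, ContinuousLinearMap.coe_neg']
      exact hx.neg)
    (fun {x y} hy => by
      show IsCompactOperator ⇑(((x * y : ↥(Toeplitz n)) : Hn n →L[ℂ] Hn n))
      have := hy.clm_comp (x : Hn n →L[ℂ] Hn n)
      simpa [Function.comp] using this)
    (fun {x y} hx => by
      show IsCompactOperator ⇑(((x * y : ↥(Toeplitz n)) : Hn n →L[ℂ] Hn n))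
      have := hx.comp_clm (y : Hn n →L[ℂ] Hn n)
      simpa [Function.comp] using this)

/-- The quotient ring `A_n = T_n / J_n`, isomorphic to `C(S_H^{2n-1})`. -/
def QuantumSphere (n : ℕ) : Type := (compactIdeal n).ringCon.Quotient

instance (n : ℕ) : Ring (QuantumSphere n) :=
  inferInstanceAs (Ring (compactIdeal n).ringCon.Quotient)

namespace QuantumSphereCancellation

open scoped ComplexConjugate
open Filter Topology MeasureTheory

variable {n : ℕ}

lemma orthonormal_delta : Orthonormal ℂ (delta : (Fin n → ℕ) → Hn n) := by
  have := (HilbertBasis.ofRepr (LinearIsometryEquiv.refl ℂ (Hn n))).orthonormal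
  convert! this
  exact funext (HilbertBasis.ofRepr (LinearIsometryEquiv.refl ℂ (Hn n))).repr_symm_single

lemma hasSum_smul_delta (x : Hn n) : HasSum (fun z => x z • delta z) x := by
  have := lp.hasSum_single (p := 2) (by simp) x
  convert! this using 2 with z
  rw [delta, ← lp.single_smul]
  simp

lemma clm_ext_delta {E : Type*} [AddCommGroup E] [Module ℂ E] [TopologicalSpace E] [T2Space E]
    {A B : Hn n →L[ℂ] E} (h : ∀ z, A (delta z) = B (delta z)) : A = B := by
  ext x
  have hA := (hasSum_smul_delta x).mapL A
  have hB := (hasSum_smul_delta x).mapL B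
  simp only [map_smul, h] at hA hB
  exact hA.unique hB

/-- The isometry with `δ_z ↦ v z` attached to an orthonormal family `v`. -/
def isometryOfOrthonormal {E : Type*} [NormedAddCommGroup E] [InnerProductSpace ℂ E]
    [CompleteSpace E] {v : (Fin n → ℕ) → E} (hv : Orthonormal ℂ v) : Hn n →ₗᵢ[ℂ] E :=
  hv.orthogonalFamily.linearIsometry

lemma isometryOfOrthonormal_delta {E : Type*} [NormedAddCommGroup E] [InnerProductSpace ℂ E]
    [CompleteSpace E] {v : (Fin n → ℕ) → E} (hv : Orthonormal ℂ v) (z : Fin n → ℕ) :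
    isometryOfOrthonormal hv (delta z) = v z := by
  have := hv.orthogonalFamily.linearIsometry_apply_single (i := z) (1 : ℂ)
  rw [isometryOfOrthonormal, delta, this]
  simp

/-- The isometry `S^y : δ_z ↦ δ_{z + y}`. -/
def translation (y : Fin n → ℕ) : Hn n →L[ℂ] Hn n :=
  (isometryOfOrthonormal
    (orthonormal_delta.comp (· + y) (add_left_injective y))).toContinuousLinearMap

@[simp]
lemma translation_delta (y z : Fin n → ℕ) : translation y (delta z) = delta (z + y) :=
  isometryOfOrthonormal_delta (orthonormal_delta.comp (· + y) (add_left_injective y)) z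

lemma norm_translation (y : Fin n → ℕ) (x : Hn n) : ‖translation y x‖ = ‖x‖ :=
  LinearIsometry.norm_map _ x

lemma translation_mul (y y' : Fin n → ℕ) :
    translation y * translation y' = translation (y + y') :=
  clm_ext_delta fun z => by
    rw [mul_apply_eq_comp]
    simp [add_assoc, add_comm y]

lemma translation_zero : translation (0 : Fin n → ℕ) = 1 :=
  clm_ext_delta fun z => by simp

lemma star_translation_mul_self (y : Fin n → ℕ) : star (translation y) * translation y = 1 :=
  (ContinuousLinearMap.norm_map_iff_adjoint_comp_self _).1 (norm_translation y)

lemma isShift_iff (i : Fin n) (T : Hn n →L[ℂ] Hn n) :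
    IsShift i T ↔ T = translation (Pi.single i 1) := by
  have key : ∀ z : Fin n → ℕ, Function.update z i (z i + 1) = z + Pi.single i 1 := by
    intro z
    ext j
    by_cases h : j = i
    · subst h; simp
    · simp [h]
  constructor
  · intro h
    exact clm_ext_delta fun z => by rw [h z, translation_delta, key]
  · rintro rfl z
    rw [translation_delta, key]

/-- The dense star-subalgebra of polynomials in the shifts and their adjoints. -/
def shiftPolynomials (n : ℕ) : StarSubalgebra ℂ (Hn n →L[ℂ] Hn n) :=
  StarAlgebra.adjoin ℂ {T : Hn n →L[ℂ] Hn n | ∃ i : Fin n, IsShift i T}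

lemma translation_mem (y : Fin n → ℕ) : translation y ∈ shiftPolynomials n := by
  have single_mem (i : Fin n) (k : ℕ) : translation (Pi.single i k) ∈ shiftPolynomials n := by
    induction k with
    | zero => simp [translation_zero]
    | succ k ih =>
      rw [Pi.single_add, ← translation_mul]
      exact mul_mem ih (StarAlgebra.subset_adjoin ℂ _ ⟨i, (isShift_iff i _).2 rfl⟩)
  have sum_mem (s : Finset (Fin n)) :
      translation (∑ i ∈ s, Pi.single i (y i)) ∈ shiftPolynomials n := by
    induction s using Finset.induction_on with
    | empty => simp [translation_zero]
    | insert i s hi ih =>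
      rw [Finset.sum_insert hi, ← translation_mul]
      exact mul_mem (single_mem i _) ih
  simpa [Finset.univ_sum_single] using sum_mem Finset.univ

lemma shiftPolynomials_le : shiftPolynomials n ≤ Toeplitz n :=
  StarSubalgebra.le_topologicalClosure _

/-- `W^k`, where `W` is the product of all the coordinate shifts. -/
def diagShift (n k : ℕ) : Hn n →L[ℂ] Hn n := translation fun _ => k

lemma diagShift_mul (k l : ℕ) : diagShift n k * diagShift n l = diagShift n (k + l) :=
  translation_mul _ _

/-- The normalized Haar measure of the torus. -/
abbrev torusMeasure (n : ℕ) : Measure (UnitAddTorus (Fin n)) :=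
  Measure.pi fun _ => AddCircle.haarAddCircle

/-- Multiplication by a continuous function on `L²` of the torus. -/
def mulOp (f : C(UnitAddTorus (Fin n), ℂ)) :
    Lp ℂ 2 (torusMeasure n) →L[ℂ]
      Lp ℂ 2 (torusMeasure n) :=
  (ContinuousLinearMap.mul ℂ ℂ).holderL (torusMeasure n) ⊤ 2 2
    (ContinuousMap.toLp ⊤ (torusMeasure n) ℂ f)

lemma coeFn_mulOp (f : C(UnitAddTorus (Fin n), ℂ))
    (g : Lp ℂ 2 (torusMeasure n)) :
    mulOp f g =ᵐ[torusMeasure n] fun t => f t * g t := by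
  have h1 := (ContinuousLinearMap.mul ℂ ℂ).coeFn_holder (r := 2)
    (ContinuousMap.toLp ⊤ (torusMeasure n) ℂ f) g
  have h2 := ContinuousMap.coeFn_toLp (p := ⊤) (𝕜 := ℂ) (torusMeasure n) f
  rw [mulOp, ContinuousLinearMap.holderL_apply_apply]
  filter_upwards [h1, h2] with t ht1 ht2
  rw [ht1, ht2]
  rfl

lemma mulOp_add (f g : C(UnitAddTorus (Fin n), ℂ)) : mulOp (f + g) = mulOp f + mulOp g := by
  simp [mulOp]

lemma mulOp_mul (f g : C(UnitAddTorus (Fin n), ℂ)) : mulOp (f * g) = mulOp f * mulOp g := by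
  ext1 x
  apply Lp.ext
  rw [mul_apply_eq_comp]
  filter_upwards [coeFn_mulOp (f * g) x, coeFn_mulOp f (mulOp g x), coeFn_mulOp g x]
    with t h1 h2 h3
  rw [h1, h2, h3, ContinuousMap.mul_apply, mul_assoc]

lemma mulOp_algebraMap (c : ℂ) :
    mulOp (algebraMap ℂ C(UnitAddTorus (Fin n), ℂ) c) = c • 1 := by
  ext1 x
  apply Lp.ext
  filter_upwards [coeFn_mulOp (algebraMap ℂ C(UnitAddTorus (Fin n), ℂ) c) x,
    Lp.coeFn_smul c x] with t h1 h2
  rw [h1]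
  simpa using h2.symm

/-- The monomials as elements of `L²` of the torus. -/
def monomialL2 (a : Fin n → ℤ) : Lp ℂ 2 (torusMeasure n) :=
  ContinuousMap.toLp 2 (torusMeasure n) ℂ (UnitAddTorus.mFourier a)

lemma orthonormal_monomialL2 : Orthonormal ℂ (monomialL2 : (Fin n → ℤ) → _) :=
  UnitAddTorus.orthonormal_mFourier

lemma mulOp_monomialL2 (a b : Fin n → ℤ) :
    mulOp (UnitAddTorus.mFourier a) (monomialL2 b) = monomialL2 (b + a) := by
  apply Lp.ext
  have coe (a : Fin n → ℤ) : monomialL2 a =ᵐ[torusMeasure n] UnitAddTorus.mFourier a :=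
    ContinuousMap.coeFn_toLp (torusMeasure n) _
  filter_upwards [coeFn_mulOp (UnitAddTorus.mFourier a) (monomialL2 b), coe b, coe (b + a)]
    with t h1 h2 h3
  rw [h1, h2, h3, UnitAddTorus.mFourier_add, mul_comm]

/-- The exponent of a monomial, viewed in `ℤ^n`. -/
def intExp (z : Fin n → ℕ) : Fin n → ℤ := fun i => z i

lemma intExp_add (y z : Fin n → ℕ) : intExp (y + z) = intExp y + intExp z := by
  ext i; simp [intExp]

lemma intExp_injective : Function.Injective (intExp : (Fin n → ℕ) → Fin n → ℤ) := by
  intro y z h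
  ext i
  simpa [intExp] using congrFun h i

/-- The isometry of `ℓ²(ℕ^n)` onto the Hardy space of the torus. -/
def hardy (n : ℕ) : Hn n →ₗᵢ[ℂ] Lp ℂ 2 (torusMeasure n) :=
  isometryOfOrthonormal
    (orthonormal_monomialL2.comp intExp intExp_injective)

lemma hardy_translation (y : Fin n → ℕ) (x : Hn n) :
    hardy n (translation y x) = mulOp (UnitAddTorus.mFourier (intExp y)) (hardy n x) := by
  have : (hardy n).toContinuousLinearMap ∘L translation y =
      mulOp (UnitAddTorus.mFourier (intExp y)) ∘L (hardy n).toContinuousLinearMap := by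
    refine clm_ext_delta fun z => ?_
    have h (z : Fin n → ℕ) : hardy n (delta z) = monomialL2 (intExp z) :=
      isometryOfOrthonormal_delta (orthonormal_monomialL2.comp intExp intExp_injective) z
    simp [h, mulOp_monomialL2, intExp_add]
  exact congrArg (fun A => A x) this

/-- The value at `t` of the symbol of the `i`-th shift. -/
def phase (i : Fin n) (t : UnitAddTorus (Fin n)) : ℂ :=
  UnitAddTorus.mFourier (intExp (Pi.single i 1)) t

lemma conj_phase (i : Fin n) (t : UnitAddTorus (Fin n)) :
    conj (phase i t) = UnitAddTorus.mFourier (-intExp (Pi.single i 1)) t :=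
  UnitAddTorus.mFourier_neg.symm

lemma conj_phase_mul_phase (i : Fin n) (t : UnitAddTorus (Fin n)) :
    conj (phase i t) * phase i t = 1 := by
  rw [conj_phase, phase, ← UnitAddTorus.mFourier_add]
  simp [UnitAddTorus.mFourier_zero]

lemma norm_phase (i : Fin n) (t : UnitAddTorus (Fin n)) : ‖phase i t‖ = 1 := by
  have := congrArg norm (conj_phase_mul_phase i t)
  rw [norm_mul, RCLike.norm_conj, norm_one] at this
  nlinarith [norm_nonneg (phase i t)]

/-- `ξ` is a sequence of approximate joint eigenvectors of the shifts over the point `t`. -/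
def IsApproxEigenvector (t : UnitAddTorus (Fin n)) (ξ : ℕ → Hn n) : Prop :=
  ∀ i, Tendsto (fun m => translation (Pi.single i 1) (ξ m) - phase i t • ξ m) atTop (𝓝 0)

/-- The function `f` on the torus is the symbol of the operator `a`, which is a polynomial in
the shifts and their adjoints. -/
structure HasSymbol (a : Hn n →L[ℂ] Hn n) (f : C(UnitAddTorus (Fin n), ℂ)) : Prop where
  contDiff : ContDiff ℝ 1 fun x : Fin n → ℝ => f fun i => (x i : UnitAddCircle)
  tendsto : ∀ t ξ, IsApproxEigenvector t ξ → Tendsto (fun m => a (ξ m) - f t • ξ m) atTop (𝓝 0)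
  absorbs : ∃ d, ∀ k, (∃ a', a * diagShift n (k + d) = diagShift n k * a') ∧
    ∀ x, hardy n (a (diagShift n (k + d) x)) = mulOp f (hardy n (diagShift n (k + d) x))

lemma contDiff_mFourier (a : Fin n → ℤ) :
    ContDiff ℝ 1 fun x : Fin n → ℝ =>
      UnitAddTorus.mFourier a fun i => (x i : UnitAddCircle) := by
  simp only [UnitAddTorus.mFourier, ContinuousMap.coe_mk, fourier_coe_apply]
  refine contDiff_prod fun i _ => ContDiff.cexp ?_
  have : ContDiff ℝ 1 fun x : Fin n → ℝ => ((x i : ℝ) : ℂ) :=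
    Complex.ofRealCLM.contDiff.comp (contDiff_apply ℝ ℝ i)
  fun_prop

lemma hasSymbol_shift (i : Fin n) :
    HasSymbol (translation (Pi.single i 1)) (UnitAddTorus.mFourier (intExp (Pi.single i 1))) where
  contDiff := contDiff_mFourier _
  tendsto _ _ h := h i
  absorbs := ⟨0, fun k => ⟨⟨translation (Pi.single i 1), by
    rw [diagShift, diagShift, translation_mul, translation_mul, add_comm]; rfl⟩,
    fun _ => hardy_translation _ _⟩⟩

lemma star_translation_comp (y : Fin n → ℕ) (x : Hn n) :
    star (translation y) (translation y x) = x :=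
  congrArg (fun A : Hn n →L[ℂ] Hn n => A x) (star_translation_mul_self y)

lemma diagShift_succ (i : Fin n) (k : ℕ) :
    diagShift n (k + 1) =
      translation (Pi.single i 1) * (diagShift n k * translation (1 - Pi.single i 1)) := by
  rw [diagShift, diagShift, translation_mul, translation_mul]
  congr 1
  ext j
  by_cases h : j = i
  · subst h; simp [add_comm]
  · simp [h]

lemma hasSymbol_star_shift (i : Fin n) :
    HasSymbol (star (translation (Pi.single i 1)))
      (UnitAddTorus.mFourier (-intExp (Pi.single i 1))) where
  contDiff := contDiff_mFourier _
  tendsto t ξ h := by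
    have := (((star (translation (Pi.single i 1)) : Hn n →L[ℂ] Hn n).continuous.tendsto 0).comp
      (h i)).const_smul (-conj (phase i t))
    rw [map_zero, smul_zero] at this
    refine this.congr fun m => ?_
    rw [Function.comp, map_sub, map_smul, star_translation_comp, smul_sub, smul_smul, neg_mul,
      conj_phase_mul_phase, ← conj_phase, neg_smul, neg_smul, one_smul]
    abel
  absorbs := by
    refine ⟨1, fun k => ⟨⟨translation (1 - Pi.single i 1), ?_⟩, fun x => ?_⟩⟩
    · rw [diagShift_succ i, ← mul_assoc, star_translation_mul_self, one_mul]
    · rw [diagShift_succ i, mul_apply_eq_comp, star_translation_comp, hardy_translation,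
        ← mul_apply_eq_comp, ← mulOp_mul]
      have : UnitAddTorus.mFourier (-intExp (Pi.single i 1)) *
          UnitAddTorus.mFourier (intExp (Pi.single i 1)) = algebraMap ℂ _ 1 := by
        ext t
        rw [ContinuousMap.mul_apply, ← UnitAddTorus.mFourier_add]
        simp [UnitAddTorus.mFourier_zero]
      rw [this, mulOp_algebraMap]
      simp

lemma HasSymbol.add {a b : Hn n →L[ℂ] Hn n} {f g : C(UnitAddTorus (Fin n), ℂ)}
    (ha : HasSymbol a f) (hb : HasSymbol b g) : HasSymbol (a + b) (f + g) where
  contDiff := ha.contDiff.add hb.contDiff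
  tendsto t ξ h := by
    have := (ha.tendsto t ξ h).add (hb.tendsto t ξ h)
    rw [add_zero] at this
    refine this.congr fun m => ?_
    simp only [add_apply, ContinuousMap.add_apply, add_smul]
    abel
  absorbs := by
    obtain ⟨d, hd⟩ := ha.absorbs
    obtain ⟨e, he⟩ := hb.absorbs
    refine ⟨d + e, fun k => ?_⟩
    obtain ⟨⟨a', ha'⟩, hfa⟩ := hd (k + e)
    obtain ⟨⟨b', hb'⟩, hfb⟩ := he (k + d)
    have e1 : k + e + d = k + (d + e) := by ring
    have e2 : k + d + e = k + (d + e) := by ring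
    rw [e1] at ha' hfa
    rw [e2] at hb' hfb
    refine ⟨⟨diagShift n e * a' + diagShift n d * b', ?_⟩, fun x => ?_⟩
    · rw [add_mul, ha', hb', mul_add, ← mul_assoc, ← mul_assoc, diagShift_mul, diagShift_mul]
    · simp [hfa, hfb, mulOp_add]

lemma HasSymbol.mul {a b : Hn n →L[ℂ] Hn n} {f g : C(UnitAddTorus (Fin n), ℂ)}
    (ha : HasSymbol a f) (hb : HasSymbol b g) : HasSymbol (a * b) (f * g) where
  contDiff := ha.contDiff.mul hb.contDiff
  tendsto t ξ h := by
    have h1 := (a.continuous.tendsto 0).comp (hb.tendsto t ξ h)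
    have := h1.add ((ha.tendsto t ξ h).const_smul (g t))
    rw [smul_zero, add_zero, map_zero] at this
    refine this.congr fun m => ?_
    simp only [Function.comp, map_sub, map_smul, mul_apply_eq_comp, ContinuousMap.mul_apply,
      smul_sub, smul_smul, mul_comm (f t)]
    abel
  absorbs := by
    obtain ⟨d, hd⟩ := ha.absorbs
    obtain ⟨e, he⟩ := hb.absorbs
    refine ⟨d + e, fun k => ?_⟩
    obtain ⟨⟨a', ha'⟩, hfa⟩ := hd k
    obtain ⟨⟨b', hb'⟩, hfb⟩ := he (k + d)
    rw [add_assoc] at hb' hfb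
    refine ⟨⟨a' * b', ?_⟩, fun x => ?_⟩
    · rw [mul_assoc, hb', ← mul_assoc, ha', mul_assoc]
    · have hx : b (diagShift n (k + (d + e)) x) = diagShift n (k + d) (b' x) :=
        congrArg (fun A : Hn n →L[ℂ] Hn n => A x) hb'
      rw [mul_apply_eq_comp, hx, hfa, ← hx, hfb, mulOp_mul, mul_apply_eq_comp]

lemma hasSymbol_algebraMap (c : ℂ) : HasSymbol (n := n) (algebraMap ℂ _ c) (algebraMap ℂ _ c) where
  contDiff := contDiff_const
  tendsto t ξ _ := by
    simp [Algebra.algebraMap_eq_smul_one]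
  absorbs := by
    refine ⟨0, fun k => ⟨⟨algebraMap ℂ _ c, ?_⟩, fun x => ?_⟩⟩
    · exact Algebra.commutes _ _
    · rw [mulOp_algebraMap]
      simp [Algebra.algebraMap_eq_smul_one]

lemma exists_hasSymbol {a : Hn n →L[ℂ] Hn n} (ha : a ∈ shiftPolynomials n) :
    ∃ f, HasSymbol a f := by
  replace ha : a ∈ (shiftPolynomials n).toSubalgebra := ha
  rw [shiftPolynomials, StarAlgebra.adjoin_toSubalgebra] at ha
  induction ha using Algebra.adjoin_induction with
  | mem x hx =>
    rcases hx with ⟨i, hi⟩ | ⟨i, hi⟩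
    · rw [(isShift_iff i x).1 hi]
      exact ⟨_, hasSymbol_shift i⟩
    · rw [← star_star x, (isShift_iff i _).1 hi]
      exact ⟨_, hasSymbol_star_shift i⟩
  | algebraMap c => exact ⟨_, hasSymbol_algebraMap c⟩
  | add x y _ _ hx hy =>
    obtain ⟨f, hf⟩ := hx
    obtain ⟨g, hg⟩ := hy
    exact ⟨_, hf.add hg⟩
  | mul x y _ _ hx hy =>
    obtain ⟨f, hf⟩ := hx
    obtain ⟨g, hg⟩ := hy
    exact ⟨_, hf.mul hg⟩

lemma summable_prod_pow {s : ℝ} (h0 : 0 ≤ s) (h1 : s < 1) :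
    Summable fun z : Fin n → ℕ => ∏ i, s ^ z i := by
  refine summable_of_sum_le (c := ((1 - s)⁻¹) ^ n)
    (fun z => Finset.prod_nonneg fun i _ => pow_nonneg h0 _) fun u => ?_
  have hsub : u ⊆
      Fintype.piFinset fun _ : Fin n => Finset.range (u.sup (fun z => ∑ i, z i) + 1) := by
    intro z hz
    simp only [Fintype.mem_piFinset, Finset.mem_range]
    intro i
    have h2 : z i ≤ ∑ i, z i := Finset.single_le_sum (fun _ _ => Nat.zero_le _) (Finset.mem_univ i)
    have h3 : ∑ i, z i ≤ u.sup (fun z => ∑ i, z i) := Finset.le_sup (f := fun z => ∑ i, z i) hz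
    omega
  calc ∑ z ∈ u, ∏ i, s ^ z i
      ≤ ∑ z ∈ Fintype.piFinset fun _ : Fin n => Finset.range (u.sup (fun z => ∑ i, z i) + 1),
          ∏ i, s ^ z i :=
        Finset.sum_le_sum_of_subset_of_nonneg hsub
          fun z _ _ => Finset.prod_nonneg fun i _ => pow_nonneg h0 _
    _ = ∏ _i : Fin n, ∑ j ∈ Finset.range (u.sup (fun z => ∑ i, z i) + 1), s ^ j :=
        (Finset.prod_univ_sum _ _).symm
    _ ≤ ∏ _i : Fin n, (1 - s)⁻¹ := by
        refine Finset.prod_le_prod (fun i _ => Finset.sum_nonneg fun j _ => pow_nonneg h0 _)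
          fun i _ => ?_
        rw [← tsum_geometric_of_lt_one h0 h1]
        exact (summable_geometric_of_lt_one h0 h1).sum_le_tsum _ fun j _ => pow_nonneg h0 _
    _ = _ := by simp

lemma inner_delta (z : Fin n → ℕ) (x : Hn n) : inner ℂ (delta z) x = x z := by
  simp [delta, lp.inner_single_left]

lemma star_translation_apply (y z : Fin n → ℕ) (x : Hn n) :
    (star (translation y) x : Hn n) z = x (z + y) := by
  rw [← inner_delta, ContinuousLinearMap.star_eq_adjoint, ContinuousLinearMap.adjoint_inner_right,
    translation_delta, inner_delta]

/-- Normalized Szegő kernels: joint eigenvectors of the adjoint shifts. -/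
lemma exists_unit_eigenvector {r : ℝ} (h0 : 0 ≤ r) (h1 : r < 1) (t : UnitAddTorus (Fin n)) :
    ∃ x : Hn n, ‖x‖ = 1 ∧
      ∀ i, star (translation (Pi.single i 1)) x = ((r : ℂ) * conj (phase i t)) • x := by
  have hmem : Memℓp (fun z : Fin n → ℕ => ∏ i, ((r : ℂ) * conj (phase i t)) ^ z i) 2 := by
    apply memℓp_gen
    have := summable_prod_pow (n := n) (sq_nonneg r) (by nlinarith)
    refine this.congr fun z => ?_
    simp [norm_phase, abs_of_nonneg h0, ← Finset.prod_pow, ← pow_mul, mul_comm]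
  obtain ⟨k, hk⟩ : ∃ k : Hn n, ∀ z, k z = ∏ i, ((r : ℂ) * conj (phase i t)) ^ z i :=
    ⟨⟨_, hmem⟩, fun _ => rfl⟩
  have hk0 : k ≠ 0 := by
    intro h
    have := hk 0
    simp [h] at this
  refine ⟨((‖k‖ : ℂ)⁻¹) • k, ?_, fun i => ?_⟩
  · rw [norm_smul]
    simp [hk0]
  · rw [map_smul, smul_comm]
    congr 1
    apply lp.ext
    ext z
    rw [star_translation_apply, hk, lp.coeFn_smul, Pi.smul_apply, hk, smul_eq_mul]
    simp only [Pi.add_apply, pow_add, Finset.prod_mul_distrib]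
    rw [mul_comm, Finset.prod_eq_single i]
    · simp
    · intro j _ hj
      simp [hj]
    · simp

lemma exists_isApproxEigenvector (t : UnitAddTorus (Fin n)) :
    ∃ ξ : ℕ → Hn n, (∀ m, ‖ξ m‖ = 1) ∧ IsApproxEigenvector t ξ := by
  have hr (m : ℕ) : 0 ≤ 1 - 1 / ((m : ℝ) + 1) := by
    have : 1 / ((m : ℝ) + 1) ≤ 1 := by
      rw [div_le_one (by positivity)]
      simp
    linarith
  have hr' (m : ℕ) : 1 - 1 / ((m : ℝ) + 1) < 1 := by
    have : 0 < 1 / ((m : ℝ) + 1) := by positivity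
    linarith
  choose ξ hnorm heig using fun m => exists_unit_eigenvector (hr m) (hr' m) t
  refine ⟨ξ, hnorm, fun i => ?_⟩
  have sq (m : ℕ) : ‖translation (Pi.single i 1) (ξ m) - phase i t • ξ m‖ ^ 2 =
      2 * (1 / ((m : ℝ) + 1)) := by
    rw [norm_sub_sq (𝕜 := ℂ), norm_translation, norm_smul, hnorm, norm_phase, inner_smul_right,
      ← ContinuousLinearMap.adjoint_inner_right, ← ContinuousLinearMap.star_eq_adjoint, heig,
      inner_smul_right, inner_self_eq_norm_sq_to_K, hnorm, mul_left_comm, mul_assoc,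
      ← mul_assoc (conj (phase i t)), conj_phase_mul_phase]
    generalize 1 / ((m : ℝ) + 1) = s
    simp
    ring
  rw [tendsto_zero_iff_norm_tendsto_zero]
  have h := (tendsto_one_div_add_atTop_nhds_zero_nat (𝕜 := ℝ)).const_mul 2
  rw [mul_zero] at h
  have h' := (Real.continuous_sqrt.tendsto 0).comp h
  rw [Real.sqrt_zero] at h'
  refine h'.congr fun m => ?_
  rw [Function.comp, ← sq, Real.sqrt_sq (norm_nonneg _)]

lemma eq_zero_of_shift_eq {i : Fin n} {c : ℂ} (hc : c ≠ 0) {x : Hn n}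
    (h : translation (Pi.single i 1) x = c • x) : x = 0 := by
  have shift_apply_zero (z : Fin n → ℕ) (hz : z i = 0) :
      (translation (Pi.single i 1) x : Hn n) z = 0 := by
    have hs := (hasSum_smul_delta x).mapL (translation (Pi.single i 1))
    have := hs.mapL (innerSL ℂ (delta z))
    simp only [map_smul, translation_delta, innerSL_apply_apply] at this
    rw [inner_delta] at this
    refine this.unique ?_
    convert! hasSum_zero with y
    rw [orthonormal_iff_ite.1 orthonormal_delta, if_neg, smul_zero]
    rintro rfl
    simp at hz
  have shift_apply (z : Fin n → ℕ) :
      (translation (Pi.single i 1) x : Hn n) (z + Pi.single i 1) = x z := by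
    rw [← star_translation_apply, star_translation_comp]
  have key (k : ℕ) : ∀ z : Fin n → ℕ, z i = k → x z = 0 := by
    induction k with
    | zero =>
      intro z hz
      have := shift_apply_zero z hz
      rw [h, lp.coeFn_smul, Pi.smul_apply] at this
      exact (smul_eq_zero.1 this).resolve_left hc
    | succ k ih =>
      intro z hz
      have hz' : z - Pi.single i 1 + Pi.single i 1 = z := by
        ext j
        by_cases hj : j = i
        · subst hj; simp; omega
        · simp [hj]
      have := shift_apply (z - Pi.single i 1)
      rw [ih _ (by simp [hz]), hz', h, lp.coeFn_smul, Pi.smul_apply] at this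
      exact (smul_eq_zero.1 this).resolve_left hc
  apply lp.ext
  ext z
  exact key _ z rfl

lemma not_tendsto_add_compact [NeZero n] {K : Hn n →L[ℂ] Hn n} (hK : IsCompactOperator K)
    {t : UnitAddTorus (Fin n)} {ξ : ℕ → Hn n} (hnorm : ∀ m, ‖ξ m‖ = 1)
    (hξ : IsApproxEigenvector t ξ) :
    ¬ Tendsto (fun m => ξ m + K (ξ m)) atTop (𝓝 0) := by
  intro h
  obtain ⟨C, hC, hsub⟩ := hK.image_closedBall_subset_compact (f := (K : Hn n →ₗ[ℂ] Hn n)) 1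
  obtain ⟨y, -, φ, hφ, hy⟩ := hC.tendsto_subseq (x := fun m => K (ξ m)) fun m =>
    hsub ⟨ξ m, by simp [hnorm], rfl⟩
  have hlim : Tendsto (ξ ∘ φ) atTop (𝓝 (-y)) := by
    have := (h.comp hφ.tendsto_atTop).sub hy
    rw [zero_sub] at this
    refine this.congr fun m => ?_
    simp
  have hn1 : ‖-y‖ = 1 := by
    refine tendsto_nhds_unique hlim.norm ?_
    simp [hnorm]
  have heq : translation (Pi.single 0 1) (-y) - phase 0 t • (-y) = 0 := by
    refine tendsto_nhds_unique ?_ ((hξ 0).comp hφ.tendsto_atTop)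
    exact (((translation (Pi.single 0 1)).continuous.tendsto _).comp hlim).sub
      (hlim.const_smul (phase 0 t))
  have hne : phase 0 t ≠ 0 := by
    intro h0
    have := conj_phase_mul_phase 0 t
    simp [h0] at this
  rw [eq_zero_of_shift_eq hne (sub_eq_zero.1 heq)] at hn1
  simp at hn1

/-- The quotient map `∂ : T_n → A_n`. -/
def quot (n : ℕ) : ↥(Toeplitz n) →+* QuantumSphere n := (compactIdeal n).ringCon.mk'

lemma quot_surjective : Function.Surjective (quot n) := RingCon.mk'_surjective _

lemma quot_eq_iff (a b : ↥(Toeplitz n)) :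
    quot n a = quot n b ↔ IsCompactOperator ((a : Hn n →L[ℂ] Hn n) - b : Hn n →L[ℂ] Hn n) := by
  have h1 : quot n a = quot n b ↔ a - b ∈ compactIdeal n := by
    rw [← TwoSidedIdeal.rel_iff]
    exact RingCon.eq _
  rw [h1, compactIdeal, TwoSidedIdeal.mem_mk']
  rfl

lemma exists_symbol_ne_zero [NeZero n] {ι : Type*} [Fintype ι] {U V : ι → ↥(Toeplitz n)}
    {f : ι → C(UnitAddTorus (Fin n), ℂ)} (hf : ∀ j, HasSymbol (V j : Hn n →L[ℂ] Hn n) (f j))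
    (h : ∑ j, quot n (U j) * quot n (V j) = 1) (t : UnitAddTorus (Fin n)) :
    ∃ j, f j t ≠ 0 := by
  by_contra! h0
  obtain ⟨ξ, hnorm, hξ⟩ := exists_isApproxEigenvector t
  have hK : quot n (∑ j, U j * V j) = quot n 1 := by simpa using h
  rw [quot_eq_iff] at hK
  refine not_tendsto_add_compact hK hnorm hξ ?_
  have hlim (j : ι) : Tendsto (fun m => (U j : Hn n →L[ℂ] Hn n) ((V j : Hn n →L[ℂ] Hn n) (ξ m)))
      atTop (𝓝 0) := by
    have := (hf j).tendsto t ξ hξ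
    simp only [h0, zero_smul, sub_zero] at this
    have := ((U j : Hn n →L[ℂ] Hn n).continuous.tendsto 0).comp this
    rwa [map_zero] at this
  have := tendsto_finsetSum Finset.univ fun j _ => hlim j
  rw [Finset.sum_const_zero] at this
  refine this.congr fun m => ?_
  simp

/-- General position: a family of `p + 1` symbols without common zeros on a torus of dimension
less than `2p` remains without common zeros after adding generic multiples of the last symbol to
the others and dropping it. -/
lemma exists_add_smul_ne_zero {p : ℕ} (hp : n < 2 * p) {f : Fin p → C(UnitAddTorus (Fin n), ℂ)}
    {g : C(UnitAddTorus (Fin n), ℂ)}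
    (hf : ∀ j, ContDiff ℝ 1 fun x : Fin n → ℝ => f j fun i => (x i : UnitAddCircle))
    (hg : ContDiff ℝ 1 fun x : Fin n → ℝ => g fun i => (x i : UnitAddCircle))
    (h : ∀ t, g t = 0 → ∃ j, f j t ≠ 0) :
    ∃ c : Fin p → ℂ, ∀ t, ∃ j, f j t + c j * g t ≠ 0 := by
  let π : (Fin n → ℝ) → UnitAddTorus (Fin n) := fun x i => (x i : UnitAddCircle)
  have hπ : Function.Surjective π := fun t => by
    choose x hx using fun i => QuotientAddGroup.mk_surjective (t i)
    exact ⟨x, funext hx⟩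
  let F : (Fin n → ℝ) → Fin p → ℂ := fun x j => f j (π x) / g (π x)
  have hdim : dimH (F '' {x | g (π x) ≠ 0}) < Module.finrank ℝ (Fin p → ℂ) := by
    have hle : dimH (F '' {x | g (π x) ≠ 0}) ≤ n := by
      refine (dimH_image_le_of_locally_lipschitzOn fun x hx => ?_).trans
        ((dimH_mono (Set.subset_univ _)).trans ?_)
      · have hF : ContDiffAt ℝ 1 F x :=
          contDiffAt_pi.2 fun j => by
            simp only [F, div_eq_mul_inv]
            exact (hf j).contDiffAt.mul (hg.contDiffAt.inv hx)
        obtain ⟨K, s, hs, hK⟩ := hF.exists_lipschitzOnWith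
        exact ⟨K, s, mem_nhdsWithin_of_mem_nhds hs, hK⟩
      · rw [Real.dimH_univ_pi_fin]
    refine hle.trans_lt ?_
    rw [Module.finrank_pi_fintype]
    simp only [Complex.finrank_real_complex, Finset.sum_const, Finset.card_univ, Fintype.card_fin,
      smul_eq_mul]
    exact_mod_cast (by omega : n < p * 2)
  obtain ⟨c, hc⟩ := (dense_compl_of_dimH_lt_finrank hdim).nonempty
  refine ⟨-c, fun t => ?_⟩
  obtain ⟨x, rfl⟩ := hπ t
  by_cases hx : g (π x) = 0
  · simpa [hx] using h _ hx
  · by_contra! h0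
    refine hc ⟨x, hx, funext fun j => ?_⟩
    have := h0 j
    simp only [F]
    rw [div_eq_iff hx]
    simp only [Pi.neg_apply] at this
    linear_combination this

lemma mulOp_sum {ι : Type*} (s : Finset ι) (f : ι → C(UnitAddTorus (Fin n), ℂ)) :
    mulOp (∑ j ∈ s, f j) = ∑ j ∈ s, mulOp (f j) := by
  simp [mulOp]

lemma norm_diagShift (k : ℕ) (x : Hn n) : ‖diagShift n k x‖ = ‖x‖ := norm_translation _ _

lemma diagShift_mem (k : ℕ) : diagShift n k ∈ Toeplitz n := shiftPolynomials_le (translation_mem _)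

/-- Symbols without common zeros make the operators jointly bounded below far from the boundary. -/
lemma exists_norm_le_sum {ι : Type*} [Fintype ι] {a : ι → Hn n →L[ℂ] Hn n}
    {f : ι → C(UnitAddTorus (Fin n), ℂ)} (hf : ∀ j, HasSymbol (a j) (f j))
    (h0 : ∀ t, ∃ j, f j t ≠ 0) :
    ∃ (k : ℕ) (C : ℝ), 0 < C ∧ ∀ x, ‖x‖ ≤ C * ∑ j, ‖a j (diagShift n k x)‖ := by
  choose d hd using fun j => (hf j).absorbs
  have hs (x : Hn n) (j : ι) : hardy n (a j (diagShift n (∑ j, d j) x)) =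
      mulOp (f j) (hardy n (diagShift n (∑ j, d j) x)) := by
    have := (hd j (∑ j, d j - d j)).2 x
    rwa [Nat.sub_add_cancel (Finset.single_le_sum (fun _ _ => Nat.zero_le _)
      (Finset.mem_univ j))] at this
  have hpos (t : UnitAddTorus (Fin n)) : (∑ j, conj (f j t) * f j t) ≠ 0 := by
    have : ∑ j, conj (f j t) * f j t = ((∑ j, ‖f j t‖ ^ 2 : ℝ) : ℂ) := by
      push_cast
      exact Finset.sum_congr rfl fun j _ => by rw [RCLike.conj_mul]; rfl
    rw [this]
    obtain ⟨j, hj⟩ := h0 t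
    have : 0 < ∑ j, ‖f j t‖ ^ 2 :=
      Finset.sum_pos' (fun _ _ => by positivity) ⟨j, Finset.mem_univ _, by positivity⟩
    exact_mod_cast this.ne'
  let h : ι → C(UnitAddTorus (Fin n), ℂ) := fun j =>
    ⟨fun t => conj (f j t) / ∑ j, conj (f j t) * f j t, by
      refine Continuous.div ?_ ?_ hpos
      · exact Complex.continuous_conj.comp (f j).continuous
      · exact continuous_finsetSum _ fun j _ =>
          (Complex.continuous_conj.comp (f j).continuous).mul (f j).continuous⟩
  have hsum : ∑ j, mulOp (h j) * mulOp (f j) = 1 := by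
    have : ∑ j, h j * f j = algebraMap ℂ _ 1 := by
      ext t
      simp only [ContinuousMap.sum_apply, ContinuousMap.mul_apply, h, ContinuousMap.coe_mk,
        div_mul_eq_mul_div]
      rw [← Finset.sum_div, div_self (hpos t)]
      simp
    simp only [← mulOp_mul]
    rw [← mulOp_sum, this, mulOp_algebraMap, one_smul]
  refine ⟨∑ j, d j, 1 + ∑ j, ‖mulOp (h j)‖, by positivity, fun x => ?_⟩
  set y := diagShift n (∑ j, d j) x with hy
  calc ‖x‖ = ‖hardy n y‖ := by rw [LinearIsometry.norm_map, norm_diagShift]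
    _ = ‖∑ j, mulOp (h j) (mulOp (f j) (hardy n y))‖ := by
        congr 1
        have := congrArg (fun A : _ →L[ℂ] _ => A (hardy n y)) hsum
        simpa using this.symm
    _ ≤ ∑ j, ‖mulOp (h j) (mulOp (f j) (hardy n y))‖ := norm_sum_le _ _
    _ ≤ ∑ j, (1 + ∑ j, ‖mulOp (h j)‖) * ‖a j y‖ := by
        refine Finset.sum_le_sum fun j _ => ?_
        rw [← hs, ← (hardy n).norm_map (a j y)]
        refine (ContinuousLinearMap.le_opNorm _ _).trans ?_
        gcongr
        have := Finset.single_le_sum (f := fun j => ‖mulOp (h j)‖) (fun _ _ => norm_nonneg _)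
          (Finset.mem_univ j)
        linarith
    _ = _ := by rw [Finset.mul_sum]

/-- In the Toeplitz algebra, a family that is jointly bounded below is left unimodular. -/
lemma exists_sum_mul_eq_one {ι : Type*} [Fintype ι] (A : ι → ↥(Toeplitz n)) {C : ℝ} (hC : 0 < C)
    (h : ∀ x, ‖x‖ ≤ C * ∑ j, ‖(A j : Hn n →L[ℂ] Hn n) x‖) :
    ∃ b : ι → ↥(Toeplitz n), ∑ j, b j * A j = 1 := by
  have hclosed : IsClosed (Toeplitz n : Set (Hn n →L[ℂ] Hn n)) :=
    StarSubalgebra.isClosed_topologicalClosure _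
  have hunit : IsUnit (∑ j, star (A j) * A j) := by
    rw [← StarSubalgebra.coe_isUnit (hS := hclosed)]
    have hc : 0 < (C ^ 2 * (Fintype.card ι + 1))⁻¹ := by positivity
    refine ContinuousLinearMap.isUnit_of_forall_le_norm_inner_map _ (c := ⟨_, hc.le⟩) hc
      fun x => ?_
    have hinner : inner ℂ (((∑ j, star (A j) * A j : ↥(Toeplitz n)) : Hn n →L[ℂ] Hn n) x) x =
        ((∑ j, ‖(A j : Hn n →L[ℂ] Hn n) x‖ ^ 2 : ℝ) : ℂ) := by
      simp [ContinuousLinearMap.star_eq_adjoint, ContinuousLinearMap.adjoint_inner_left,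
        inner_self_eq_norm_sq_to_K]
    rw [hinner, Complex.norm_real, Real.norm_of_nonneg (by positivity)]
    show ‖x‖ ^ 2 * (C ^ 2 * (Fintype.card ι + 1))⁻¹ ≤ _
    rw [mul_inv_le_iff₀ (by positivity)]
    calc ‖x‖ ^ 2 ≤ (C * ∑ j, ‖(A j : Hn n →L[ℂ] Hn n) x‖) ^ 2 := by
          gcongr
          exact h x
      _ ≤ C ^ 2 * (Fintype.card ι * ∑ j, ‖(A j : Hn n →L[ℂ] Hn n) x‖ ^ 2) := by
          rw [mul_pow]
          gcongr
          exact sq_sum_le_card_mul_sum_sq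
      _ ≤ _ := by
          have : 0 ≤ C ^ 2 * ∑ j, ‖(A j : Hn n →L[ℂ] Hn n) x‖ ^ 2 := by positivity
          linarith
  obtain ⟨u, hu⟩ := hunit
  refine ⟨fun j => ↑u⁻¹ * star (A j), ?_⟩
  simp only [mul_assoc]
  rw [← Finset.mul_sum, ← hu, Units.inv_mul]

section Columns

open Matrix

variable {R S ι : Type*} [Ring R] [Ring S] [Fintype ι] [DecidableEq ι]

/-- Two columns are equivalent if an invertible matrix carries one to the other. -/
def ColEquiv (v w : ι → R) : Prop :=
  ∃ g : (Matrix ι ι R)ˣ, (g : Matrix ι ι R) *ᵥ v = w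

/-- A column is left unimodular if its entries generate the unit left ideal. -/
def IsUnimodular (v : ι → R) : Prop := ∃ u : ι → R, u ⬝ᵥ v = 1

lemma ColEquiv.trans {v w x : ι → R} (h : ColEquiv v w) (h' : ColEquiv w x) : ColEquiv v x := by
  obtain ⟨g, rfl⟩ := h
  obtain ⟨g', rfl⟩ := h'
  exact ⟨g' * g, by rw [Units.val_mul, mulVec_mulVec]⟩

lemma ColEquiv.map (φ : R →+* S) {v w : ι → R} (h : ColEquiv v w) :
    ColEquiv (φ ∘ v) (φ ∘ w) := by
  obtain ⟨g, rfl⟩ := h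
  refine ⟨Units.map (RingHom.toMonoidHom φ.mapMatrix) g, ?_⟩
  ext i
  exact (RingHom.map_mulVec φ _ v i).symm

lemma IsUnimodular.of_colEquiv {v w : ι → R} (hv : IsUnimodular v) (h : ColEquiv v w) :
    IsUnimodular w := by
  obtain ⟨g, rfl⟩ := h
  obtain ⟨u, hu⟩ := hv
  refine ⟨u ᵥ* (g⁻¹ : (Matrix ι ι R)ˣ).val, ?_⟩
  rw [← dotProduct_mulVec, mulVec_mulVec, ← Units.val_mul, inv_mul_cancel, Units.val_one,
    one_mulVec, hu]

/-- Adding `x` times a left combination of the entries of a column is invertible if the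
combination annihilates `x`. -/
lemma colEquiv_add_mul {r x : ι → R} (h : r ⬝ᵥ x = 0) (v : ι → R) :
    ColEquiv v (v + fun i => x i * (r ⬝ᵥ v)) := by
  have hsq : vecMulVec x r * vecMulVec x r = 0 := by
    ext i j
    have : ∑ k, x i * r k * (x k * r j) = x i * (r ⬝ᵥ x) * r j := by
      simp [dotProduct, Finset.mul_sum, Finset.sum_mul, mul_assoc]
    simp [mul_apply, vecMulVec_apply, this, h]
  refine ⟨⟨1 + vecMulVec x r, 1 - vecMulVec x r, ?_, ?_⟩, ?_⟩
  · rw [add_mul, mul_sub, mul_sub, hsq]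
    simp
  · rw [sub_mul, mul_add, mul_add, hsq]
    simp
  · ext i
    rw [Units.val_mk, add_mulVec, one_mulVec]
    simp [mulVec, vecMulVec_apply, dotProduct, Finset.mul_sum, mul_assoc]

lemma colEquiv_single_of_isometry {κ : Type*} [Fintype κ] [DecidableEq κ] {v : Option κ → R}
    (hv : IsUnimodular v) (i : κ) {w w' : R} (hw : w' * w = 1) (hi : w' * v (some i) = 0) :
    ColEquiv v (Pi.single none 1) := by
  obtain ⟨u, hu⟩ := hv
  have hadd : ColEquiv v (v + Pi.single (some i) w) := by
    have hr : Function.update u (some i) (u (some i) * (1 - w * w')) ⬝ᵥ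
        Pi.single (some i) w = 0 := by
      simp [mul_assoc, sub_mul, hw]
    have hr' : Function.update u (some i) (u (some i) * (1 - w * w')) ⬝ᵥ v = 1 := by
      refine Eq.trans (Finset.sum_congr rfl fun j _ => ?_) hu
      by_cases hj : j = some i
      · subst hj
        simp [mul_assoc, sub_mul, hi]
      · simp [hj]
    have := colEquiv_add_mul hr v
    simpa [hr'] using this
  set v₁ := v + Pi.single (some i) w with hv₁
  have hw₁ : w' * v₁ (some i) = 1 := by simp [hv₁, mul_add, hi, hw]
  have hnone : ColEquiv v₁ (v₁ + Pi.single none (1 - v₁ none)) := by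
    have hr : Pi.single (some i) w' ⬝ᵥ (Pi.single none (1 - v₁ none) : Option κ → R) = 0 := by
      simp
    have := colEquiv_add_mul hr v₁
    simpa [hw₁] using this
  set v₂ := v₁ + Pi.single none (1 - v₁ none) with hv₂
  have hn : v₂ none = 1 := by simp [hv₂]
  have hclear : ColEquiv v₂ (Pi.single none 1) := by
    have hr : Pi.single none 1 ⬝ᵥ (Pi.single none 1 - v₂) = 0 := by
      simp [hn]
    convert colEquiv_add_mul hr v₂ using 1
    ext1 j
    simp [hn]
  exact hadd.trans (hnone.trans hclear)

end Columns

open scoped Matrix.Norms.Operator in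
lemma eventually_isUnit_matrix {R ι : Type*} [NormedRing R] [CompleteSpace R] [Fintype ι]
    [DecidableEq ι] : ∀ᶠ M : Matrix ι ι R in 𝓝 1, IsUnit M := by
  have h : @CompleteSpace (Matrix ι ι R) (Matrix.linftyOpNormedRing).toMetricSpace.toUniformSpace :=
    inferInstanceAs (@CompleteSpace (ι → ι → R) _)
  have : HasSummableGeomSeries (Matrix ι ι R) := @instHasSummableGeomSeriesOfCompleteSpace _ _ h
  exact Units.isOpen.mem_nhds isUnit_one

/-- Small perturbations of a lift of a unimodular column do not change its class. -/
lemma eventually_colEquiv {ι : Type*} [Fintype ι] [DecidableEq ι] {V : ι → ↥(Toeplitz n)}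
    (hV : IsUnimodular (quot n ∘ V)) :
    ∀ᶠ V' in 𝓝 V, ColEquiv (quot n ∘ V) (quot n ∘ V') := by
  obtain ⟨u, hu⟩ := hV
  choose U hU using fun j => quot_surjective (u j)
  have hclosed : IsClosed (Toeplitz n : Set (Hn n →L[ℂ] Hn n)) :=
    StarSubalgebra.isClosed_topologicalClosure _
  have : CompleteSpace ↥(Toeplitz n) := hclosed.completeSpace_coe
  have hcont : Continuous fun V' : ι → ↥(Toeplitz n) => 1 + Matrix.vecMulVec (V' - V) U := by
    fun_prop
  have hlim := hcont.tendsto V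
  simp only [sub_self, Matrix.zero_vecMulVec, add_zero] at hlim
  filter_upwards [hlim.eventually eventually_isUnit_matrix] with V' hV'
  obtain ⟨g, hg⟩ := hV'
  refine ⟨Units.map (RingHom.toMonoidHom (quot n).mapMatrix) g, ?_⟩
  ext i
  have : ((Units.map (RingHom.toMonoidHom (quot n).mapMatrix) g :
      (Matrix ι ι (QuantumSphere n))ˣ) : Matrix ι ι (QuantumSphere n)) =
      1 + Matrix.vecMulVec (fun i => quot n (V' i) - quot n (V i)) u := by
    rw [Units.coe_map, hg]
    ext i j
    simp [Matrix.vecMulVec_apply, hU, Matrix.one_apply, apply_ite]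
  rw [this, Matrix.add_mulVec, Matrix.one_mulVec]
  have hu' : (Matrix.vecMulVec (fun i => quot n (V' i) - quot n (V i)) u).mulVec (quot n ∘ V) i =
      (quot n (V' i) - quot n (V i)) * (u ⬝ᵥ (quot n ∘ V)) := by
    simp [Matrix.mulVec, dotProduct, Matrix.vecMulVec_apply, Finset.mul_sum, mul_assoc]
  rw [Pi.add_apply, hu', hu]
  simp

lemma dense_shiftPolynomials :
    Dense {a : ↥(Toeplitz n) | (a : Hn n →L[ℂ] Hn n) ∈ shiftPolynomials n} := by
  intro a
  rw [closure_subtype]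
  have ha : (a : Hn n →L[ℂ] Hn n) ∈ closure (shiftPolynomials n : Set (Hn n →L[ℂ] Hn n)) := a.2
  convert! ha
  ext x
  exact ⟨fun ⟨y, hy, hx⟩ => hx ▸ hy, fun hx => ⟨⟨x, shiftPolynomials_le hx⟩, hx, rfl⟩⟩

/-- The diagonal shift `W^k` as an element of the Toeplitz algebra. -/
def toeplitzShift (n k : ℕ) : ↥(Toeplitz n) := ⟨diagShift n k, diagShift_mem k⟩

lemma star_toeplitzShift_mul_self (k : ℕ) : star (toeplitzShift n k) * toeplitzShift n k = 1 :=
  Subtype.ext (star_translation_mul_self _)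

/-- A unimodular column of length `p + 1` with `n < 2p` can be brought to a form in which all
entries but one have lifts that vanish far from the boundary. -/
lemma exists_colEquiv_mul_toeplitzShift_eq_zero [NeZero n] {p : ℕ} (hp : n < 2 * p)
    {v : Option (Fin p) → QuantumSphere n} (hv : IsUnimodular v) :
    ∃ (k : ℕ) (V : Option (Fin p) → ↥(Toeplitz n)), ColEquiv v (quot n ∘ V) ∧
      ∀ j, V (some j) * toeplitzShift n k = 0 := by
  choose V₀ hV₀ using fun j => quot_surjective (v j)
  obtain rfl : quot n ∘ V₀ = v := funext hV₀
  obtain ⟨V, hpoly, hV⟩ := (dense_pi Set.univ fun _ _ => dense_shiftPolynomials).inter_nhds_nonempty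
    (eventually_colEquiv hv)
  obtain ⟨u, hu⟩ := hv.of_colEquiv hV
  choose U hU using fun j => quot_surjective (u j)
  choose f hf using fun j => exists_hasSymbol (hpoly j (Set.mem_univ j))
  have hne (t : UnitAddTorus (Fin n)) : ∃ j, f j t ≠ 0 :=
    exists_symbol_ne_zero (U := U) hf (by simpa [hU, dotProduct] using hu) t
  obtain ⟨c, hc⟩ := exists_add_smul_ne_zero hp (f := fun j => f (some j)) (g := f none)
    (fun j => (hf _).contDiff) (hf _).contDiff (fun t ht => by
      obtain ⟨_ | j, hj⟩ := hne t
      · exact absurd ht hj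
      · exact ⟨j, hj⟩)
  let A : Fin p → ↥(Toeplitz n) := fun j => V (some j) + algebraMap ℂ _ (c j) * V none
  have hA (j : Fin p) : HasSymbol (A j : Hn n →L[ℂ] Hn n)
      (f (some j) + algebraMap ℂ _ (c j) * f none) :=
    (hf _).add ((hasSymbol_algebraMap (c j)).mul (hf none))
  obtain ⟨k, C, hC, hbound⟩ := exists_norm_le_sum hA (fun t => by simpa using hc t)
  obtain ⟨b', hb'⟩ := exists_sum_mul_eq_one (fun j => A j * toeplitzShift n k) hC hbound
  obtain ⟨b, hb⟩ : ∃ b : Fin p → ↥(Toeplitz n),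
      (∑ j, b j * A j) * toeplitzShift n k = toeplitzShift n k := by
    refine ⟨fun j => toeplitzShift n k * b' j, ?_⟩
    conv_rhs => rw [← mul_one (toeplitzShift n k), ← hb', Finset.mul_sum]
    simp only [Finset.sum_mul, mul_assoc]
  have hadd : ColEquiv V (fun i => i.elim (V none) A) := by
    have hr : Pi.single none 1 ⬝ᵥ (fun i : Option (Fin p) =>
        i.elim 0 fun j => algebraMap ℂ ↥(Toeplitz n) (c j)) = 0 := by
      simp
    convert colEquiv_add_mul hr V using 1
    ext1 i
    cases i <;> simp [A]
  let B : ↥(Toeplitz n) := V none + (1 - V none) * ∑ j, b j * A j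
  have hB : B * toeplitzShift n k = toeplitzShift n k := by
    simp only [B, add_mul, mul_assoc, hb, sub_mul, one_mul]
    abel
  have hnone : ColEquiv (fun i : Option (Fin p) => i.elim (V none) A) (fun i => i.elim B A) := by
    have hr : (fun i : Option (Fin p) => i.elim 0 b) ⬝ᵥ Pi.single none (1 - V none) = 0 := by
      simp
    convert colEquiv_add_mul hr _ using 1
    ext1 i
    cases i <;> simp [B, dotProduct]
  have hclear : ColEquiv (fun i : Option (Fin p) => i.elim B A)
      (fun i => i.elim B fun j => A j - A j * B) := by
    have hr : Pi.single none 1 ⬝ᵥ (fun i : Option (Fin p) => i.elim 0 fun j => -A j) = 0 := by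
      simp
    convert colEquiv_add_mul hr _ using 1
    ext1 i
    cases i <;> simp [sub_eq_add_neg]
  refine ⟨k, _, hV.trans ((hadd.trans (hnone.trans hclear)).map (quot n)), fun j => ?_⟩
  simp [sub_mul, mul_assoc, hB]

lemma exists_star_diagShift_mul {a : Hn n →L[ℂ] Hn n} (ha : a ∈ shiftPolynomials n) (k : ℕ) :
    ∃ (m : ℕ) (a' : Hn n →L[ℂ] Hn n), star (diagShift n m) * a = a' * star (diagShift n k) := by
  obtain ⟨f, hf⟩ := exists_hasSymbol (star_mem ha)
  obtain ⟨d, hd⟩ := hf.absorbs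
  obtain ⟨a', ha'⟩ := (hd k).1
  refine ⟨k + d, star a', ?_⟩
  rw [← star_mul, ← ha', star_mul, star_star]

theorem colEquiv_single_of_isUnimodular [NeZero n] {p : ℕ} (hp : n < 2 * p)
    {v : Option (Fin p) → QuantumSphere n} (hv : IsUnimodular v) :
    ColEquiv v (Pi.single none 1) := by
  obtain ⟨k, V, hV, hzero⟩ := exists_colEquiv_mul_toeplitzShift_eq_zero hp hv
  let i : Fin p := ⟨0, by omega⟩
  set q : ↥(Toeplitz n) := 1 - toeplitzShift n k * star (toeplitzShift n k) with hq
  have hVq : V (some i) * q = V (some i) := by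
    rw [hq, mul_sub, ← mul_assoc, hzero]
    simp
  have hev : ∀ᶠ a in 𝓝 (V (some i)),
      ColEquiv (quot n ∘ V) (quot n ∘ Function.update V (some i) (a * q)) := by
    have hcont : Continuous fun a : ↥(Toeplitz n) => Function.update V (some i) (a * q) := by
      fun_prop
    have hlim := hcont.tendsto (V (some i))
    simp only [hVq, Function.update_eq_self] at hlim
    exact hlim.eventually (eventually_colEquiv (hv.of_colEquiv hV))
  obtain ⟨a, ha, hVa⟩ := dense_shiftPolynomials.inter_nhds_nonempty hev
  obtain ⟨m, a', ha'⟩ := exists_star_diagShift_mul ha k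
  have hstar : star (toeplitzShift n m) * (a * q) = 0 := by
    apply Subtype.ext
    have hkq : star (diagShift n k) * (q : Hn n →L[ℂ] Hn n) = 0 := by
      have : star (toeplitzShift n k) * q = 0 := by
        rw [hq, mul_sub, ← mul_assoc, star_toeplitzShift_mul_self]
        simp
      exact congrArg Subtype.val this
    change star (diagShift n m) * (a * q : Hn n →L[ℂ] Hn n) = 0
    rw [← mul_assoc, ha', mul_assoc, hkq, mul_zero]
  have htrans := hV.trans hVa
  refine htrans.trans (colEquiv_single_of_isometry (hv.of_colEquiv htrans) i
    (w := quot n (toeplitzShift n m)) (w' := quot n (star (toeplitzShift n m))) ?_ ?_)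
  · rw [← map_mul, star_toeplitzShift_mul_self, map_one]
  · simp only [Function.comp, Function.update_self, ← map_mul, hstar, map_zero]

section Idempotents

open Matrix

variable {R : Type*} [Ring R]

/-- `P` factors as `X * Y` with `Y * X` the identity matrix of index type `κ`, so that the module
defined by `P` is free with basis indexed by `κ`. -/
def IsFreeIdem {ι : Type*} (κ : Type*) [Fintype ι] [Fintype κ] [DecidableEq κ]
    (P : Matrix ι ι R) : Prop :=
  ∃ (X : Matrix ι κ R) (Y : Matrix κ ι R), X * Y = P ∧ Y * X = 1

lemma padMat_eq_mul {ι : Type*} [Fintype ι] {N : ℕ} (f : ι ↪ Fin N) (P : Matrix ι ι R) :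
    padMat f P = (1 : Matrix (Fin N) (Fin N) R).submatrix id f * P *
      (1 : Matrix (Fin N) (Fin N) R).submatrix f id := by
  ext i j
  simp only [padMat, mul_apply, submatrix_apply, one_apply, id, ite_mul, one_mul,
    zero_mul, mul_ite, mul_one, mul_zero, ite_and]
  rw [Finset.sum_comm]
  refine Finset.sum_congr rfl fun b _ => ?_
  split_ifs <;> simp [eq_comm]

lemma isFreeIdem_of_idemEquiv {ι κ : Type*} [Fintype ι] [Fintype κ] [DecidableEq ι]
    [DecidableEq κ] {P : Matrix ι ι R}
    (hP : P * P = P) (h : IdemEquiv P (1 : Matrix κ κ R)) : IsFreeIdem κ P := by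
  obtain ⟨N, f, g, U, hU⟩ := h
  rw [padMat_eq_mul, padMat_eq_mul, Matrix.mul_one] at hU
  have hf : (1 : Matrix (Fin N) (Fin N) R).submatrix f id *
      (1 : Matrix (Fin N) (Fin N) R).submatrix id f = 1 := by
    rw [← submatrix_mul _ _ f id f Function.bijective_id, Matrix.mul_one, submatrix_one_embedding]
  have hg : (1 : Matrix (Fin N) (Fin N) R).submatrix g id *
      (1 : Matrix (Fin N) (Fin N) R).submatrix id g = 1 := by
    rw [← submatrix_mul _ _ g id g Function.bijective_id, Matrix.mul_one, submatrix_one_embedding]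
  generalize (1 : Matrix (Fin N) (Fin N) R).submatrix f id = F' at *
  generalize (1 : Matrix (Fin N) (Fin N) R).submatrix id f = F at *
  generalize (1 : Matrix (Fin N) (Fin N) R).submatrix g id = G' at *
  generalize (1 : Matrix (Fin N) (Fin N) R).submatrix id g = G at *
  have hU' : (U⁻¹).val * (G * (G' * U.val)) = F * P * F' := by
    rw [← Matrix.mul_assoc G, ← hU]
    simp [← Matrix.mul_assoc]
  refine ⟨P * F' * (U⁻¹).val * G, G' * U.val * F * P, ?_, ?_⟩
  · calc P * F' * (U⁻¹).val * G * (G' * U.val * F * P)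
        = P * F' * ((U⁻¹).val * (G * (G' * U.val))) * F * P := by simp only [Matrix.mul_assoc]
      _ = P * (F' * F) * P * (F' * F) * P := by rw [hU']; simp only [Matrix.mul_assoc]
      _ = P := by simp [hf, hP]
  · calc G' * U.val * F * P * (P * F' * (U⁻¹).val * G)
        = G' * (U.val * (F * (P * P) * F') * (U⁻¹).val) * G := by simp only [Matrix.mul_assoc]
      _ = (G' * G) * (G' * G) := by rw [hP, hU]; simp only [Matrix.mul_assoc]
      _ = 1 := by simp [hg]

lemma padMat_apply {ι : Type*} [Fintype ι] [DecidableEq ι] {N : ℕ} (f : ι ↪ Fin N)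
    (P : Matrix ι ι R) (a b : ι) : padMat f P (f a) (f b) = P a b := by
  simp [padMat, ite_and]

lemma padMat_of_notMem_left {ι : Type*} [Fintype ι] {N : ℕ} (f : ι ↪ Fin N)
    (P : Matrix ι ι R) {i : Fin N} (hi : ∀ a, f a ≠ i) (j : Fin N) : padMat f P i j = 0 := by
  simp [padMat, hi]

lemma padMat_of_notMem_right {ι : Type*} [Fintype ι] {N : ℕ} (f : ι ↪ Fin N)
    (P : Matrix ι ι R) (i : Fin N) {j : Fin N} (hj : ∀ a, f a ≠ j) : padMat f P i j = 0 := by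
  simp [padMat, hj]

lemma idemEquiv_of_isFreeIdem {k m : ℕ} {P : Matrix (Fin k) (Fin k) R}
    (h : IsFreeIdem (Fin m) P) : IdemEquiv P (1 : Matrix (Fin m) (Fin m) R) := by
  obtain ⟨X, Y, rfl, hYX⟩ := h
  have hX : X * Y * X = X := by rw [Matrix.mul_assoc, hYX, Matrix.mul_one]
  have hY : Y * (X * Y) = Y := by rw [← Matrix.mul_assoc, hYX, Matrix.one_mul]
  have hP : X * Y * (X * Y) = X * Y := by rw [← Matrix.mul_assoc, hX]
  let M : Matrix (Fin k ⊕ Fin m) (Fin k ⊕ Fin m) R := fromBlocks (1 - X * Y) X Y 0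
  have hMM : M * M = 1 := by
    simp [M, fromBlocks_multiply, Matrix.sub_mul, Matrix.mul_sub, hX, hY, hP, hYX]
  let e : Fin (k + m) ≃ Fin k ⊕ Fin m := finSumFinEquiv.symm
  have hM' : M.submatrix e e * M.submatrix e e = 1 := by
    rw [submatrix_mul_equiv, hMM, submatrix_one_equiv]
  have hne (a : Fin m) (b : Fin k) : Fin.natAddEmb k a ≠ finSumFinEquiv (Sum.inl b) := by
    simp [Fin.ext_iff]
    omega
  have hne' (a : Fin k) (b : Fin m) : Fin.castAddEmb m a ≠ finSumFinEquiv (Sum.inr b) := by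
    simp [Fin.ext_iff]
    omega
  have hpadP : padMat (Fin.castAddEmb m) (X * Y) = (fromBlocks (X * Y) 0 0 0).submatrix e e := by
    ext i j
    obtain ⟨i | i, rfl⟩ := finSumFinEquiv.surjective i <;>
    obtain ⟨j | j, rfl⟩ := finSumFinEquiv.surjective j
    · simpa [e] using padMat_apply (Fin.castAddEmb m) (X * Y) i j
    · simpa [e] using padMat_of_notMem_right _ _ _ (hne' · j)
    · simpa [e] using padMat_of_notMem_left _ _ (hne' · i) _
    · simpa [e] using padMat_of_notMem_left _ _ (hne' · i) _
  have hpad1 : padMat (Fin.natAddEmb k) (1 : Matrix (Fin m) (Fin m) R) =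
      (fromBlocks 0 0 0 1).submatrix e e := by
    ext i j
    obtain ⟨i | i, rfl⟩ := finSumFinEquiv.surjective i <;>
    obtain ⟨j | j, rfl⟩ := finSumFinEquiv.surjective j
    · simpa [e] using padMat_of_notMem_left _ _ (hne · i) _
    · simpa [e] using padMat_of_notMem_left _ _ (hne · i) _
    · simpa [e] using padMat_of_notMem_right _ _ _ (hne · j)
    · simpa [e] using padMat_apply (Fin.natAddEmb k) (1 : Matrix (Fin m) (Fin m) R) i j
  refine ⟨k + m, Fin.castAddEmb m, Fin.natAddEmb k, ⟨_, _, hM', hM'⟩, ?_⟩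
  rw [hpadP, hpad1]
  simp [submatrix_mul_equiv, M, fromBlocks_multiply, Matrix.sub_mul, Matrix.mul_sub, hY, hP, hYX]

lemma isFreeIdem_of_option {α β : Type*} [Fintype α] [Fintype β] [DecidableEq α] [DecidableEq β]
    (hcol : ∀ v : Option β → R, IsUnimodular v → ColEquiv v (Pi.single none 1))
    {P : Matrix (Option α) (Option α) R} (h00 : P none none = 1)
    (h10 : ∀ a, P (some a) none = 0)
    (hP : IsFreeIdem (Option β) P) : IsFreeIdem β (P.submatrix some some) := by
  obtain ⟨X, Y, hXY, hYX⟩ := hP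
  obtain ⟨g, hg⟩ := hcol (fun j => Y j none) ⟨fun j => X none j, by
    rw [← h00, ← hXY]; rfl⟩
  set X' := X * (g⁻¹).val with hX'
  set Y' := g.val * Y with hY'
  have hXY' : X' * Y' = P := by
    rw [hX', hY', Matrix.mul_assoc, ← Matrix.mul_assoc _ g.val, ← Units.val_mul, inv_mul_cancel,
      Units.val_one, Matrix.one_mul, hXY]
  have hYX' : Y' * X' = 1 := by
    rw [hX', hY', Matrix.mul_assoc, ← Matrix.mul_assoc Y, hYX, Matrix.one_mul, ← Units.val_mul,
      mul_inv_cancel, Units.val_one]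
  have hYn (j : Option β) : Y' j none = (Pi.single none 1 : Option β → R) j := congrFun hg j
  have hXn (a : α) : X' (some a) none = 0 := by
    have := congrFun (congrFun hXY' (some a)) none
    simpa [mul_apply, hYn, h10] using this
  refine ⟨X'.submatrix some some, Y'.submatrix some some, ?_, ?_⟩
  · ext a b
    have := congrFun (congrFun hXY' (some a)) (some b)
    simpa [mul_apply, hXn] using this
  · ext a b
    have := congrFun (congrFun hYX' (some a)) (some b)
    simpa [mul_apply, hYn, one_apply] using this

lemma IsFreeIdem.submatrix {ι ι' κ κ' : Type*} [Fintype ι] [Fintype ι'] [Fintype κ] [Fintype κ']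
    [DecidableEq κ] [DecidableEq κ'] {P : Matrix ι ι R} (h : IsFreeIdem κ P) (e : ι' ≃ ι)
    (d : κ' ≃ κ) : IsFreeIdem κ' (P.submatrix e e) := by
  obtain ⟨X, Y, rfl, hYX⟩ := h
  exact ⟨X.submatrix e d, Y.submatrix d e, by rw [submatrix_mul_equiv],
    by rw [submatrix_mul_equiv, hYX, submatrix_one_equiv]⟩

/-- Splitting off the first element of the second summand. -/
def optionSumFinEquiv (α : Type*) (r : ℕ) : Option (α ⊕ Fin r) ≃ α ⊕ Fin (r + 1) where
  toFun x := x.elim (Sum.inr 0) (Sum.map id Fin.succ)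
  invFun := Sum.elim (fun a => some (Sum.inl a)) (Fin.cases none fun j => some (Sum.inr j))
  left_inv := by rintro (_ | _ | _) <;> rfl
  right_inv := by
    rintro (_ | j)
    · rfl
    · cases j using Fin.cases <;> rfl

theorem isFreeIdem_of_stably {k m r : ℕ}
    (hcol : ∀ p, m ≤ p → ∀ v : Option (Fin p) → R, IsUnimodular v →
      ColEquiv v (Pi.single none 1))
    {P : Matrix (Fin k) (Fin k) R}
    (h : IsFreeIdem (Fin (m + r)) (fromBlocks P 0 0 (1 : Matrix (Fin r) (Fin r) R))) :
    IsFreeIdem (Fin m) P := by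
  induction r with
  | zero =>
    convert! h.submatrix (Equiv.sumEmpty (Fin k) (Fin 0)).symm (Equiv.refl _)
  | succ r ih =>
    refine ih ?_
    have h' := h.submatrix (optionSumFinEquiv (Fin k) r) (finSuccEquiv (m + r)).symm
    convert! isFreeIdem_of_option (hcol (m + r) (by omega)) ?_ ?_ h' using 1
    · ext (i | i) (j | j) <;> simp [optionSumFinEquiv, one_apply]
    · simp [optionSumFinEquiv]
    · rintro (a | a) <;> simp [optionSumFinEquiv, one_apply]

end Idempotents

end QuantumSphereCancellation

theorem stmt7 (n : ℕ) (hn : 1 ≤ n) (m : ℕ) (hm : (n - 1) / 2 + 3 ≤ m)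
    (k : ℕ) (P : Matrix (Fin k) (Fin k) (QuantumSphere n)) (hP : P * P = P)
    (r : ℕ)
    (hstab : IdemEquiv
      (Matrix.fromBlocks P 0 0 (1 : Matrix (Fin r) (Fin r) (QuantumSphere n)))
      (1 : Matrix (Fin (m + r)) (Fin (m + r)) (QuantumSphere n))) :
    IdemEquiv P (1 : Matrix (Fin m) (Fin m) (QuantumSphere n)) := by
  have : NeZero n := ⟨by omega⟩
  refine QuantumSphereCancellation.idemEquiv_of_isFreeIdem
    (QuantumSphereCancellation.isFreeIdem_of_stably (r := r)
      (fun p hp v hv => QuantumSphereCancellation.colEquiv_single_of_isUnimodular (by omega) hv)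
      (QuantumSphereCancellation.isFreeIdem_of_idemEquiv ?_ hstab))
  simp [Matrix.fromBlocks_multiply, hP]
end
end
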